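/- arXiv:1704.02887 — 3 statements merged into one kernel-verified Lean document; each statement's English description precedes it below -/
import Mathlib

section
/- Let d ≥ 1, let a₁, …, a_d > 0, let A = diag(a₁, …, a_d) so that X = Aℤ^d is the orthorhombic lattice, and let f ∈ 𝓕 with ∑_{m∈ℤ^d∖{0}} f(Am) < ∞. Define the alternating (rock-salt) configuration φ*(m) = (−1)^{m₁+⋯+m_d}. Then φ* is 2-periodic and satisfies the normalization, and for every integer N ≥ 1 and every N-periodic φ : ℤ^d → ℝ satisfying the normalization, E_{X,f}[φ*] ≤ E_{X,f}[φ]. Moreover, if f is not identically zero on ℝ^d∖{0} and E_{X,f}[φ] = E_{X,f}[φ*], then φ = φ* or φ = −φ* (i.e., the minimizer is unique up to translations by a lattice vector). -/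
open scoped Real BigOperators
open MeasureTheory

open Filter Topology in
theorem exists_pos_le_prod_one_sub_pow {q : ℝ} (hq0 : 0 < q) (hq1 : q < 1) :
    ∃ δ > 0, ∀ n, δ ≤ ∏ i ∈ Finset.range n, (1 - q ^ (i + 1)) := by
  have hlt : ∀ i : ℕ, q ^ (i + 1) < 1 := fun i => pow_lt_one₀ hq0.le hq1 (Nat.succ_ne_zero i)
  have hs : Summable fun i : ℕ => ‖-q ^ (i + 1)‖ := by
    have := (summable_nat_add_iff 1).mpr (summable_geometric_of_lt_one hq0.le hq1)
    simpa [abs_of_pos hq0] using this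
  have hm : Multipliable fun i : ℕ => 1 + -q ^ (i + 1) := multipliable_one_add_of_summable hs
  have hne : ∏' i : ℕ, (1 + -q ^ (i + 1)) ≠ 0 :=
    tprod_one_add_ne_zero_of_summable (fun i => by have := hlt i; linarith) hs
  have ht := hm.hasProd.tendsto_prod_nat
  simp only [← sub_eq_add_neg] at ht hne
  have hanti : Antitone fun n => ∏ i ∈ Finset.range n, (1 - q ^ (i + 1)) := by
    refine antitone_nat_of_succ_le fun n => ?_
    rw [Finset.prod_range_succ]
    refine mul_le_of_le_one_right (Finset.prod_nonneg fun i _ => ?_) ?_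
    · linarith [hlt i]
    · linarith [pow_pos hq0 (n + 1)]
  refine ⟨_, lt_of_le_of_ne ?_ hne.symm, fun n => hanti.le_of_tendsto ht n⟩
  exact ge_of_tendsto' ht fun n => Finset.prod_nonneg fun i _ => by linarith [hlt i]

/-- The reciprocal of `∏_{i=1}^k (1 - p^i)`, extended by zero to negative `k`. -/
noncomputable def qFactInv (p : ℝ) (k : ℤ) : ℝ :=
  if 0 ≤ k then (∏ i ∈ Finset.range k.toNat, (1 - p ^ (i + 1)))⁻¹ else 0

theorem qFactInv_sub_one {p : ℝ} (hp0 : 0 < p) (hp1 : p < 1) (k : ℤ) :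
    qFactInv p (k - 1) = (1 - p ^ k) * qFactInv p k := by
  have hlt : ∀ i : ℕ, 0 < 1 - p ^ (i + 1) := fun i =>
    sub_pos.2 (pow_lt_one₀ hp0.le hp1 (Nat.succ_ne_zero i))
  rcases lt_trichotomy k 0 with hk | rfl | hk
  · simp [qFactInv, not_le.2 hk, show ¬ (1 ≤ k) by omega]
  · simp [qFactInv]
  · obtain ⟨n, rfl⟩ : ∃ n : ℕ, k = n + 1 := ⟨(k - 1).toNat, by omega⟩
    have h1 : ((n : ℤ) + 1).toNat = n + 1 := by omega
    have h2 : (0 : ℤ) ≤ n + 1 := by omega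
    simp only [qFactInv, add_sub_cancel_right, h1, h2, if_true, Int.natCast_nonneg,
      Int.toNat_natCast, Finset.prod_range_succ, mul_inv]
    have := (hlt n).ne'
    rw [show p ^ ((n : ℤ) + 1) = p ^ (n + 1) by exact_mod_cast zpow_natCast p (n + 1)]
    field_simp

theorem qFactInv_nonneg {p : ℝ} (hp0 : 0 < p) (hp1 : p < 1) (k : ℤ) : 0 ≤ qFactInv p k := by
  unfold qFactInv
  split_ifs
  · exact inv_nonneg.2 (Finset.prod_nonneg fun i _ =>
      sub_nonneg.2 (pow_le_one₀ hp0.le hp1.le))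
  · exact le_rfl

open Filter Topology in
theorem exists_tendsto_qFactInv {p : ℝ} (hp0 : 0 < p) (hp1 : p < 1) :
    ∃ G > 0, (∀ k, qFactInv p k ≤ G) ∧ Tendsto (qFactInv p) atTop (𝓝 G) := by
  obtain ⟨δ, hδ, hle⟩ := exists_pos_le_prod_one_sub_pow hp0 hp1
  have hmono : Monotone (qFactInv p) := by
    refine monotone_int_of_le_succ fun k => ?_
    have h := qFactInv_sub_one hp0 hp1 (k + 1)
    rw [add_sub_cancel_right] at h
    have h0 := qFactInv_nonneg hp0 hp1 (k + 1)
    nlinarith [zpow_pos hp0 (k + 1)]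
  have hb : BddAbove (Set.range (qFactInv p)) := by
    refine ⟨δ⁻¹, ?_⟩
    rintro _ ⟨k, rfl⟩
    unfold qFactInv
    split_ifs
    · exact inv_anti₀ hδ (hle _)
    · positivity
  refine ⟨_, ?_, fun k => le_ciSup hb k, tendsto_atTop_ciSup hmono hb⟩
  refine lt_of_lt_of_le one_pos ((le_ciSup hb 0).trans' ?_)
  simp [qFactInv]

/-- The coefficients of the finite form of the Jacobi triple product. -/
noncomputable def tripleCoeff (q : ℝ) (n : ℕ) (m : ℤ) : ℝ :=
  q ^ (m ^ 2) * (∏ i ∈ Finset.range (2 * n), (1 - (q ^ 2) ^ (i + 1))) *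
    qFactInv (q ^ 2) (n + m) * qFactInv (q ^ 2) (n - m)

theorem tripleCoeff_succ {q : ℝ} (hq0 : 0 < q) (hq1 : q < 1) (n : ℕ) (m : ℤ) :
    tripleCoeff q (n + 1) m = (1 + (q ^ (2 * n + 1)) ^ 2) * tripleCoeff q n m +
      q ^ (2 * n + 1) * (tripleCoeff q n (m - 1) + tripleCoeff q n (m + 1)) := by
  have hp0 : 0 < q ^ 2 := by positivity
  have hp1 : q ^ 2 < 1 := pow_lt_one₀ hq0.le hq1 two_ne_zero
  have key := qFactInv_sub_one hp0 hp1
  have e1 : qFactInv (q ^ 2) (n + m) = (1 - (q ^ 2) ^ (n + 1 + m : ℤ)) *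
      qFactInv (q ^ 2) (n + 1 + m) := by rw [← key]; congr 1; ring
  have e2 : qFactInv (q ^ 2) (n - m) = (1 - (q ^ 2) ^ (n + 1 - m : ℤ)) *
      qFactInv (q ^ 2) (n + 1 - m) := by rw [← key]; congr 1; ring
  have e3 : qFactInv (q ^ 2) (n + (m - 1)) = (1 - (q ^ 2) ^ (n + m : ℤ)) *
      qFactInv (q ^ 2) (n + m) := by rw [← key]; congr 1; ring
  have e4 : qFactInv (q ^ 2) (n - (m + 1)) = (1 - (q ^ 2) ^ (n - m : ℤ)) *
      qFactInv (q ^ 2) (n - m) := by rw [← key]; congr 1; ring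
  have e5 : qFactInv (q ^ 2) (n - (m - 1)) = qFactInv (q ^ 2) (n + 1 - m) := by congr 1; ring
  have e6 : qFactInv (q ^ 2) (n + (m + 1)) = qFactInv (q ^ 2) (n + 1 + m) := by congr 1; ring
  have hq : q ≠ 0 := hq0.ne'
  have hprod : ∏ i ∈ Finset.range (2 * (n + 1)), (1 - (q ^ 2) ^ (i + 1)) =
      (∏ i ∈ Finset.range (2 * n), (1 - (q ^ 2) ^ (i + 1))) *
        (1 - (q ^ 2) ^ (2 * n + 1)) * (1 - (q ^ 2) ^ (2 * n + 2)) := by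
    rw [show 2 * (n + 1) = 2 * n + 1 + 1 by ring, Finset.prod_range_succ, Finset.prod_range_succ]
  have m1 : q ^ ((m - 1) ^ 2) = q ^ (m ^ 2) * q / (q ^ m) ^ 2 := by
    rw [show (m - 1) ^ 2 = m ^ 2 + 1 - m * 2 by ring, zpow_sub₀ hq, zpow_add₀ hq, zpow_mul]
    norm_cast; simp
  have m2 : q ^ ((m + 1) ^ 2) = q ^ (m ^ 2) * q * (q ^ m) ^ 2 := by
    rw [show (m + 1) ^ 2 = m ^ 2 + 1 + m * 2 by ring, zpow_add₀ hq, zpow_add₀ hq, zpow_mul]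
    norm_cast; simp
  have z1 : (q ^ 2) ^ (n + m : ℤ) = (q ^ n) ^ 2 * (q ^ m) ^ 2 := by
    rw [zpow_add₀ hp0.ne', zpow_natCast, ← pow_mul, ← pow_mul, mul_comm 2 n]
    congr 1
    rw [← zpow_natCast, ← zpow_natCast, ← zpow_mul, ← zpow_mul, mul_comm]
  have z2 : (q ^ 2) ^ (n - m : ℤ) = (q ^ n) ^ 2 / (q ^ m) ^ 2 := by
    rw [zpow_sub₀ hp0.ne', zpow_natCast, ← pow_mul, ← pow_mul, mul_comm 2 n]
    congr 1
    rw [← zpow_natCast, ← zpow_natCast, ← zpow_mul, ← zpow_mul, mul_comm]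
  have z3 : (q ^ 2) ^ (n + 1 + m : ℤ) = q ^ 2 * ((q ^ n) ^ 2 * (q ^ m) ^ 2) := by
    rw [← z1, add_right_comm, zpow_add_one₀ hp0.ne', mul_comm]
  have z4 : (q ^ 2) ^ (n + 1 - m : ℤ) = q ^ 2 * ((q ^ n) ^ 2 / (q ^ m) ^ 2) := by
    rw [← z2, add_sub_right_comm, zpow_add_one₀ hp0.ne', mul_comm]
  have hm : q ^ m ≠ 0 := zpow_ne_zero _ hq
  simp only [tripleCoeff, hprod, Nat.cast_add, Nat.cast_one]
  rw [e3, e4, e5, e6, e1, e2, m1, m2, z1, z2, z3, z4]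
  generalize qFactInv (q ^ 2) (n + 1 + m) = a
  generalize qFactInv (q ^ 2) (n + 1 - m) = b
  generalize ∏ i ∈ Finset.range (2 * n), (1 - (q ^ 2) ^ (i + 1)) = P
  have k1 : (q ^ 2) ^ (2 * n + 1) = (q ^ n) ^ 4 * q ^ 2 := by ring
  have k2 : (q ^ 2) ^ (2 * n + 2) = (q ^ n) ^ 4 * q ^ 4 := by ring
  have k3 : q ^ (2 * n + 1) = (q ^ n) ^ 2 * q := by ring
  rw [k1, k2, k3]
  generalize q ^ (m ^ 2) = M
  generalize q ^ m = u at *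
  generalize q ^ n = v
  field_simp
  ring

theorem summable_zpow_sq {q : ℝ} (hq0 : 0 < q) (hq1 : q < 1) :
    Summable fun m : ℤ => q ^ (m ^ 2) := by
  have h : Summable fun n : ℕ => q ^ ((n : ℤ) ^ 2) := by
    refine (summable_geometric_of_lt_one hq0.le hq1).of_nonneg_of_le
      (fun n => (zpow_pos hq0 _).le) fun n => ?_
    rw [← Nat.cast_pow, zpow_natCast]
    exact pow_le_pow_of_le_one hq0.le hq1.le (Nat.le_self_pow two_ne_zero n)
  exact Summable.of_nat_of_neg h (by simpa using h)

theorem ofReal_norm_one_add_mul_sq (r : ℝ) {z : ℂ} (hz : ‖z‖ = 1) :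
    ((‖1 + r * z‖ ^ 2 : ℝ) : ℂ) = (1 + r * z) * (1 + r * z⁻¹) := by
  rw [Complex.inv_eq_conj hz]
  push_cast
  rw [← Complex.mul_conj']
  simp

theorem hasSum_tripleCoeff {q : ℝ} (hq0 : 0 < q) (hq1 : q < 1) {z : ℂ} (hz : ‖z‖ = 1) (n : ℕ) :
    HasSum (fun m : ℤ => (tripleCoeff q n m : ℂ) * z ^ m)
      ((∏ k ∈ Finset.range n, ‖1 + (q ^ (2 * k + 1) : ℝ) * z‖ ^ 2 : ℝ) : ℂ) := by
  have hz0 : z ≠ 0 := by rintro rfl; simp at hz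
  induction n with
  | zero =>
    convert hasSum_single (0 : ℤ) fun m hm => ?_ using 1
    · simp [tripleCoeff, qFactInv]
    · rcases lt_or_gt_of_ne hm with h | h
      · simp [tripleCoeff, qFactInv, not_le.2 h]
      · simp [tripleCoeff, qFactInv, not_le.2 h]
  | succ n ih =>
    have h1 := ((Equiv.subRight (1 : ℤ)).hasSum_iff.2 ih).mul_left z
    have h2 := ((Equiv.addRight (1 : ℤ)).hasSum_iff.2 ih).mul_left z⁻¹
    set r : ℝ := q ^ (2 * n + 1) with hr
    have h := (ih.mul_left (1 + (r : ℂ) ^ 2)).add ((h1.add h2).mul_left (r : ℂ))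
    rw [Finset.prod_range_succ, Complex.ofReal_mul, ← hr, ofReal_norm_one_add_mul_sq r hz]
    have hval : ∀ T : ℂ, T * ((1 + r * z) * (1 + r * z⁻¹)) =
        (1 + (r : ℂ) ^ 2) * T + r * (z * T + z⁻¹ * T) := by
      intro T
      field_simp
      ring
    rw [hval]
    refine h.congr_fun fun m => ?_
    have e1 : z * z ^ (m - 1) = z ^ m := by rw [zpow_sub_one₀ hz0]; field_simp
    have e2 : z⁻¹ * z ^ (m + 1) = z ^ m := by rw [zpow_add_one₀ hz0]; field_simp
    simp only [Function.comp, Equiv.subRight_apply, Equiv.coe_addRight]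
    rw [mul_left_comm z, e1, mul_left_comm z⁻¹, e2, tripleCoeff_succ hq0 hq1, ← hr]
    push_cast
    ring

open Filter Topology in
/-- The Jacobi triple product on the unit circle. -/
theorem exists_tendsto_prod_theta {q : ℝ} (hq0 : 0 < q) (hq1 : q < 1) :
    ∃ G > 0, ∀ z : ℂ, ‖z‖ = 1 →
      Tendsto (fun n => ((∏ k ∈ Finset.range n, ‖1 + (q ^ (2 * k + 1) : ℝ) * z‖ ^ 2 : ℝ) : ℂ))
        atTop (𝓝 ((G : ℝ) * ∑' m : ℤ, ((q ^ (m ^ 2) : ℝ) : ℂ) * z ^ m)) := by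
  have hp0 : 0 < q ^ 2 := by positivity
  have hp1 : q ^ 2 < 1 := pow_lt_one₀ hq0.le hq1 two_ne_zero
  obtain ⟨G, hG, hle, hlim⟩ := exists_tendsto_qFactInv hp0 hp1
  refine ⟨G, hG, fun z hz => ?_⟩
  have hP : ∀ n : ℕ, ∏ i ∈ Finset.range n, (1 - (q ^ 2) ^ (i + 1)) = (qFactInv (q ^ 2) n)⁻¹ := by
    intro n; simp [qFactInv]
  have hnn := qFactInv_nonneg hp0 hp1
  rw [← tsum_mul_left]
  simp_rw [← fun n => (hasSum_tripleCoeff hq0 hq1 hz n).tsum_eq]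
  refine tendsto_tsum_of_dominated_convergence
    (bound := fun m : ℤ => q ^ (m ^ 2) * (G * G)) ((summable_zpow_sq hq0 hq1).mul_right _) ?_ ?_
  · intro m
    rw [← mul_assoc, ← Complex.ofReal_mul]
    refine Tendsto.mul_const _ ((Complex.continuous_ofReal.tendsto _).comp ?_)
    have t1 : Tendsto (fun n : ℕ => qFactInv (q ^ 2) ((2 * n : ℕ) : ℤ)) atTop (𝓝 G) :=
      hlim.comp (tendsto_natCast_atTop_atTop.comp
        (tendsto_id.const_mul_atTop' (by norm_num : 0 < 2)))
    have t2 : Tendsto (fun n : ℕ => qFactInv (q ^ 2) (n + m)) atTop (𝓝 G) :=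
      hlim.comp (tendsto_atTop_add_const_right _ _ tendsto_natCast_atTop_atTop)
    have t3 : Tendsto (fun n : ℕ => qFactInv (q ^ 2) (n - m)) atTop (𝓝 G) :=
      hlim.comp (tendsto_atTop_add_const_right _ _ tendsto_natCast_atTop_atTop)
    have := (((t1.inv₀ hG.ne').const_mul (q ^ (m ^ 2))).mul t2).mul t3
    simp only [tripleCoeff, hP]
    convert this using 2
    field_simp
  · refine Eventually.of_forall fun n m => ?_
    rw [norm_mul, norm_zpow, hz, one_zpow, mul_one, Complex.norm_real, Real.norm_eq_abs]
    have hprod0 : 0 ≤ ∏ i ∈ Finset.range (2 * n), (1 - (q ^ 2) ^ (i + 1)) :=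
      Finset.prod_nonneg fun i _ => sub_nonneg.2 (pow_le_one₀ hp0.le hp1.le)
    have hprod1 : ∏ i ∈ Finset.range (2 * n), (1 - (q ^ 2) ^ (i + 1)) ≤ 1 :=
      Finset.prod_le_one (fun i _ => sub_nonneg.2 (pow_le_one₀ hp0.le hp1.le))
        fun i _ => sub_le_self _ (by positivity)
    have hq := (zpow_pos hq0 (m ^ 2)).le
    rw [tripleCoeff, abs_of_nonneg (by have := hnn (n + m); have := hnn (n - m); positivity),
      mul_assoc]
    exact mul_le_mul (mul_le_of_le_one_right hq hprod1)
      (mul_le_mul (hle _) (hle _) (hnn _) hG.le) (mul_nonneg (hnn _) (hnn _)) hq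

open Filter Topology in
/-- On the unit circle the theta series is real, and it is minimal, with a positive value,
exactly at `-1`. -/
theorem exists_theta {q : ℝ} (hq0 : 0 < q) (hq1 : q < 1) :
    ∃ θ : ℂ → ℝ, (∀ z, ‖z‖ = 1 → HasSum (fun m : ℤ => ((q ^ (m ^ 2) : ℝ) : ℂ) * z ^ m) (θ z)) ∧
      0 < θ (-1) ∧ ∀ z, ‖z‖ = 1 → z ≠ -1 → θ (-1) < θ z := by
  obtain ⟨G, hG, hlim⟩ := exists_tendsto_prod_theta hq0 hq1
  set P : ℂ → ℕ → ℝ := fun z n => ∏ k ∈ Finset.range n, ‖1 + (q ^ (2 * k + 1) : ℝ) * z‖ ^ 2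
  set S : ℂ → ℂ := fun z => ∑' m : ℤ, ((q ^ (m ^ 2) : ℝ) : ℂ) * z ^ m
  have hre : ∀ z, ‖z‖ = 1 → Tendsto (P z) atTop (𝓝 (G * (S z).re)) := by
    intro z hz
    have := (Complex.continuous_re.tendsto _).comp (hlim z hz)
    simpa only [Function.comp_def, Complex.ofReal_re, Complex.re_ofReal_mul] using this
  have him : ∀ z, ‖z‖ = 1 → (S z).im = 0 := by
    intro z hz
    have := (Complex.continuous_im.tendsto _).comp (hlim z hz)
    simp only [Function.comp_def, Complex.ofReal_im, Complex.im_ofReal_mul,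
      tendsto_const_nhds_iff] at this
    exact (mul_eq_zero.1 this.symm).resolve_left hG.ne'
  have hone : ‖(-1 : ℂ)‖ = 1 := by simp
  have hr1 : ∀ k : ℕ, q ^ (2 * k + 1) < 1 := fun k => pow_lt_one₀ hq0.le hq1 (by omega)
  have hfac : ∀ k : ℕ, ‖1 + (q ^ (2 * k + 1) : ℝ) * (-1 : ℂ)‖ = 1 - q ^ (2 * k + 1) := by
    intro k
    rw [show (1 + (q ^ (2 * k + 1) : ℝ) * (-1 : ℂ)) = ((1 - q ^ (2 * k + 1) : ℝ) : ℂ) by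
      push_cast; ring, Complex.norm_real, Real.norm_of_nonneg (sub_nonneg.2 (hr1 k).le)]
  have hfacle : ∀ z : ℂ, ‖z‖ = 1 → ∀ k : ℕ,
      1 - q ^ (2 * k + 1) ≤ ‖1 + (q ^ (2 * k + 1) : ℝ) * z‖ := by
    intro z hz k
    have := norm_sub_norm_le (1 : ℂ) (-((q ^ (2 * k + 1) : ℝ) * z))
    rwa [norm_neg, norm_mul, hz, Complex.norm_real, Real.norm_of_nonneg (by positivity), mul_one,
      norm_one, sub_neg_eq_add] at this
  have hpos : 0 < (S (-1)).re := by
    obtain ⟨δ, hδ, hle⟩ := exists_pos_le_prod_one_sub_pow hq0 hq1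
    have : δ ^ 2 ≤ G * (S (-1)).re := by
      refine ge_of_tendsto' (hre _ hone) fun n => ?_
      simp only [P, hfac, Finset.prod_pow]
      refine pow_le_pow_left₀ hδ.le ((hle n).trans ?_) 2
      refine Finset.prod_le_prod (fun k _ => sub_nonneg.2 (pow_le_one₀ hq0.le hq1.le)) fun k _ => ?_
      exact sub_le_sub_left (pow_le_pow_of_le_one hq0.le hq1.le (by omega)) 1
    exact pos_of_mul_pos_right ((pow_pos hδ 2).trans_le this) hG.le
  refine ⟨fun z => (S z).re, fun z hz => ?_, hpos, fun z hz hne => ?_⟩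
  · have hs : Summable fun m : ℤ => ((q ^ (m ^ 2) : ℝ) : ℂ) * z ^ m := by
      refine Summable.of_norm ((summable_zpow_sq hq0 hq1).congr fun m => ?_)
      rw [norm_mul, norm_zpow, hz, one_zpow, mul_one, Complex.norm_real,
        Real.norm_of_nonneg (zpow_pos hq0 _).le]
    have h := hs.hasSum
    rwa [show (∑' m : ℤ, ((q ^ (m ^ 2) : ℝ) : ℂ) * z ^ m) = ((S z).re : ℂ) from
      Complex.ext (Complex.ofReal_re _).symm ((him z hz).trans (Complex.ofReal_im _).symm)] at h
  · have hreal : -1 < z.re := by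
      have hsq : z.re ^ 2 + z.im ^ 2 = 1 := by
        have := Complex.sq_norm z
        rw [hz, Complex.normSq_apply] at this
        linarith
      have hge : -1 ≤ z.re := by nlinarith [sq_nonneg z.im]
      refine lt_of_le_of_ne hge fun h => hne ?_
      refine Complex.ext (by simp [← h]) ?_
      rw [← h] at hsq
      have : z.im ^ 2 = 0 := by linarith
      simpa using this
    have hn : ‖1 + (q : ℂ) * z‖ ^ 2 = 1 + 2 * q * z.re + q ^ 2 := by
      have := Complex.sq_norm z
      rw [hz, Complex.normSq_apply] at this
      rw [Complex.sq_norm, Complex.normSq_apply]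
      simp
      linear_combination (-q ^ 2) * this
    have h1q : 0 < (1 - q) ^ 2 := by nlinarith
    have hbound : ∀ n, ‖1 + (q : ℂ) * z‖ ^ 2 * P (-1) (n + 1) ≤ (1 - q) ^ 2 * P z (n + 1) := by
      intro n
      simp only [P, hfac, Finset.prod_range_succ']
      have hle : ∏ k ∈ Finset.range n, (1 - q ^ (2 * (k + 1) + 1)) ^ 2 ≤
          ∏ k ∈ Finset.range n, ‖1 + (q ^ (2 * (k + 1) + 1) : ℝ) * z‖ ^ 2 :=
        Finset.prod_le_prod (fun k _ => sq_nonneg _) fun k _ =>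
          pow_le_pow_left₀ (sub_nonneg.2 (hr1 _).le) (hfacle z hz _) 2
      have := mul_le_mul_of_nonneg_left hle
        (mul_nonneg (sq_nonneg ‖1 + (q : ℂ) * z‖) (sq_nonneg (1 - q)))
      simp only [mul_zero, zero_add, pow_one]
      linarith
    have hl := le_of_tendsto_of_tendsto'
      (((tendsto_add_atTop_iff_nat 1).2 (hre _ hone)).const_mul (‖1 + (q : ℂ) * z‖ ^ 2))
      (((tendsto_add_atTop_iff_nat 1).2 (hre z hz)).const_mul ((1 - q) ^ 2)) hbound
    have hl' : ‖1 + (q : ℂ) * z‖ ^ 2 * (S (-1)).re ≤ (1 - q) ^ 2 * (S z).re := by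
      refine le_of_mul_le_mul_left ?_ hG
      linarith
    have hlt : (1 - q) ^ 2 * (S (-1)).re < ‖1 + (q : ℂ) * z‖ ^ 2 * (S (-1)).re := by
      refine mul_lt_mul_of_pos_right ?_ hpos
      rw [hn]; nlinarith
    exact lt_of_mul_lt_mul_left (hlt.trans_le hl') h1q.le

theorem summable_norm_hasSum_pi_prod {ι : Type*} {d : ℕ} {f : Fin d → ι → ℂ} {s : Fin d → ℂ}
    (hf : ∀ i, Summable fun n => ‖f i n‖) (hs : ∀ i, HasSum (f i) (s i)) :
    Summable (fun m : Fin d → ι => ‖∏ i, f i (m i)‖) ∧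
      HasSum (fun m : Fin d → ι => ∏ i, f i (m i)) (∏ i, s i) := by
  induction d with
  | zero =>
    simp only [Finset.univ_eq_empty, Finset.prod_empty]
    exact ⟨(hasSum_fintype _).summable, by simp⟩
  | succ d ih =>
    obtain ⟨h1, h2⟩ := ih (fun i => hf i.succ) (fun i => hs i.succ)
    constructor
    · rw [← (Fin.consEquiv fun _ => ι).summable_iff]
      refine ((hf 0).mul_norm h1).congr fun x => ?_
      simp [Fin.consEquiv, Fin.prod_univ_succ]
    · rw [← (Fin.consEquiv fun _ => ι).hasSum_iff, Fin.prod_univ_succ]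
      have h := (hs 0).mul h2 ((hf 0).mul_norm h1).of_norm
      refine h.congr_fun fun x => ?_
      simp [Fin.consEquiv, Fin.prod_univ_succ]

/-- A function on `ℤ^d` that is a finite nonnegative combination of unitary characters. -/
def IsCharacterCombination {d : ℕ} (s : (Fin d → ℤ) → ℝ) : Prop :=
  ∃ (J : Type) (_ : Fintype J) (p : J → ℝ) (z : J → Fin d → ℂ), (∀ j, 0 ≤ p j) ∧
    (∀ j i, ‖z j i‖ = 1) ∧ ∀ m : Fin d → ℤ, (s m : ℂ) = ∑ j, (p j : ℂ) * ∏ i, z j i ^ m i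

/-- Among normalized positive combinations of characters, the alternating character has the
strictly smallest Gaussian sum. -/
theorem IsCharacterCombination.exists_hasSum_sub {d : ℕ} {s : (Fin d → ℤ) → ℝ}
    (hs : IsCharacterCombination s) (hs0 : s 0 = 1) {q : Fin d → ℝ} (hq0 : ∀ i, 0 < q i)
    (hq1 : ∀ i, q i < 1) :
    ∃ D : ℝ, HasSum (fun m : Fin d → ℤ => (s m - (-1 : ℝ) ^ (∑ i, m i)) * ∏ i, q i ^ (m i ^ 2)) D ∧
      0 ≤ D ∧ (D = 0 → ∀ m, s m = (-1 : ℝ) ^ (∑ i, m i)) := by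
  obtain ⟨J, _, p, z, hp, hz, hrep⟩ := hs
  choose θ hθ hpos hlt using fun i => exists_theta (hq0 i) (hq1 i)
  have hsum : ∑ j, p j = 1 := by
    have := hrep 0
    rw [hs0] at this
    simp only [Pi.zero_apply, zpow_zero, Finset.prod_const_one, mul_one] at this
    exact_mod_cast this.symm
  have hneg : ∀ m : Fin d → ℤ, ∏ i, (-1 : ℂ) ^ m i = (((-1 : ℝ) ^ (∑ i, m i) : ℝ) : ℂ) := by
    intro m
    rw [Complex.ofReal_zpow]
    push_cast
    have : ∀ t : Finset (Fin d), ∏ i ∈ t, (-1 : ℂ) ^ m i = (-1) ^ (∑ i ∈ t, m i) := by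
      intro t
      induction t using Finset.cons_induction with
      | empty => simp
      | cons a t ha ih => rw [Finset.prod_cons, Finset.sum_cons, ih, zpow_add₀ (by norm_num)]
    exact this _
  have key : ∀ w : Fin d → ℂ, (∀ i, ‖w i‖ = 1) →
      HasSum (fun m : Fin d → ℤ => ((∏ i, q i ^ (m i ^ 2) : ℝ) : ℂ) * ∏ i, w i ^ m i)
        ((∏ i, θ i (w i) : ℝ) : ℂ) := by
    intro w hw
    have := (summable_norm_hasSum_pi_prod (fun i => ?_) fun i => hθ i (w i) (hw i)).2
    · rw [Complex.ofReal_prod]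
      refine this.congr_fun fun m => ?_
      rw [Complex.ofReal_prod, Finset.prod_mul_distrib]
    · refine (summable_zpow_sq (hq0 i) (hq1 i)).congr fun m => ?_
      rw [norm_mul, norm_zpow, hw i, one_zpow, mul_one, Complex.norm_real,
        Real.norm_of_nonneg (zpow_pos (hq0 i) _).le]
  have hle : ∀ j, ∏ i, θ i (-1) ≤ ∏ i, θ i (z j i) := by
    refine fun j => Finset.prod_le_prod (fun i _ => (hpos i).le) fun i _ => ?_
    by_cases h : z j i = -1
    · rw [h]
    · exact (hlt i _ (hz j i) h).le
  refine ⟨∑ j, p j * (∏ i, θ i (z j i) - ∏ i, θ i (-1)), ?_, ?_, ?_⟩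
  · have h1 := (hasSum_sum fun j (_ : j ∈ Finset.univ) => (key (z j) (hz j)).mul_left (p j : ℂ)).sub
      (key (fun _ => -1) fun _ => by simp)
    rw [← Complex.hasSum_ofReal]
    have hval : ((∑ j, p j * (∏ i, θ i (z j i) - ∏ i, θ i (-1)) : ℝ) : ℂ) =
        ∑ j, (p j : ℂ) * ((∏ i, θ i (z j i) : ℝ) : ℂ) - ((∏ i, θ i (-1) : ℝ) : ℂ) := by
      simp only [mul_sub, Finset.sum_sub_distrib, ← Finset.sum_mul, hsum, one_mul]
      push_cast
      rfl
    rw [hval]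
    refine h1.congr_fun fun m => ?_
    rw [Complex.ofReal_mul, Complex.ofReal_sub, hrep, hneg, sub_mul, Finset.sum_mul,
      mul_comm (Complex.ofReal (_ ^ _))]
    congr 1
    exact Finset.sum_congr rfl fun j _ => by ring
  · exact Finset.sum_nonneg fun j _ => mul_nonneg (hp j) (sub_nonneg.2 (hle j))
  · intro hD m
    have hzero := (Finset.sum_eq_zero_iff_of_nonneg fun j _ =>
      mul_nonneg (hp j) (sub_nonneg.2 (hle j))).1 hD
    have hj : ∀ j, p j = 0 ∨ ∀ i, z j i = -1 := by
      intro j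
      rcases mul_eq_zero.1 (hzero j (Finset.mem_univ j)) with h | h
      · exact Or.inl h
      · right
        by_contra! hne
        obtain ⟨i, hi⟩ := hne
        have := Finset.prod_lt_prod (s := Finset.univ) (f := fun i => θ i (-1))
          (g := fun i => θ i (z j i)) (fun i _ => hpos i) (fun i _ => ?_)
          ⟨i, Finset.mem_univ i, hlt i _ (hz j i) hi⟩
        · linarith
        · by_cases h' : z j i = -1
          · simp [h']
          · exact (hlt i _ (hz j i) h').le
    have : (s m : ℂ) = (((-1 : ℝ) ^ (∑ i, m i) : ℝ) : ℂ) := by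
      have h1 : ∀ j, (p j : ℂ) * ∏ i, z j i ^ m i = p j * (((-1 : ℝ) ^ (∑ i, m i) : ℝ) : ℂ) := by
        intro j
        rcases hj j with h | h
        · simp [h]
        · simp only [h, hneg]
      rw [hrep, Finset.sum_congr rfl fun j _ => h1 j, ← Finset.sum_mul, ← Complex.ofReal_sum, hsum]
      simp
    exact_mod_cast this

/-- Autocorrelations on a finite abelian group are positive combinations of characters. -/
theorem exists_autocorrelation_eq_sum_addChar {G : Type*} [AddCommGroup G] [Fintype G]
    (Φ : G → ℝ) :
    ∃ p : AddChar G ℂ → ℝ, (∀ ψ, 0 ≤ p ψ) ∧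
      ∀ g, ((∑ x, Φ x * Φ (x + g) : ℝ) : ℂ) = ∑ ψ, (p ψ : ℂ) * ψ g := by
  classical
  refine ⟨fun ψ => ‖∑ x, (Φ x : ℂ) * ψ x‖ ^ 2 / Fintype.card G, fun ψ => by positivity,
    fun g => ?_⟩
  have hcard : (Fintype.card G : ℂ) ≠ 0 := by exact_mod_cast Fintype.card_ne_zero
  have hψ : ∀ ψ : AddChar G ℂ, ((‖∑ x, (Φ x : ℂ) * ψ x‖ ^ 2 / Fintype.card G : ℝ) : ℂ) * ψ g =
      (Fintype.card G : ℂ)⁻¹ * ∑ x, ∑ y, (Φ x : ℂ) * Φ y * ψ (x + g - y) := by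
    intro ψ
    push_cast
    rw [← Complex.mul_conj', map_sum, Finset.sum_mul_sum, div_eq_inv_mul, mul_assoc, Finset.sum_mul]
    congr 1
    refine Finset.sum_congr rfl fun x _ => ?_
    rw [Finset.sum_mul]
    refine Finset.sum_congr rfl fun y _ => ?_
    rw [map_mul, Complex.conj_ofReal, ← AddChar.map_neg_eq_conj, sub_eq_add_neg,
      AddChar.map_add_eq_mul, AddChar.map_add_eq_mul]
    ring
  rw [Finset.sum_congr rfl fun ψ _ => hψ ψ, ← Finset.mul_sum, Finset.sum_comm]
  have hx : ∀ x, ∑ ψ : AddChar G ℂ, ∑ y, (Φ x : ℂ) * Φ y * ψ (x + g - y) =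
      Fintype.card G * (Φ x * Φ (x + g)) := by
    intro x
    rw [Finset.sum_comm]
    simp only [← Finset.mul_sum, AddChar.sum_apply_eq_ite, sub_eq_zero]
    simp
    ring
  rw [Finset.sum_congr rfl fun x _ => hx x, ← Finset.mul_sum, inv_mul_cancel_left₀ hcard]
  push_cast
  rfl

theorem IsCharacterCombination.abs_le {d : ℕ} {s : (Fin d → ℤ) → ℝ}
    (hs : IsCharacterCombination s) (m : Fin d → ℤ) : |s m| ≤ s 0 := by
  obtain ⟨J, _, p, z, hp, hz, hrep⟩ := hs
  have h0 : s 0 = ∑ j, p j := by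
    have := hrep 0
    simp only [Pi.zero_apply, zpow_zero, Finset.prod_const_one, mul_one] at this
    exact_mod_cast this
  rw [h0, ← Real.norm_eq_abs, ← Complex.norm_real, hrep]
  refine (norm_sum_le _ _).trans (Finset.sum_le_sum fun j _ => ?_)
  simp [hz, abs_of_nonneg (hp j)]

theorem abs_neg_one_zpow_le (k : ℤ) : |(-1 : ℝ) ^ k| ≤ 1 := by
  rw [abs_zpow, abs_neg, abs_one, one_zpow]

theorem integrable_tsum_of_summable_integral_norm {α ι : Type*} [MeasurableSpace α]
    {μ : Measure α} [Countable ι] {F : ι → α → ℝ} (hF_meas : ∀ i, Measurable (F i))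
    (hF_int : ∀ i, Integrable (F i) μ) (hF_sum : Summable fun i => ∫ a, ‖F i a‖ ∂μ) :
    Integrable (fun a => ∑' i, F i a) μ := by
  refine ⟨(Measurable.tsum hF_meas).aestronglyMeasurable, ?_⟩
  have h1 : ∀ i, ∫⁻ a, ‖F i a‖ₑ ∂μ = ENNReal.ofReal (∫ a, ‖F i a‖ ∂μ) := fun i =>
    (ofReal_integral_norm_eq_lintegral_enorm (hF_int i)).symm
  calc ∫⁻ a, ‖∑' i, F i a‖ₑ ∂μ ≤ ∫⁻ a, ∑' i, ‖F i a‖ₑ ∂μ :=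
        lintegral_mono fun a => enorm_tsum_le_tsum_enorm
    _ = ∑' i, ENNReal.ofReal (∫ a, ‖F i a‖ ∂μ) := by
        rw [lintegral_tsum fun i => (hF_meas i).enorm.aemeasurable]
        simp only [h1]
    _ = ENNReal.ofReal (∑' i, ∫ a, ‖F i a‖ ∂μ) :=
        (ENNReal.ofReal_tsum_of_nonneg (fun i => integral_nonneg fun a => norm_nonneg _)
          hF_sum).symm
    _ < ⊤ := ENNReal.ofReal_lt_top

theorem exp_neg_sum_mul_eq_prod_zpow {d : ℕ} (a : Fin d → ℝ) (m : Fin d → ℤ) (t : ℝ) :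
    Real.exp (-(∑ i, (a i * m i) ^ 2) * t) = ∏ i, Real.exp (-(a i ^ 2 * t)) ^ (m i ^ 2) := by
  simp_rw [← Real.rpow_intCast, ← Real.exp_mul, ← Real.exp_sum]
  congr 1
  rw [neg_mul, Finset.sum_mul, ← Finset.sum_neg_distrib]
  refine Finset.sum_congr rfl fun i _ => ?_
  push_cast
  ring

/-- Comparison of a positive combination of characters with the alternating character, for a
mixture of Gaussian weights. -/
theorem IsCharacterCombination.tsum_sub_mul_nonneg {d : ℕ} {s : (Fin d → ℤ) → ℝ}
    (hs : IsCharacterCombination s) (hs0 : s 0 = 1) {a : Fin d → ℝ} (ha : ∀ i, 0 < a i)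
    {ν : Measure ℝ} (hν : ∀ᵐ t ∂ν, 0 < t) {w : {m : Fin d → ℤ // m ≠ 0} → ℝ}
    (hexp : ∀ m : {m : Fin d → ℤ // m ≠ 0},
      Integrable (fun t => Real.exp (-(∑ i, (a i * m.1 i) ^ 2) * t)) ν)
    (hw : ∀ m, w m = ∫ t, Real.exp (-(∑ i, (a i * m.1 i) ^ 2) * t) ∂ν) (hsum : Summable w) :
    0 ≤ ∑' m, (s m.1 - (-1 : ℝ) ^ (∑ i, m.1 i)) * w m ∧
      (ν ≠ 0 → ∑' m, (s m.1 - (-1 : ℝ) ^ (∑ i, m.1 i)) * w m = 0 →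
        ∀ m, s m = (-1 : ℝ) ^ (∑ i, m i)) := by
  set F : {m : Fin d → ℤ // m ≠ 0} → ℝ → ℝ := fun m t =>
    (s m.1 - (-1 : ℝ) ^ (∑ i, m.1 i)) * Real.exp (-(∑ i, (a i * m.1 i) ^ 2) * t) with hF
  have hFint : ∀ m, Integrable (F m) ν := fun m => (hexp m).const_mul _
  have hbound : ∀ m, |s m - (-1 : ℝ) ^ (∑ i, m i)| ≤ 2 := fun m => by
    have h1 := hs.abs_le m
    have h2 := abs_neg_one_zpow_le (∑ i, m i)
    have h3 := abs_sub (s m) ((-1 : ℝ) ^ (∑ i, m i))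
    linarith
  have hFsum : Summable fun m => ∫ t, ‖F m t‖ ∂ν := by
    refine (hsum.mul_left 2).of_nonneg_of_le (fun m => integral_nonneg fun t => norm_nonneg _)
      fun m => ?_
    simp only [hF, norm_mul, integral_const_mul, Real.norm_eq_abs, Real.abs_exp, ← hw]
    refine mul_le_mul_of_nonneg_right (hbound _) ?_
    rw [hw]
    exact integral_nonneg fun t => (Real.exp_pos _).le
  have hpt : ∀ t, 0 < t → 0 ≤ ∑' m, F m t ∧
      (∑' m, F m t = 0 → ∀ m, s m = (-1 : ℝ) ^ (∑ i, m i)) := by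
    intro t ht
    obtain ⟨D, hD, hD0, heq⟩ := hs.exists_hasSum_sub hs0 (q := fun i => Real.exp (-(a i ^ 2 * t)))
      (fun i => Real.exp_pos _) fun i =>
        Real.exp_lt_one_iff.2 (neg_lt_zero.2 (mul_pos (pow_pos (ha i) 2) ht))
    have hsub : HasSum (fun m => F m t) D := by
      rw [← hasSum_subtype_iff_of_support_subset (s := {m : Fin d → ℤ | m ≠ 0})] at hD
      · refine hD.congr_fun fun m => ?_
        simp only [hF, exp_neg_sum_mul_eq_prod_zpow]
        rfl
      · intro m hm h0
        apply hm
        simp [h0, hs0]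
    rw [hsub.tsum_eq]
    exact ⟨hD0, heq⟩
  have hval : ∑' m, (s m.1 - (-1 : ℝ) ^ (∑ i, m.1 i)) * w m = ∫ t, ∑' m, F m t ∂ν := by
    rw [← integral_tsum_of_summable_integral_norm hFint hFsum]
    exact tsum_congr fun m => by rw [hF, integral_const_mul, hw]
  have hae : 0 ≤ᵐ[ν] fun t => ∑' m, F m t := hν.mono fun t ht => (hpt t ht).1
  rw [hval]
  refine ⟨integral_nonneg_of_ae hae, fun hne h => ?_⟩
  have hmeas : ∀ m, Measurable (F m) := fun m => by fun_prop
  rw [integral_eq_zero_iff_of_nonneg_ae hae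
    (integrable_tsum_of_summable_integral_norm hmeas hFint hFsum)] at h
  have : (ae ν).NeBot := ae_neBot.2 hne
  obtain ⟨t, ht, h0⟩ := (hν.and h).exists
  exact (hpt t ht).2 h0

theorem exists_eq_comp_intCast {d N : ℕ} [NeZero N] {φ : (Fin d → ℤ) → ℝ}
    (hφ : ∀ (m : Fin d → ℤ) (i : Fin d), φ (m + Pi.single i (N : ℤ)) = φ m) :
    ∃ Φ : (Fin d → ZMod N) → ℝ, ∀ m, φ m = Φ fun i => (m i : ZMod N) := by
  have hper : ∀ (v : Fin d → ℤ) (t : Finset (Fin d)),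
      Function.Periodic φ (∑ i ∈ t, v i • Pi.single i (N : ℤ)) := by
    intro v t
    induction t using Finset.cons_induction with
    | empty => intro m; simp
    | cons a t ha ih =>
      rw [Finset.sum_cons]
      exact Function.Periodic.add_period (Function.Periodic.zsmul (fun m => hφ m a) _) ih
  refine ⟨fun g => φ fun i => ((g i).val : ℤ), fun m => ?_⟩
  have hm : m = (fun i => (((m i : ZMod N)).val : ℤ)) +
      ∑ i, (m i / N) • Pi.single i (N : ℤ) := by
    ext j
    simp only [Pi.add_apply, Finset.sum_apply, Pi.smul_apply, Pi.single_apply, smul_eq_mul,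
      mul_ite, mul_zero, Finset.sum_ite_eq, Finset.mem_univ, if_true, ZMod.val_intCast]
    exact (Int.emod_add_ediv_mul _ _).symm
  conv_lhs => rw [hm]
  exact hper _ _ _

theorem sum_piFinset_Ico_intCast {d N : ℕ} [NeZero N] (F : (Fin d → ZMod N) → ℝ) :
    ∑ y ∈ Fintype.piFinset (fun _ : Fin d => Finset.Ico (0 : ℤ) (N : ℤ)),
      F (fun i => (y i : ZMod N)) = ∑ g, F g := by
  refine Finset.sum_nbij' (fun y i => (y i : ZMod N)) (fun g i => ((g i).val : ℤ)) ?_ ?_ ?_ ?_ ?_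
  · simp
  · intro g _
    exact Fintype.mem_piFinset.2 fun i => Finset.mem_Ico.2
      ⟨Int.natCast_nonneg _, by exact_mod_cast ZMod.val_lt (g i)⟩
  · intro y hy
    ext i
    have := Finset.mem_Ico.1 (Fintype.mem_piFinset.1 hy i)
    simp only [ZMod.val_intCast]
    exact Int.emod_eq_of_lt this.1 this.2
  · intro g _
    ext i
    simp
  · simp

/-- The normalized autocorrelation of a function over the box `{0, …, N - 1}^d`. -/
noncomputable def autocorrelation {d : ℕ} (N : ℕ) (φ : (Fin d → ℤ) → ℝ) (m : Fin d → ℤ) : ℝ :=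
  ((N : ℝ) ^ d)⁻¹ * ∑ y ∈ Fintype.piFinset (fun _ : Fin d => Finset.Ico (0 : ℤ) (N : ℤ)),
    φ y * φ (y + m)

theorem isCharacterCombination_autocorrelation {d N : ℕ} [NeZero N] {φ : (Fin d → ℤ) → ℝ}
    (hφ : ∀ (m : Fin d → ℤ) (i : Fin d), φ (m + Pi.single i (N : ℤ)) = φ m) :
    IsCharacterCombination (autocorrelation N φ) := by
  obtain ⟨Φ, hΦ⟩ := exists_eq_comp_intCast hφ
  obtain ⟨p, hp, hrep⟩ := exists_autocorrelation_eq_sum_addChar Φ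
  refine ⟨AddChar (Fin d → ZMod N) ℂ, inferInstance, fun ψ => ((N : ℝ) ^ d)⁻¹ * p ψ,
    fun ψ i => ψ (Pi.single i 1), fun ψ => mul_nonneg (by positivity) (hp ψ),
    fun ψ i => ψ.norm_apply _, fun m => ?_⟩
  have hsum : ∑ y ∈ Fintype.piFinset (fun _ : Fin d => Finset.Ico (0 : ℤ) (N : ℤ)),
      φ y * φ (y + m) = ∑ g, Φ g * Φ (g + fun i => (m i : ZMod N)) := by
    rw [← sum_piFinset_Ico_intCast]
    refine Finset.sum_congr rfl fun y _ => ?_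
    rw [hΦ, hΦ]
    congr 2
    ext i
    simp
  have hψ : ∀ ψ : AddChar (Fin d → ZMod N) ℂ,
      ψ (fun i => (m i : ZMod N)) = ∏ i, ψ (Pi.single i 1) ^ m i := by
    intro ψ
    have : (fun i => (m i : ZMod N)) = ∑ i, m i • Pi.single i (1 : ZMod N) := by
      ext j
      simp [Finset.sum_apply, Pi.single_apply]
    rw [this]
    induction (Finset.univ : Finset (Fin d)) using Finset.cons_induction with
    | empty => simp
    | cons i t hi ih =>
      rw [Finset.sum_cons, Finset.prod_cons, AddChar.map_add_eq_mul, AddChar.map_zsmul_eq_zpow, ih]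
  rw [autocorrelation, hsum, Complex.ofReal_mul, hrep, Finset.mul_sum]
  refine Finset.sum_congr rfl fun ψ _ => ?_
  rw [hψ]
  push_cast
  ring

theorem sum_tsum_eq_tsum_autocorrelation {d N : ℕ} [NeZero N] {φ : (Fin d → ℤ) → ℝ}
    (hφ : ∀ (m : Fin d → ℤ) (i : Fin d), φ (m + Pi.single i (N : ℤ)) = φ m)
    {w : {m : Fin d → ℤ // m ≠ 0} → ℝ} (hw : Summable w) :
    (2 * (N : ℝ) ^ d)⁻¹ *
        ∑ y ∈ Fintype.piFinset (fun _ : Fin d => Finset.Ico (0 : ℤ) (N : ℤ)),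
          ∑' m : {m : Fin d → ℤ // m ≠ 0}, φ y * φ (y + m.1) * w m =
      2⁻¹ * ∑' m : {m : Fin d → ℤ // m ≠ 0}, autocorrelation N φ m.1 * w m := by
  obtain ⟨Φ, hΦ⟩ := exists_eq_comp_intCast hφ
  have hB : ∀ m, |φ m| ≤ ∑ g, |Φ g| := fun m => by
    rw [hΦ]
    exact Finset.single_le_sum (f := fun g => |Φ g|) (fun g _ => abs_nonneg _) (Finset.mem_univ _)
  rw [← Summable.tsum_finsetSum, mul_inv, mul_assoc, ← tsum_mul_left]
  · congr 1
    refine tsum_congr fun m => ?_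
    rw [autocorrelation, ← Finset.sum_mul, mul_assoc]
  · intro y _
    refine (hw.norm.mul_left ((∑ g, |Φ g|) * ∑ g, |Φ g|)).of_norm_bounded fun m => ?_
    rw [norm_mul, norm_mul]
    exact mul_le_mul_of_nonneg_right
      (mul_le_mul (hB _) (hB _) (norm_nonneg _) ((abs_nonneg _).trans (hB y))) (norm_nonneg _)

theorem autocorrelation_zero {d : ℕ} (N : ℕ) (φ : (Fin d → ℤ) → ℝ) :
    autocorrelation N φ 0 = ((N : ℝ) ^ d)⁻¹ *
      ∑ y ∈ Fintype.piFinset (fun _ : Fin d => Finset.Ico (0 : ℤ) (N : ℤ)), φ y ^ 2 := by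
  simp [autocorrelation, sq]

/-- Autocorrelation `-1` at a unit lattice vector forces a sign change along it. -/
theorem add_single_eq_neg_of_autocorrelation {d N : ℕ} [NeZero N] {φ : (Fin d → ℤ) → ℝ}
    (hφ : ∀ (m : Fin d → ℤ) (i : Fin d), φ (m + Pi.single i (N : ℤ)) = φ m)
    (h0 : autocorrelation N φ 0 = 1) {v : Fin d → ℤ} (hv : autocorrelation N φ v = -1)
    (m : Fin d → ℤ) : φ (m + v) = -φ m := by
  obtain ⟨Φ, hΦ⟩ := exists_eq_comp_intCast hφ
  set c : Fin d → ZMod N := fun i => (v i : ZMod N)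
  have hadd : ∀ y, φ (y + v) = Φ ((fun i => (y i : ZMod N)) + c) := by
    intro y
    rw [hΦ]
    congr 1
    ext i
    simp [c]
  have e0 : ((N : ℝ) ^ d)⁻¹ * ∑ g, Φ g ^ 2 = 1 := by
    rw [← h0, autocorrelation_zero, ← sum_piFinset_Ico_intCast]
    simp only [hΦ]
  have e1 : ((N : ℝ) ^ d)⁻¹ * ∑ g, Φ g * Φ (g + c) = -1 := by
    rw [← hv, autocorrelation, ← sum_piFinset_Ico_intCast]
    simp only [hadd]
    simp only [hΦ]
  have e2 : ∑ g, Φ (g + c) ^ 2 = ∑ g, Φ g ^ 2 :=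
    Equiv.sum_comp (Equiv.addRight c) fun g => Φ g ^ 2
  have hN : ((N : ℝ) ^ d)⁻¹ ≠ 0 := inv_ne_zero (pow_ne_zero _ (NeZero.ne _))
  have hz : ∑ g, (Φ (g + c) + Φ g) ^ 2 = 0 := by
    have : ∑ g, (Φ (g + c) + Φ g) ^ 2 =
        ∑ g, Φ (g + c) ^ 2 + 2 * (∑ g, Φ g * Φ (g + c)) + ∑ g, Φ g ^ 2 := by
      rw [Finset.mul_sum, ← Finset.sum_add_distrib, ← Finset.sum_add_distrib]
      exact Finset.sum_congr rfl fun g _ => by ring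
    refine (mul_eq_zero.1 ?_).resolve_left hN
    rw [this, e2]
    linear_combination 2 * e0 + 2 * e1
  have := (Finset.sum_eq_zero_iff_of_nonneg fun g _ => sq_nonneg _).1 hz
    (fun i => (m i : ZMod N)) (Finset.mem_univ _)
  rw [hadd, hΦ m]
  exact eq_neg_of_add_eq_zero_left (pow_eq_zero_iff two_ne_zero |>.1 this)

theorem eq_neg_one_zpow_mul_of_add_single {d : ℕ} {φ : (Fin d → ℤ) → ℝ}
    (h : ∀ i m, φ (m + Pi.single i 1) = -φ m) (m : Fin d → ℤ) :
    φ m = (-1 : ℝ) ^ (∑ i, m i) * φ 0 := by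
  set ψ : (Fin d → ℤ) → ℝ := fun m => (-1 : ℝ) ^ (∑ i, m i) * φ m with hψ
  have hper1 : ∀ i, Function.Periodic ψ (Pi.single i 1) := by
    intro i m
    simp only [hψ, Pi.add_apply, Finset.sum_add_distrib, Finset.sum_pi_single', h,
      Finset.mem_univ, if_true]
    rw [zpow_add₀ (by norm_num)]
    simp
  have hper : ∀ t : Finset (Fin d), Function.Periodic ψ (∑ i ∈ t, m i • Pi.single i (1 : ℤ)) := by
    intro t
    induction t using Finset.cons_induction with
    | empty => intro m; simp
    | cons a t ha ih =>
      rw [Finset.sum_cons]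
      exact Function.Periodic.add_period ((hper1 a).zsmul _) ih
  have hm : m = ∑ i, m i • Pi.single i (1 : ℤ) := by
    ext j
    simp [Finset.sum_apply, Pi.single_apply]
  have h1 := hper Finset.univ 0
  rw [← hm, zero_add] at h1
  simp only [hψ, Pi.zero_apply, Finset.sum_const_zero, zpow_zero, one_mul] at h1
  rw [← h1, ← mul_assoc, ← mul_zpow]
  simp

theorem measure_singleton_zero_of_summable_integral {ι : Type*} [Infinite ι] {ν : Measure ℝ}
    {c : ι → ℝ} (hexp : ∀ m, Integrable (fun t => Real.exp (-c m * t)) ν)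
    (hsum : Summable fun m => ∫ t, Real.exp (-c m * t) ∂ν) : ν {0} = 0 := by
  have hle : ∀ m, (ν {0}).toReal ≤ ∫ t, Real.exp (-c m * t) ∂ν := by
    intro m
    have h := setIntegral_le_integral (s := {(0 : ℝ)}) (hexp m)
      (Filter.Eventually.of_forall fun t => (Real.exp_pos _).le)
    rw [Measure.restrict_singleton, integral_smul_measure, integral_dirac] at h
    simpa using h
  have hfin : ν {0} ≠ ⊤ := by
    obtain ⟨m⟩ : Nonempty ι := inferInstance
    have h := (integrableOn_singleton_iff (by simp)).1 ((hexp m).integrableOn (s := {(0 : ℝ)}))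
    simpa [← lt_top_iff_ne_top] using h
  have hlim := ge_of_tendsto' hsum.tendsto_cofinite_zero hle
  exact (ENNReal.toReal_eq_zero_iff _).1 (le_antisymm hlim ENNReal.toReal_nonneg)
    |>.resolve_right hfin

theorem infinite_ne_zero_of_pos {d : ℕ} (hd : 1 ≤ d) : Infinite {m : Fin d → ℤ // m ≠ 0} := by
  refine Infinite.of_injective
    (fun k : ℕ => (⟨Pi.single ⟨0, hd⟩ ((k : ℤ) + 1), fun h => ?_⟩ : {m : Fin d → ℤ // m ≠ 0})) ?_
  · have := congrFun h ⟨0, hd⟩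
    simp at this
    omega
  · intro k l h
    have := congrFun (congrArg Subtype.val h) ⟨0, hd⟩
    simpa using this

theorem sum_sq_piFinset_neg_one_zpow (d : ℕ) :
    ((2 : ℝ) ^ d)⁻¹ * ∑ y ∈ Fintype.piFinset (fun _ : Fin d => Finset.Ico (0 : ℤ) (2 : ℤ)),
      ((-1 : ℝ) ^ (∑ i, y i)) ^ 2 = 1 := by
  have h : ∀ k : ℤ, ((-1 : ℝ) ^ k) ^ 2 = 1 := fun k => by
    rw [← sq_abs, abs_zpow, abs_neg, abs_one, one_zpow, one_pow]
  simp [h]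

theorem autocorrelation_neg_one_zpow {d : ℕ} (m : Fin d → ℤ) :
    autocorrelation 2 (fun y : Fin d → ℤ => (-1 : ℝ) ^ (∑ i, y i)) m = (-1 : ℝ) ^ (∑ i, m i) := by
  have h := sum_sq_piFinset_neg_one_zpow d
  have hy : ∀ y : Fin d → ℤ, (-1 : ℝ) ^ (∑ i, y i) * (-1 : ℝ) ^ (∑ i, (y + m) i) =
      ((-1 : ℝ) ^ (∑ i, y i)) ^ 2 * (-1 : ℝ) ^ (∑ i, m i) := fun y => by
    simp only [Pi.add_apply, Finset.sum_add_distrib]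
    rw [zpow_add₀ (by norm_num)]
    ring
  simp only [autocorrelation, hy]
  rw [← Finset.sum_mul, ← mul_assoc]
  push_cast
  rw [h, one_mul]

/-- Optimal charge distribution for orthorhombic lattices (summable case): the
alternating rock-salt configuration `φ*(m) = (−1)^{m₁+⋯+m_d}` minimizes the energy per
particle among all periodic normalized charge configurations, and if `f` is not
identically zero the minimizer is unique up to translation, i.e. `φ = φ*` or `φ = −φ*`. -/
theorem orthorhombic_rocksalt_optimal_summable (d : ℕ) (hd : 1 ≤ d)
    (a : Fin d → ℝ) (ha : ∀ i, 0 < a i)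
    (A : Matrix (Fin d) (Fin d) ℝ) (hA : A = Matrix.diagonal a)
    (μ : Measure ℝ) (f : (Fin d → ℝ) → ℝ)
    (hμf : ∀ x : Fin d → ℝ, x ≠ 0 →
      IntegrableOn (fun t : ℝ => Real.exp (-(∑ i, x i ^ 2) * t)) (Set.Ici 0) μ)
    (hf : ∀ x : Fin d → ℝ, x ≠ 0 →
      f x = ∫ t in Set.Ici 0, Real.exp (-(∑ i, x i ^ 2) * t) ∂μ)
    (hsum : Summable fun m : {m : Fin d → ℤ // m ≠ 0} => f (A.mulVec fun j => (m.1 j : ℝ)))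
    (E : ℕ → ((Fin d → ℤ) → ℝ) → ℝ)
    (hE : ∀ (L : ℕ) (χ : (Fin d → ℤ) → ℝ),
      E L χ = (2 * (L : ℝ) ^ d)⁻¹ *
        ∑ y ∈ Fintype.piFinset (fun _ : Fin d => Finset.Ico (0 : ℤ) (L : ℤ)),
          ∑' m : {m : Fin d → ℤ // m ≠ 0},
            χ y * χ (y + m.1) * f (A.mulVec fun j => (m.1 j : ℝ)))
    (φstar : (Fin d → ℤ) → ℝ)
    (hφstar : ∀ m : Fin d → ℤ, φstar m = (-1 : ℝ) ^ (∑ i, m i)) :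
    (∀ (m : Fin d → ℤ) (i : Fin d), φstar (m + Pi.single i (2 : ℤ)) = φstar m) ∧
    ((2 : ℝ) ^ d)⁻¹ *
      (∑ y ∈ Fintype.piFinset (fun _ : Fin d => Finset.Ico (0 : ℤ) (2 : ℤ)), φstar y ^ 2) = 1 ∧
    ∀ (N : ℕ), 1 ≤ N → ∀ φ : (Fin d → ℤ) → ℝ,
      (∀ (m : Fin d → ℤ) (i : Fin d), φ (m + Pi.single i (N : ℤ)) = φ m) →
      ((N : ℝ) ^ d)⁻¹ *
        (∑ y ∈ Fintype.piFinset (fun _ : Fin d => Finset.Ico (0 : ℤ) (N : ℤ)), φ y ^ 2) = 1 →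
      E 2 φstar ≤ E N φ ∧
      ((∃ x : Fin d → ℝ, x ≠ 0 ∧ f x ≠ 0) → E N φ = E 2 φstar →
        (φ = φstar ∨ φ = -φstar)) := by
  have hσ : φstar = fun m => (-1 : ℝ) ^ (∑ i, m i) := funext hφstar
  have hper : ∀ (m : Fin d → ℤ) (i : Fin d), φstar (m + Pi.single i (2 : ℤ)) = φstar m := by
    intro m i
    simp only [hφstar, Pi.add_apply, Finset.sum_add_distrib, Finset.sum_pi_single',
      Finset.mem_univ, if_true]
    rw [zpow_add₀ (by norm_num)]
    norm_num
  have hnorm : ((2 : ℝ) ^ d)⁻¹ *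
      (∑ y ∈ Fintype.piFinset (fun _ : Fin d => Finset.Ico (0 : ℤ) (2 : ℤ)), φstar y ^ 2) = 1 := by
    simp only [hφstar]
    exact sum_sq_piFinset_neg_one_zpow d
  refine ⟨hper, hnorm, fun N hN φ hφ hφ1 => ?_⟩
  have : NeZero N := ⟨by omega⟩
  have : Infinite {m : Fin d → ℤ // m ≠ 0} := infinite_ne_zero_of_pos hd
  set ν := μ.restrict (Set.Ici 0)
  set w : {m : Fin d → ℤ // m ≠ 0} → ℝ := fun m => f (A.mulVec fun j => (m.1 j : ℝ)) with hwdef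
  have hmul : ∀ m : Fin d → ℤ, (A.mulVec fun j => (m j : ℝ)) = fun i => a i * m i := by
    intro m
    ext i
    rw [hA, Matrix.mulVec_diagonal]
  have hne : ∀ m : {m : Fin d → ℤ // m ≠ 0}, (fun i => a i * (m.1 i : ℝ)) ≠ 0 := by
    intro m h
    refine m.2 (funext fun i => ?_)
    have := congrFun h i
    simpa [(ha i).ne'] using this
  have hexp : ∀ m : {m : Fin d → ℤ // m ≠ 0},
      Integrable (fun t => Real.exp (-(∑ i, (a i * m.1 i) ^ 2) * t)) ν := fun m => hμf _ (hne m)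
  have hw : ∀ m, w m = ∫ t, Real.exp (-(∑ i, (a i * m.1 i) ^ 2) * t) ∂ν := fun m => by
    simp only [hwdef, hmul]
    exact hf _ (hne m)
  have hν0 : ν {0} = 0 := by
    refine measure_singleton_zero_of_summable_integral hexp ?_
    simpa only [← hw] using hsum
  have hν : ∀ᵐ t ∂ν, 0 < t := by
    have h1 : ∀ᵐ t ∂ν, t ∈ Set.Ici (0 : ℝ) := ae_restrict_mem measurableSet_Ici
    have h2 : ∀ᵐ t ∂ν, t ≠ 0 := by
      rw [ae_iff]
      simpa using hν0
    filter_upwards [h1, h2] with t h1 h2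
    exact lt_of_le_of_ne h1 h2.symm
  set s := autocorrelation N φ with hs
  have hs0 : s 0 = 1 := by rw [hs, autocorrelation_zero, hφ1]
  have hcomb : IsCharacterCombination s := isCharacterCombination_autocorrelation hφ
  have key := hcomb.tsum_sub_mul_nonneg hs0 ha hν hexp hw hsum
  have hEφ : E N φ = 2⁻¹ * ∑' m : {m : Fin d → ℤ // m ≠ 0}, s m.1 * w m := by
    rw [hE]
    exact sum_tsum_eq_tsum_autocorrelation hφ hsum
  have hEstar : E 2 φstar =
      2⁻¹ * ∑' m : {m : Fin d → ℤ // m ≠ 0}, (-1 : ℝ) ^ (∑ i, m.1 i) * w m := by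
    rw [hE]
    refine (sum_tsum_eq_tsum_autocorrelation (N := 2) hper hsum).trans ?_
    simp only [hσ, autocorrelation_neg_one_zpow]
  have hbdd : ∀ g : (Fin d → ℤ) → ℝ, (∀ m, |g m| ≤ 1) →
      Summable fun m : {m : Fin d → ℤ // m ≠ 0} => g m.1 * w m := fun g hg =>
    hsum.norm.of_norm_bounded fun m => by
      rw [norm_mul]
      exact mul_le_of_le_one_left (norm_nonneg _) (hg _)
  have hdiff : ∑' m : {m : Fin d → ℤ // m ≠ 0}, (s m.1 - (-1 : ℝ) ^ (∑ i, m.1 i)) * w m =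
      2 * (E N φ - E 2 φstar) := by
    simp only [sub_mul]
    rw [(hbdd s fun m => (hcomb.abs_le m).trans hs0.le).tsum_sub
      (hbdd (fun m => (-1 : ℝ) ^ (∑ i, m i)) fun m => abs_neg_one_zpow_le _), hEφ, hEstar]
    ring
  rw [hdiff] at key
  refine ⟨by linarith [key.1], fun ⟨x, hx, hfx⟩ heq => ?_⟩
  have hνne : ν ≠ 0 := by
    intro h
    apply hfx
    rw [hf x hx, h, integral_zero_measure]
  have hsσ := key.2 hνne (by rw [heq, sub_self, mul_zero])
  have hstep : ∀ i m, φ (m + Pi.single i 1) = -φ m := fun i m =>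
    add_single_eq_neg_of_autocorrelation hφ hs0
      (by rw [← hs, hsσ, Finset.sum_pi_single']; simp) m
  have hφeq : ∀ m, φ m = φstar m * φ 0 := fun m => by
    rw [hφstar]
    exact eq_neg_one_zpow_mul_of_add_single hstep m
  have hsq : φ 0 ^ 2 = 1 := by
    have h : ∀ m, φ m ^ 2 = φ 0 ^ 2 := fun m => by
      rw [hφeq m, hφstar, mul_pow, ← sq_abs, abs_zpow, abs_neg, abs_one, one_zpow, one_pow, one_mul]
    simp only [h, Finset.sum_const, Fintype.card_piFinset, Int.card_Ico, sub_zero,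
      Int.toNat_natCast, Finset.prod_const, Finset.card_univ, Fintype.card_fin, nsmul_eq_mul, Nat.cast_pow] at hφ1
    rwa [inv_mul_cancel_left₀ (pow_ne_zero _ (NeZero.ne _))] at hφ1
  rcases eq_or_eq_neg_of_sq_eq_sq (φ 0) 1 (by rw [hsq, one_pow]) with h | h
  · exact Or.inl (funext fun m => by rw [hφeq, h, mul_one])
  · exact Or.inr (funext fun m => by rw [hφeq, h, mul_neg_one, Pi.neg_apply])
end

section
/- (Born's conjecture.) Let d ≥ 1, let a₁, …, a_d > 0 with a₁⋯a_d = 1, let A = diag(a₁, …, a_d) so that X = Aℤ^d is an orthorhombic lattice of unit density, and let f ∈ 𝓕. Define the alternating (rock-salt) configuration φ*(m) = (−1)^{m₁+⋯+m_d}, which is 2-periodic, satisfies the normalization and the charge neutrality constraint. Then the Ewald energy E_{X,f}[φ*] exists, and for every integer N ≥ 1 and every N-periodic φ : ℤ^d → ℝ satisfying the normalization and the charge neutrality constraint, the Ewald energy E_{X,f}[φ] exists and E_{X,f}[φ*] ≤ E_{X,f}[φ]. In particular this applies to the Coulomb potential f(x) = |x|^{−1} in dimension d = 3 on the cubic lattice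 ℤ³. -/
open scoped Real BigOperators Topology
open MeasureTheory Filter

/-- Elementary estimate `exp (c v²) ≤ cosh (c v)` for `c ≥ π` and `|v| ≤ 1/2`. -/
lemma exp_mul_sq_le_cosh {c v : ℝ} (hc : π ≤ c) (hv0 : 0 ≤ v) (hv : v ≤ 1 / 2) :
    Real.exp (c * v ^ 2) ≤ Real.cosh (c * v) := by
  have hπ := Real.pi_gt_three
  have hc0 : 0 < c := by linarith
  set z := c * v with hz
  have hz0 : 0 ≤ z := by positivity
  rcases le_total (7 / 5) z with h | h
  · have h1 : c * v ^ 2 ≤ z / 2 := by rw [hz]; nlinarith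
    have h2 : 2 ≤ Real.exp (z / 2) := by
      have : Real.log 2 ≤ z / 2 := by linarith [Real.log_two_lt_d9]
      calc (2 : ℝ) = Real.exp (Real.log 2) := (Real.exp_log two_pos).symm
        _ ≤ _ := Real.exp_le_exp.2 this
    have h3 : Real.exp z = Real.exp (z / 2) * Real.exp (z / 2) := by
      rw [← Real.exp_add]; ring_nf
    calc Real.exp (c * v ^ 2) ≤ Real.exp (z / 2) := Real.exp_le_exp.2 h1
      _ ≤ Real.exp z / 2 := by rw [h3]; nlinarith
      _ ≤ Real.cosh z := by rw [Real.cosh_eq]; linarith [Real.exp_pos (-z)]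
  · have hw : c * v ^ 2 = z ^ 2 / c := by rw [hz]; field_simp
    have h1 : z ^ 2 / c ≤ z ^ 2 / 3 := by gcongr; linarith
    have hw1 : z ^ 2 / 3 ≤ 1 := by nlinarith
    have hw2 : z ^ 2 / 3 ≤ 2 / 3 := by nlinarith
    have hw0 : 0 ≤ z ^ 2 / 3 := by positivity
    have h2 := Real.exp_bound' hw0 hw1 (n := 3) (by norm_num)
    have h3 : 1 + z ^ 2 / 2 ≤ Real.cosh z := by
      have e : Real.cosh z = 1 + 2 * Real.sinh (z / 2) ^ 2 := by
        have h := Real.cosh_two_mul (z / 2)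
        rw [mul_div_cancel₀ z two_ne_zero] at h
        linarith [Real.cosh_sq (z / 2)]
      have h : z / 2 ≤ Real.sinh (z / 2) := Real.self_le_sinh_iff.2 (by positivity)
      have h' : 0 ≤ z / 2 := by positivity
      nlinarith
    have h4 : Real.exp (c * v ^ 2) ≤ Real.exp (z ^ 2 / 3) := by
      rw [hw]; exact Real.exp_le_exp.2 h1
    norm_num [Finset.sum_range_succ, Nat.factorial] at h2
    set w := z ^ 2 / 3 with hwdef
    have : z ^ 2 / 2 = 3 / 2 * w := by rw [hwdef]; ring
    nlinarith [mul_nonneg hw0 hw0, mul_nonneg hw0 (sub_nonneg.2 hw2),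
      mul_nonneg (mul_nonneg hw0 hw0) (sub_nonneg.2 hw2)]

lemma abs_sin_nat_mul_le (n : ℕ) (x : ℝ) : |Real.sin (n * x)| ≤ n * |Real.sin x| := by
  induction n with
  | zero => simp
  | succ k ih =>
    push_cast
    rw [add_mul, one_mul, Real.sin_add]
    calc |Real.sin (k * x) * Real.cos x + Real.cos (k * x) * Real.sin x|
        ≤ |Real.sin (k * x)| * |Real.cos x| + |Real.cos (k * x)| * |Real.sin x| := by
          rw [← abs_mul, ← abs_mul]; exact abs_add_le _ _
      _ ≤ |Real.sin (k * x)| * 1 + 1 * |Real.sin x| := by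
          gcongr
          · exact Real.abs_cos_le_one _
          · exact Real.abs_cos_le_one _
      _ ≤ _ := by linarith

/-- The cosine sum at frequency `n` deviates from its value at `1/2` by at most `n²` times the
deviation at frequency one. -/
lemma abs_cos_sub_cos_half_le (n : ℕ) (u : ℝ) :
    |Real.cos (2 * π * u * n) - Real.cos (2 * π * (1 / 2) * n)| ≤
      n ^ 2 * (Real.cos (2 * π * u) + 1) := by
  have key : Real.cos (2 * π * u * n) - Real.cos (2 * π * (1 / 2) * n) =
      Real.cos (n * π) * (-2 * Real.sin (n * (π * (u - 1 / 2))) ^ 2) := by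
    have h1 : 2 * π * u * n = 2 * (n * (π * (u - 1 / 2))) + n * π := by ring
    have h2 : 2 * π * (1 / 2) * n = n * π := by ring
    rw [h1, h2, Real.cos_add, Real.sin_nat_mul_pi, Real.cos_two_mul']
    have := Real.sin_sq_add_cos_sq (n * (π * (u - 1 / 2)))
    linear_combination Real.cos (n * π) * this
  have h1 : Real.cos (2 * π * u) + 1 = 2 * Real.sin (π * (u - 1 / 2)) ^ 2 := by
    have : 2 * π * u = 2 * (π * (u - 1 / 2)) + π := by ring
    rw [this, Real.cos_add_pi, Real.cos_two_mul']
    linarith [Real.sin_sq_add_cos_sq (π * (u - 1 / 2))]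
  rw [key, h1, abs_mul]
  have h2 := abs_sin_nat_mul_le n (π * (u - 1 / 2))
  have h3 : Real.sin (n * (π * (u - 1 / 2))) ^ 2 ≤ n ^ 2 * Real.sin (π * (u - 1 / 2)) ^ 2 := by
    rw [← sq_abs (Real.sin (n * _)), ← sq_abs (Real.sin (π * _)), ← mul_pow]
    gcongr
  calc _ ≤ 1 * |-2 * Real.sin (n * (π * (u - 1 / 2))) ^ 2| := by
        gcongr; exact Real.abs_cos_le_one _
    _ = 2 * Real.sin (n * (π * (u - 1 / 2))) ^ 2 := by
        rw [one_mul, abs_mul, abs_neg, abs_two, abs_of_nonneg (sq_nonneg _)]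
    _ ≤ _ := by linarith

lemma add_two_sq_mul_pow_le {q : ℝ} (hq0 : 0 ≤ q) (hq : q ≤ 1 / 8) (k : ℕ) :
    ((k : ℝ) + 2) ^ 2 * q ^ ((k + 2) ^ 2) ≤ q * (1 / 2 * (1 / 2) ^ k) := by
  have h1 : ((k : ℝ) + 2) ^ 2 ≤ 4 ^ (k + 1) := by
    induction k with
    | zero => norm_num
    | succ k ih =>
      have hk : (0 : ℝ) ≤ k := Nat.cast_nonneg k
      push_cast
      rw [pow_succ (4 : ℝ) (k + 1)]
      nlinarith
  have h2 : q ^ ((k + 2) ^ 2) ≤ q * (1 / 8) ^ (k + 1) := by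
    calc q ^ ((k + 2) ^ 2) ≤ q ^ (k + 2) :=
          pow_le_pow_of_le_one hq0 (by linarith) (by nlinarith)
      _ = q * q ^ (k + 1) := by ring
      _ ≤ _ := by gcongr
  calc ((k : ℝ) + 2) ^ 2 * q ^ ((k + 2) ^ 2) ≤ 4 ^ (k + 1) * (q * (1 / 8) ^ (k + 1)) := by gcongr
    _ = q * (4 * (1 / 8)) ^ (k + 1) := by rw [mul_pow]; ring
    _ = q * (1 / 2 * (1 / 2) ^ k) := by
        rw [pow_succ']
        norm_num

open HurwitzZeta

lemma cosKernel_half_le_of_one_le (u : ℝ) {x : ℝ} (hx : 1 ≤ x) :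
    cosKernel ((1 / 2 : ℝ) : UnitAddCircle) x ≤ cosKernel (u : UnitAddCircle) x := by
  have hx0 : 0 < x := by linarith
  have hsum := (hasSum_nat_cosKernel₀ u hx0).sub (hasSum_nat_cosKernel₀ (1 / 2) hx0)
  set q := Real.exp (-π * x) with hq
  have hq0 : 0 < q := Real.exp_pos _
  have hq8 : q ≤ 1 / 8 := by
    have h3 : Real.exp (-π * x) ≤ Real.exp (-3) :=
      Real.exp_le_exp.2 (by nlinarith [Real.pi_gt_three])
    have h4 : (8 : ℝ) ≤ Real.exp 3 := by
      have : Real.exp 3 = Real.exp 1 ^ 3 := by rw [← Real.exp_nat_mul]; norm_num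
      rw [this]
      calc (8 : ℝ) = 2 ^ 3 := by norm_num
        _ ≤ _ := by gcongr; linarith [Real.add_one_le_exp (1 : ℝ)]
    calc q ≤ Real.exp (-3) := h3
      _ = 1 / Real.exp 3 := by rw [Real.exp_neg, one_div]
      _ ≤ 1 / 8 := one_div_le_one_div_of_le (by norm_num) h4
  have hexp (n : ℕ) : Real.exp (-π * n ^ 2 * x) = q ^ (n ^ 2) := by
    rw [hq, ← Real.exp_nat_mul]; push_cast; ring_nf
  set D := Real.cos (2 * π * u) + 1 with hD
  have hD0 : 0 ≤ D := by linarith [Real.neg_one_le_cos (2 * π * u)]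
  have h0 := (hasSum_nat_add_iff' 1).2 hsum
  have hgeo : HasSum (fun k : ℕ => -(2 * D * q) * (1 / 2 * (1 / 2 : ℝ) ^ k)) (-(2 * D * q)) := by
    have := (hasSum_geometric_two).mul_left (1 / 2)
    have := this.mul_left (-(2 * D * q))
    simpa using this
  have hle := hasSum_le (fun k => ?_) hgeo h0
  · rw [Finset.sum_range_one] at hle
    have e1 : 2 * Real.cos (2 * π * u * ((0 : ℕ) + 1)) * Real.exp (-π * ((0 : ℕ) + 1) ^ 2 * x) -
        2 * Real.cos (2 * π * (1 / 2) * ((0 : ℕ) + 1)) * Real.exp (-π * ((0 : ℕ) + 1) ^ 2 * x) =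
        2 * D * q := by
      have : 2 * π * (1 / 2) * ((0 : ℕ) + 1) = π := by push_cast; ring
      rw [this, Real.cos_pi, hD, hq]
      push_cast
      simp only [zero_add, mul_one, one_pow]
      ring
    rw [e1] at hle
    linarith
  · have e := hexp (k + 2)
    have b := abs_cos_sub_cos_half_le (k + 2) u
    have g := add_two_sq_mul_pow_le hq0.le hq8 k
    push_cast at e b ⊢
    rw [add_assoc (k : ℝ) 1 1, one_add_one_eq_two, e]
    have b' := (abs_le.1 b).1
    have p : 0 ≤ q ^ ((k + 2) ^ 2) := by positivity
    have := mul_le_mul_of_nonneg_right b' p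
    have := mul_le_mul_of_nonneg_left g hD0
    nlinarith

lemma evenKernel_half_le_of_one_le {u : ℝ} (hu0 : 0 ≤ u) (hu1 : u ≤ 1) {y : ℝ} (hy : 1 ≤ y) :
    evenKernel ((1 / 2 : ℝ) : UnitAddCircle) y ≤ evenKernel (u : UnitAddCircle) y := by
  have hy0 : 0 < y := by linarith
  have h1 := hasSum_int_evenKernel u hy0
  have h2 := (Equiv.subLeft (-1 : ℤ)).hasSum_iff.2 h1
  have h3 := (h1.add h2).mul_left (1 / 2)
  rw [← two_mul, ← mul_assoc, one_div_mul_cancel two_ne_zero, one_mul] at h3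
  refine hasSum_le (fun n => ?_) (hasSum_int_evenKernel (1 / 2) hy0) h3
  set v := u - 1 / 2 with hv
  have hv1 : |v| ≤ 1 / 2 := abs_le.2 ⟨by linarith, by linarith⟩
  have hpi : π ≤ π * y := le_mul_of_one_le_right Real.pi_pos.le hy
  have hcosh : Real.exp (π * y * v ^ 2) ≤ Real.cosh (π * y * (2 * n + 1) * v) := by
    have := exp_mul_sq_le_cosh hpi (abs_nonneg v) hv1
    rw [sq_abs] at this
    refine this.trans (Real.cosh_le_cosh.2 ?_)
    have hn : (1 : ℝ) ≤ |2 * (n : ℝ) + 1| := by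
      have : (1 : ℤ) ≤ |2 * n + 1| := Int.one_le_abs (by omega)
      exact_mod_cast this
    rw [abs_mul (π * y) |v|, abs_abs, abs_mul (π * y * _) v, abs_mul (π * y)]
    exact mul_le_mul_of_nonneg_right (le_mul_of_one_le_right (abs_nonneg _) hn) (abs_nonneg _)
  have e1 : Real.exp (-π * (n + u) ^ 2 * y) = Real.exp (-π * (n + 1 / 2) ^ 2 * y) *
      Real.exp (-(π * y * v ^ 2)) * Real.exp (-(π * y * (2 * n + 1) * v)) := by
    rw [← Real.exp_add, ← Real.exp_add, hv]; ring_nf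
  have e2 : Real.exp (-π * (((-1 - n : ℤ) : ℝ) + u) ^ 2 * y) =
      Real.exp (-π * (n + 1 / 2) ^ 2 * y) *
      Real.exp (-(π * y * v ^ 2)) * Real.exp (π * y * (2 * n + 1) * v) := by
    rw [← Real.exp_add, ← Real.exp_add, hv]; push_cast; ring_nf
  simp only [Function.comp_apply, Equiv.subLeft_apply]
  rw [e1, e2]
  rw [Real.cosh_eq] at hcosh
  have hpos : 0 < Real.exp (-π * (n + 1 / 2) ^ 2 * y) := Real.exp_pos _
  have hinv : Real.exp (-(π * y * v ^ 2)) * Real.exp (π * y * v ^ 2) = 1 := by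
    rw [← Real.exp_add]; simp
  have h4 := mul_le_mul_of_nonneg_left hcosh
    (mul_nonneg hpos.le (Real.exp_pos (-(π * y * v ^ 2))).le)
  rw [mul_assoc, hinv] at h4
  linarith

lemma cosKernel_eq_evenKernel (u : UnitAddCircle) {x : ℝ} (hx : 0 < x) :
    cosKernel u x = 1 / x ^ (1 / 2 : ℝ) * evenKernel u (1 / x) := by
  rw [evenKernel_functional_equation, one_div_one_div, ← mul_assoc,
    Real.div_rpow zero_le_one hx.le, Real.one_rpow, one_div_one_div, one_div_mul_cancel, one_mul]
  positivity

/-- The periodic Gaussian theta function is minimal at the half period. -/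
lemma cosKernel_half_le {u : ℝ} (hu0 : 0 ≤ u) (hu1 : u ≤ 1) {x : ℝ} (hx : 0 < x) :
    cosKernel ((1 / 2 : ℝ) : UnitAddCircle) x ≤ cosKernel (u : UnitAddCircle) x := by
  rcases le_total 1 x with h | h
  · exact cosKernel_half_le_of_one_le u h
  · rw [cosKernel_eq_evenKernel _ hx, cosKernel_eq_evenKernel _ hx]
    gcongr
    exact evenKernel_half_le_of_one_le hu0 hu1 (one_le_one_div hx h)

lemma evenKernel_nonneg (u : UnitAddCircle) {x : ℝ} (hx : 0 < x) : 0 ≤ evenKernel u x := by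
  induction u using QuotientAddGroup.induction_on with
  | H u => exact (hasSum_int_evenKernel u hx).nonneg fun n => (Real.exp_pos _).le

lemma cosKernel_nonneg (u : UnitAddCircle) {x : ℝ} (hx : 0 < x) : 0 ≤ cosKernel u x := by
  rw [cosKernel_eq_evenKernel _ hx]
  exact mul_nonneg (by positivity) (evenKernel_nonneg u (by positivity))

/-- Absolutely convergent sums over `ℤ^d` of products factor into products of sums. -/
lemma hasSum_pi_prod : ∀ {d : ℕ} {g : Fin d → ℤ → ℂ} {s : Fin d → ℂ},
    (∀ i, Summable fun n => ‖g i n‖) → (∀ i, HasSum (g i) (s i)) →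
    (Summable fun m : Fin d → ℤ => ‖∏ i, g i (m i)‖) ∧
      HasSum (fun m : Fin d → ℤ => ∏ i, g i (m i)) (∏ i, s i)
  | 0, g, s, _, _ => by
    simp only [Finset.univ_eq_empty, Finset.prod_empty]
    exact ⟨(hasSum_fintype _).summable, by simp⟩
  | d + 1, g, s, hg, hs => by
    obtain ⟨h1, h2⟩ := hasSum_pi_prod (fun i => hg i.succ) (fun i => hs i.succ)
    have h3 : Summable fun p : ℤ × (Fin d → ℤ) => ‖g 0 p.1 * ∏ i, g i.succ (p.2 i)‖ := by
      simpa only [norm_mul] using (hg 0).mul_of_nonneg h1 (fun _ => norm_nonneg _)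
        (fun _ => norm_nonneg _)
    have h4 := (hs 0).mul h2 h3.of_norm
    rw [Fin.prod_univ_succ]
    constructor
    · rw [← (Fin.consEquiv fun _ => ℤ).summable_iff]
      simpa [Function.comp_def, Fin.consEquiv, Fin.prod_univ_succ] using h3
    · rw [← (Fin.consEquiv fun _ => ℤ).hasSum_iff]
      simpa [Function.comp_def, Fin.consEquiv, Fin.prod_univ_succ] using h4

/-- Theta series of the orthorhombic lattice with a plane-wave weight. -/
lemma hasSum_plane_wave {d : ℕ} {a : Fin d → ℝ} (ha : ∀ i, 0 < a i) (u : Fin d → ℝ) {s : ℝ}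
    (hs : 0 < s) :
    HasSum (fun m : Fin d → ℤ => Complex.exp (2 * π * Complex.I * ∑ i, (u i : ℂ) * m i) *
      (Real.exp (-s * ∑ i, (a i * m i) ^ 2) : ℂ))
      (∏ i, (cosKernel (u i : UnitAddCircle) (a i ^ 2 / π * s) : ℂ)) := by
  have hpos (i) : 0 < a i ^ 2 / π * s := by have := ha i; positivity
  have h := (hasSum_pi_prod (fun i => ?_) fun i => hasSum_int_cosKernel (u i) (hpos i)).2
  · refine h.congr_fun fun m => ?_
    rw [Finset.prod_mul_distrib, ← Complex.exp_sum, ← Complex.ofReal_prod, ← Real.exp_sum,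
      Finset.mul_sum, Finset.mul_sum]
    congr 2
    · exact Finset.sum_congr rfl fun i _ => by ring
    · congr 1
      refine Finset.sum_congr rfl fun i _ => ?_
      field_simp
  · exact (hasSum_int_cosKernel (u i) (hpos i)).summable.norm

lemma tendsto_evenKernel_atTop (u : UnitAddCircle) :
    Tendsto (evenKernel u) atTop (𝓝 (if u = 0 then 1 else 0)) := by
  obtain ⟨p, hp, h⟩ := isBigO_atTop_evenKernel_sub u
  have h0 : Tendsto (fun x : ℝ => Real.exp (-p * x)) atTop (𝓝 0) := by
    have : Tendsto (fun x : ℝ => -p * x) atTop atBot :=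
      tendsto_id.const_mul_atTop_of_neg (by linarith)
    exact Real.tendsto_exp_atBot.comp this
  simpa using (h.trans_tendsto h0).add_const (if u = 0 then (1 : ℝ) else 0)

lemma tendsto_rpow_mul_evenKernel_atTop {u : UnitAddCircle} (hu : u ≠ 0) (r : ℝ) :
    Tendsto (fun y : ℝ => y ^ r * evenKernel u y) atTop (𝓝 0) := by
  obtain ⟨p, hp, h⟩ := isBigO_atTop_evenKernel_sub u
  simp only [hu, if_false, sub_zero] at h
  exact ((Asymptotics.isBigO_refl (fun y : ℝ => y ^ r) atTop).mul h).trans_tendsto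
    (tendsto_rpow_mul_exp_neg_mul_atTop_nhds_zero r p hp)

/-- A nontrivial plane wave kills the theta series at high temperature. -/
lemma tendsto_prod_cosKernel {d : ℕ} {b : Fin d → ℝ} (hb : ∀ i, 0 < b i)
    {u : Fin d → UnitAddCircle} {i₀ : Fin d} (hu : u i₀ ≠ 0) :
    Tendsto (fun s : ℝ => ∏ i, cosKernel (u i) (b i * s)) (𝓝[>] 0) (𝓝 0) := by
  have hinv : Tendsto (fun s : ℝ => s⁻¹) (𝓝[>] 0) atTop := tendsto_inv_nhdsGT_zero
  have key : Tendsto (fun y : ℝ => ∏ i, cosKernel (u i) (b i * y⁻¹)) atTop (𝓝 0) := by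
    have hy (i : Fin d) : Tendsto (fun y : ℝ => y / b i) atTop atTop :=
      tendsto_id.atTop_div_const (hb i)
    have e : ∀ᶠ y : ℝ in atTop, (b i₀ ^ ((d : ℝ) / 2) * ∏ i, (1 / b i ^ (1 / 2 : ℝ))) *
        (((y / b i₀) ^ ((d : ℝ) / 2) * evenKernel (u i₀) (y / b i₀)) *
          ∏ i ∈ Finset.univ.erase i₀, evenKernel (u i) (y / b i)) =
        ∏ i, cosKernel (u i) (b i * y⁻¹) := by
      filter_upwards [eventually_gt_atTop 0] with y hy
      have e1 (i : Fin d) : cosKernel (u i) (b i * y⁻¹) =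
          1 / b i ^ (1 / 2 : ℝ) * (y ^ (1 / 2 : ℝ) * evenKernel (u i) (y / b i)) := by
        rw [cosKernel_eq_evenKernel _ (mul_pos (hb i) (inv_pos.2 hy)),
          Real.mul_rpow (hb i).le (inv_pos.2 hy).le, Real.inv_rpow hy.le]
        have : 1 / (b i * y⁻¹) = y / b i := by field_simp
        rw [this]
        field_simp
      simp_rw [e1]
      rw [Finset.prod_mul_distrib, Finset.prod_mul_distrib, Finset.prod_const, Finset.card_univ,
        Fintype.card_fin, ← Real.rpow_mul_natCast hy.le, Real.div_rpow hy.le (hb i₀).le,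
        ← Finset.mul_prod_erase Finset.univ (fun i => evenKernel (u i) (y / b i))
          (Finset.mem_univ i₀)]
      have : (b i₀ ^ ((d : ℝ) / 2)) ≠ 0 := (Real.rpow_pos_of_pos (hb i₀) _).ne'
      have hd : (1 / 2 : ℝ) * d = d / 2 := by ring
      rw [hd]
      field_simp
    refine Tendsto.congr' e ?_
    have t1 := (tendsto_rpow_mul_evenKernel_atTop hu ((d : ℝ) / 2)).comp (hy i₀)
    have t2 := tendsto_finsetProd (Finset.univ.erase i₀) fun i _ =>
      (tendsto_evenKernel_atTop (u i)).comp (hy i)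
    simpa using (t1.mul t2).const_mul (b i₀ ^ ((d : ℝ) / 2) * ∏ i, (1 / b i ^ (1 / 2 : ℝ)))
  simpa [Function.comp_def] using key.comp hinv

lemma continuousOn_prod_cosKernel {d : ℕ} {b : Fin d → ℝ} (hb : ∀ i, 0 < b i)
    (u : Fin d → UnitAddCircle) :
    ContinuousOn (fun s : ℝ => ∏ i, cosKernel (u i) (b i * s)) (Set.Ioi 0) :=
  continuousOn_finsetProd _ fun i _ => (continuousOn_cosKernel (u i)).comp
    (by fun_prop) fun s hs => mul_pos (hb i) hs

lemma sum_Ico_exp {N : ℕ} (hN : 1 ≤ N) (j : ℤ) :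
    ∑ k ∈ Finset.Ico (0 : ℤ) N, Complex.exp (2 * π * Complex.I * (((k / N : ℝ) : ℂ) * j)) =
      if (N : ℤ) ∣ j then (N : ℂ) else 0 := by
  have hN0 : (N : ℂ) ≠ 0 := Nat.cast_ne_zero.2 (by omega)
  set ζ := Complex.exp (2 * π * Complex.I * (j / N)) with hζ
  have hs : ∑ k ∈ Finset.Ico (0 : ℤ) N,
      Complex.exp (2 * π * Complex.I * (((k / N : ℝ) : ℂ) * j)) = ∑ k ∈ Finset.range N, ζ ^ k := by
    refine (Finset.sum_bij (fun (k : ℕ) _ => (k : ℤ)) ?_ ?_ ?_ ?_).symm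
    · intro k hk; simpa using hk
    · intro k _ l _ h; exact_mod_cast h
    · intro k hk
      rw [Finset.mem_Ico] at hk
      exact ⟨k.toNat, Finset.mem_range.2 (by omega), by omega⟩
    · intro k _
      rw [hζ, ← Complex.exp_nat_mul]
      push_cast
      ring_nf
  have hiff : ζ = 1 ↔ (N : ℤ) ∣ j := by
    rw [hζ, Complex.exp_eq_one_iff]
    constructor
    · rintro ⟨n, hn⟩
      refine ⟨n, ?_⟩
      have h2 : (j : ℂ) / N = n := by
        have : (2 * π * Complex.I : ℂ) ≠ 0 := Complex.two_pi_I_ne_zero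
        apply mul_left_cancel₀ this
        rw [hn]; ring
      rw [div_eq_iff hN0] at h2
      have : (j : ℂ) = ((N * n : ℤ) : ℂ) := by rw [h2]; push_cast; ring
      exact_mod_cast this
    · rintro ⟨n, rfl⟩
      refine ⟨n, ?_⟩
      push_cast
      field_simp
  rw [hs]
  split_ifs with h
  · simp [hiff.2 h]
  · have h1 : ζ ≠ 1 := fun e => h (hiff.1 e)
    have hpow : ζ ^ N = 1 := by
      rw [hζ, ← Complex.exp_nat_mul, Complex.exp_eq_one_iff]
      exact ⟨j, by field_simp⟩
    rw [geom_sum_eq h1, hpow, sub_self, zero_div]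

/-- The fundamental period cell `{0, …, N - 1}^d`. -/
noncomputable abbrev periodCell (d N : ℕ) : Finset (Fin d → ℤ) :=
  Fintype.piFinset fun _ : Fin d => Finset.Ico (0 : ℤ) (N : ℤ)

lemma sum_periodCell_exp {d N : ℕ} (hN : 1 ≤ N) (j : Fin d → ℤ) :
    ∑ k ∈ periodCell d N,
      Complex.exp (2 * π * Complex.I * ∑ i, (((k i / N : ℝ) : ℂ) * j i)) =
      if ∀ i, (N : ℤ) ∣ j i then (N : ℂ) ^ d else 0 := by
  simp_rw [Finset.mul_sum, Complex.exp_sum]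
  rw [← Finset.prod_univ_sum (fun _ : Fin d => Finset.Ico (0 : ℤ) (N : ℤ))
    (fun i k => Complex.exp (2 * π * Complex.I * (((k / N : ℝ) : ℂ) * j i)))]
  simp_rw [sum_Ico_exp hN]
  split_ifs with h
  · simp [h]
  · obtain ⟨i, hi⟩ := not_forall.1 h
    exact Finset.prod_eq_zero (Finset.mem_univ i) (if_neg hi)

lemma eq_of_forall_dvd_sub {d N : ℕ} {φ : (Fin d → ℤ) → ℝ}
    (hφ : ∀ (m : Fin d → ℤ) (i : Fin d), φ (m + Pi.single i (N : ℤ)) = φ m)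
    {x z : Fin d → ℤ} (h : ∀ i, (N : ℤ) ∣ x i - z i) : φ x = φ z := by
  choose k hk using h
  have hper (s : Finset (Fin d)) :
      Function.Periodic φ (∑ i ∈ s, k i • (Pi.single i (N : ℤ) : Fin d → ℤ)) := by
    induction s using Finset.induction_on with
    | empty => intro m; simp
    | insert i s hi ih =>
      rw [Finset.sum_insert hi]
      exact (Function.Periodic.zsmul (fun m => hφ m i) (k i)).add_period ih
  have hx : x = z + ∑ i, k i • (Pi.single i (N : ℤ) : Fin d → ℤ) := by
    ext j
    have : (∑ i, k i • (Pi.single i (N : ℤ) : Fin d → ℤ)) j = k j * N := by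
      rw [Finset.sum_apply, Finset.sum_eq_single j]
      · simp
      · intro i _ hij; simp [hij.symm]
      · simp
    rw [Pi.add_apply, this]
    linarith [hk j]
  rw [hx]
  exact hper Finset.univ z

lemma emod_mem_periodCell {d N : ℕ} (hN : 1 ≤ N) (x : Fin d → ℤ) :
    (fun i => x i % N) ∈ periodCell d N := by
  have : (0 : ℤ) < N := by omega
  exact Fintype.mem_piFinset.2 fun i => Finset.mem_Ico.2
    ⟨Int.emod_nonneg _ this.ne', Int.emod_lt_of_pos _ this⟩

/-- The normalized autocorrelation of a periodic charge distribution has a nonnegative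
finite Fourier spectrum, whose zero mode is the squared mean charge. -/
lemma exists_spectral_weights {d N : ℕ} (hN : 1 ≤ N) {φ : (Fin d → ℤ) → ℝ}
    (hφ : ∀ (m : Fin d → ℤ) (i : Fin d), φ (m + Pi.single i (N : ℤ)) = φ m) :
    ∃ c : (Fin d → ℤ) → ℝ, (∀ k, 0 ≤ c k) ∧
      (∑ y ∈ periodCell d N, φ y = 0 → c 0 = 0) ∧
      ∀ m : Fin d → ℤ,
        ((((N : ℝ) ^ d)⁻¹ * ∑ y ∈ periodCell d N, φ y * φ (y + m) : ℝ) : ℂ) =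
        ∑ k ∈ periodCell d N, (c k : ℂ) *
          Complex.exp (2 * π * Complex.I * ∑ i, (((k i / N : ℝ) : ℂ) * m i)) := by
  set e : (Fin d → ℤ) → (Fin d → ℤ) → ℂ := fun k m =>
    Complex.exp (2 * π * Complex.I * ∑ i, (((k i / N : ℝ) : ℂ) * m i)) with he
  have hadd (k x y) : e k (x + y) = e k x * e k y := by
    simp only [he, ← Complex.exp_add, ← mul_add, ← Finset.sum_add_distrib, Pi.add_apply]
    push_cast; rfl
  have hconj (k x) : (starRingEnd ℂ) (e k x) = e k (-x) := by
    simp only [he, ← Complex.exp_conj, map_mul, map_sum, Complex.conj_ofReal, Complex.conj_I,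
      map_ofNat, Pi.neg_apply, Int.cast_neg, mul_neg, Finset.sum_neg_distrib, map_intCast,
      neg_mul]
  set S : (Fin d → ℤ) → ℂ := fun k => ∑ y ∈ periodCell d N, (φ y : ℂ) * e k y with hS
  have hN0 : (N : ℂ) ≠ 0 := Nat.cast_ne_zero.2 (by omega)
  refine ⟨fun k => (((N : ℝ) ^ d)⁻¹) ^ 2 * Complex.normSq (S k), fun k => ?_, fun h => ?_,
    fun m => ?_⟩
  · exact mul_nonneg (sq_nonneg _) (Complex.normSq_nonneg _)
  · have : S 0 = 0 := by
      simp only [hS, he, Pi.zero_apply]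
      simp only [Int.cast_zero, zero_div, Complex.ofReal_zero, zero_mul, Finset.sum_const_zero,
        mul_zero, Complex.exp_zero, mul_one]
      exact_mod_cast h
    simp [this]
  · have hshift (y : Fin d → ℤ) : (∑ y' ∈ periodCell d N, (φ y' : ℂ) *
        ∑ k ∈ periodCell d N, e k (y + m - y')) = (N : ℂ) ^ d * φ (y + m) := by
      simp only [he, sum_periodCell_exp hN]
      rw [Finset.sum_eq_single (fun i => (y + m) i % N)]
      · rw [if_pos fun i => ?_, eq_of_forall_dvd_sub hφ (x := y + m)
          (z := fun i => (y + m) i % N) fun i => ?_, mul_comm]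
        · exact Int.dvd_self_sub_emod
        · exact Int.dvd_self_sub_emod
      · intro y' hy' hne
        rw [if_neg, mul_zero]
        intro h
        apply hne
        ext i
        have h1 := Finset.mem_Ico.1 (Fintype.mem_piFinset.1 hy' i)
        have h2 : (y + m) i % N = y' i % N := Int.emod_eq_emod_iff_emod_sub_eq_zero.2
          (Int.emod_eq_zero_of_dvd (h i))
        rw [h2, Int.emod_eq_of_lt h1.1 h1.2]
      · intro h
        exact absurd (emod_mem_periodCell hN _) h
    have hsq (k) : (Complex.normSq (S k) : ℂ) * e k m = ∑ y ∈ periodCell d N,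
        ∑ y' ∈ periodCell d N, (φ y : ℂ) * (φ y' * e k (y + m - y')) := by
      rw [Complex.normSq_eq_conj_mul_self, hS]
      simp only [map_sum, map_mul, Complex.conj_ofReal, hconj]
      rw [mul_comm (∑ y ∈ _, _), mul_right_comm, Finset.sum_mul, Finset.sum_mul_sum]
      refine Finset.sum_congr rfl fun y _ => Finset.sum_congr rfl fun y' _ => ?_
      rw [sub_eq_add_neg, hadd, hadd]
      ring
    have hcomm : ∑ k ∈ periodCell d N, (Complex.normSq (S k) : ℂ) * e k m =
        ∑ y ∈ periodCell d N, (φ y : ℂ) * ((N : ℂ) ^ d * φ (y + m)) := by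
      simp_rw [hsq, ← hshift, Finset.mul_sum]
      rw [Finset.sum_comm]
      exact Finset.sum_congr rfl fun y _ => Finset.sum_comm
    change _ = ∑ k ∈ periodCell d N,
      (((((N : ℝ) ^ d)⁻¹) ^ 2 * Complex.normSq (S k) : ℝ) : ℂ) * e k m
    push_cast
    simp_rw [mul_assoc]
    rw [← Finset.mul_sum, hcomm, Finset.mul_sum, Finset.mul_sum]
    refine Finset.sum_congr rfl fun y _ => ?_
    field_simp

/-- Soft-cutoff summation of superpositions of exponentials: removing the cutoff yields the
integral of the theta series `G` of the weights `R`. -/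
lemma tendsto_tsum_cutoff {ι : Type*} [Countable ι] {μ : Measure ℝ} {q R : ι → ℝ} {B c : ℝ}
    {G : ℝ → ℝ} (hc : 0 < c) (hq : ∀ i, c ≤ q i)
    (hqsum : ∀ s : ℝ, 0 < s → Summable fun i => Real.exp (-s * q i)) (hR : ∀ i, |R i| ≤ B)
    (hμ : ∀ r : ℝ, 0 < r → IntegrableOn (fun t : ℝ => Real.exp (-r * t)) (Set.Ici 0) μ)
    (hG : ∀ s : ℝ, 0 < s → HasSum (fun i => R i * Real.exp (-s * q i)) (G s))
    (hGc : ContinuousOn G (Set.Ioi 0)) (hG0 : Tendsto G (𝓝[>] 0) (𝓝 (G 0))) :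
    IntegrableOn G (Set.Ici 0) μ ∧
    Tendsto (fun η : ℝ => ∑' i, R i * (∫ t in Set.Ici 0, Real.exp (-q i * t) ∂μ) *
      Real.exp (-η * q i)) (𝓝[>] 0) (𝓝 (∫ t in Set.Ici 0, G t ∂μ)) := by
  obtain ⟨C, hC⟩ : ∃ C : ℝ, ∀ s : ℝ, 0 ≤ s → |G s| ≤ C * Real.exp (-c * s) := by
    obtain ⟨ε, hε, hnear⟩ : ∃ ε : ℝ, 0 < ε ∧ ∀ s ∈ Set.Ioo 0 ε, |G s| ≤ |G 0| + 1 := by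
      have := hG0.abs.eventually (ge_mem_nhds (lt_add_one |G 0|))
      obtain ⟨ε, hε, h⟩ := (mem_nhdsGT_iff_exists_Ioo_subset).1 this
      exact ⟨ε, hε, h⟩
    set S := ∑' i, Real.exp (-ε * q i)
    have hS0 : 0 ≤ S := tsum_nonneg fun i => (Real.exp_pos _).le
    refine ⟨(|G 0| + 1) * Real.exp (c * ε) + |B| * S * Real.exp (c * ε), fun s hs => ?_⟩
    rw [add_mul, mul_assoc, mul_assoc _ _ (Real.exp (-c * s)), ← Real.exp_add]
    rcases lt_or_ge s ε with h | h
    · have h1 : |G s| ≤ |G 0| + 1 := by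
        rcases hs.eq_or_lt with rfl | hs
        · linarith
        · exact hnear s ⟨hs, h⟩
      have h2 : 1 ≤ Real.exp (c * ε + -c * s) := Real.one_le_exp (by nlinarith)
      have h3 : 0 ≤ |B| * S * Real.exp (c * ε + -c * s) := by positivity
      have h4 : 0 ≤ |G 0| + 1 := by positivity
      nlinarith
    · have h1 : |G s| ≤ |B| * S * Real.exp (c * ε + -c * s) := by
        have hsum := ((hqsum ε hε).hasSum.mul_left |B|).mul_right (Real.exp (c * ε + -c * s))
        rw [← (hG s (hε.trans_le h)).tsum_eq, ← Real.norm_eq_abs]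
        refine tsum_of_norm_bounded hsum fun i => ?_
        rw [norm_mul, Real.norm_eq_abs, Real.norm_eq_abs, Real.abs_exp, mul_assoc, ← Real.exp_add]
        refine mul_le_mul ((hR i).trans (le_abs_self B)) (Real.exp_le_exp.2 ?_)
          (Real.exp_pos _).le (abs_nonneg _)
        nlinarith [mul_nonneg (sub_nonneg.2 h) (sub_nonneg.2 (hq i))]
      have h2 : 0 ≤ (|G 0| + 1) * Real.exp (c * ε + -c * s) := by positivity
      linarith
  have hcont : ContinuousOn G (Set.Ici 0) := by
    intro t ht
    rcases (Set.mem_Ici.1 ht).eq_or_lt with rfl | ht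
    · exact continuousWithinAt_Ioi_iff_Ici.1 hG0
    · exact (hGc.continuousAt (Ioi_mem_nhds ht)).continuousWithinAt
  have hbound : IntegrableOn (fun t => C * Real.exp (-c * t)) (Set.Ici 0) μ :=
    (hμ c hc).const_mul C
  have hmem : ∀ᵐ t ∂(μ.restrict (Set.Ici 0)), t ∈ Set.Ici (0 : ℝ) :=
    ae_restrict_mem measurableSet_Ici
  refine ⟨hbound.mono' (hcont.aestronglyMeasurable measurableSet_Ici) ?_, ?_⟩
  · filter_upwards [hmem] with t ht using hC t ht
  have hint : ∀ᶠ η : ℝ in 𝓝[>] 0, ∫ t in Set.Ici 0, G (t + η) ∂μ =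
      ∑' i, R i * (∫ t in Set.Ici 0, Real.exp (-q i * t) ∂μ) * Real.exp (-η * q i) := by
    filter_upwards [self_mem_nhdsWithin] with η hη
    have hη : 0 < η := hη
    have hqi (i) : IntegrableOn (fun t => Real.exp (-q i * t)) (Set.Ici 0) μ :=
      hμ (q i) (hc.trans_le (hq i))
    have hsum := hasSum_integral_of_summable_integral_norm (μ := μ.restrict (Set.Ici 0))
      (F := fun i t => R i * Real.exp (-η * q i) * Real.exp (-q i * t))
      (fun i => (hqi i).const_mul _) ?_
    · have e1 : ∫ t in Set.Ici 0, G (t + η) ∂μ = ∫ t in Set.Ici 0,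
          (∑' i, R i * Real.exp (-η * q i) * Real.exp (-q i * t)) ∂μ := by
        refine setIntegral_congr_fun measurableSet_Ici fun t ht => ?_
        have ht : 0 ≤ t := ht
        rw [← (hG (t + η) (by linarith)).tsum_eq]
        refine tsum_congr fun i => ?_
        rw [mul_assoc, ← Real.exp_add]
        ring_nf
      rw [e1, ← hsum.tsum_eq]
      refine tsum_congr fun i => ?_
      rw [integral_const_mul]
      ring
    · refine Summable.of_nonneg_of_le (fun i => integral_nonneg fun t => norm_nonneg _) (fun i => ?_)
        ((hqsum η hη).mul_left (|B| * ∫ t in Set.Ici 0, Real.exp (-c * t) ∂μ))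
      simp_rw [norm_mul, Real.norm_eq_abs, Real.abs_exp]
      rw [integral_const_mul]
      have h1 : ∫ t in Set.Ici 0, Real.exp (-q i * t) ∂μ ≤ ∫ t in Set.Ici 0, Real.exp (-c * t) ∂μ := by
        refine setIntegral_mono_on (hqi i) (hμ c hc) measurableSet_Ici fun t ht => ?_
        exact Real.exp_le_exp.2 (by nlinarith [mul_le_mul_of_nonneg_right (hq i) (Set.mem_Ici.1 ht)])
      have h2 : 0 ≤ ∫ t in Set.Ici 0, Real.exp (-q i * t) ∂μ :=
        integral_nonneg fun t => (Real.exp_pos _).le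
      calc |R i| * Real.exp (-η * q i) * ∫ t in Set.Ici 0, Real.exp (-q i * t) ∂μ
          ≤ |B| * Real.exp (-η * q i) * ∫ t in Set.Ici 0, Real.exp (-c * t) ∂μ := by
            gcongr ?_ * _ * ?_
            exact (hR i).trans (le_abs_self B)
        _ = _ := by ring
  refine Tendsto.congr' hint ?_
  refine tendsto_integral_filter_of_dominated_convergence (fun t => C * Real.exp (-c * t))
    ?_ ?_ hbound ?_
  · filter_upwards [self_mem_nhdsWithin] with η hη
    have hη : 0 < η := hη
    refine ContinuousOn.aestronglyMeasurable (hcont.comp (by fun_prop) fun t ht => ?_)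
      measurableSet_Ici
    have ht : 0 ≤ t := ht
    exact Set.mem_Ici.2 (by linarith)
  · filter_upwards [self_mem_nhdsWithin] with η hη
    have hη : 0 < η := hη
    filter_upwards [hmem] with t ht
    have ht : 0 ≤ t := ht
    have h1 := hC (t + η) (by linarith)
    have hC0 : 0 ≤ C := by
      have := (abs_nonneg _).trans (hC 0 le_rfl)
      simpa using this
    refine h1.trans ?_
    gcongr ?_ * ?_
    exact Real.exp_le_exp.2 (by nlinarith)
  · filter_upwards [hmem] with t ht
    have ht : 0 ≤ t := ht
    refine (hcont t ht).tendsto.comp (tendsto_nhdsWithin_iff.2 ⟨?_, ?_⟩)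
    · have : Tendsto (fun η : ℝ => t + η) (𝓝 0) (𝓝 (t + 0)) := by
        exact (continuous_const.add continuous_id).tendsto 0
      rw [add_zero] at this
      exact this.mono_left nhdsWithin_le_nhds
    · filter_upwards [self_mem_nhdsWithin] with η hη
      have hη : 0 < η := hη
      exact Set.mem_Ici.2 (by linarith)

/-- Cutoff Ewald sums converge to half the integral of the theta series of the autocorrelation,
without its self-energy term. -/
lemma tendsto_ewald {d N : ℕ} (hd : 1 ≤ d) (hN : 1 ≤ N) {a : Fin d → ℝ} (ha : ∀ i, 0 < a i)
    {μ : Measure ℝ}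
    (hμ : ∀ r : ℝ, 0 < r → IntegrableOn (fun t : ℝ => Real.exp (-r * t)) (Set.Ici 0) μ)
    {φ : (Fin d → ℤ) → ℝ}
    (hφ : ∀ (m : Fin d → ℤ) (i : Fin d), φ (m + Pi.single i (N : ℤ)) = φ m)
    (hnorm : ((N : ℝ) ^ d)⁻¹ * ∑ y ∈ periodCell d N, φ y ^ 2 = 1)
    {Θ : ℝ → ℝ}
    (hΘ : ∀ s : ℝ, 0 < s → HasSum (fun m : Fin d → ℤ =>
      (((N : ℝ) ^ d)⁻¹ * ∑ y ∈ periodCell d N, φ y * φ (y + m)) *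
        Real.exp (-s * ∑ i, (a i * m i) ^ 2)) (Θ s))
    (hΘc : ContinuousOn Θ (Set.Ioi 0)) (hΘ0 : Θ 0 = 0) (hΘt : Tendsto Θ (𝓝[>] 0) (𝓝 0)) :
    IntegrableOn (fun t => Θ t - 1) (Set.Ici 0) μ ∧
    Tendsto (fun η : ℝ => (2 * (N : ℝ) ^ d)⁻¹ * ∑ y ∈ periodCell d N,
      ∑' m : {m : Fin d → ℤ // m ≠ 0}, φ y * φ (y + m.1) *
        (∫ t in Set.Ici 0, Real.exp (-(∑ i, (a i * m.1 i) ^ 2) * t) ∂μ) *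
          Real.exp (-η * ∑ i, (a i * m.1 i) ^ 2))
      (𝓝[>] 0) (𝓝 (1 / 2 * ∫ t in Set.Ici 0, (Θ t - 1) ∂μ)) := by
  set q : (Fin d → ℤ) → ℝ := fun m => ∑ i, (a i * m i) ^ 2 with hq
  set R : (Fin d → ℤ) → ℝ := fun m => ((N : ℝ) ^ d)⁻¹ * ∑ y ∈ periodCell d N, φ y * φ (y + m)
    with hRdef
  obtain ⟨c, hc, hcq⟩ : ∃ c : ℝ, 0 < c ∧ ∀ m : Fin d → ℤ, m ≠ 0 → c ≤ q m := by
    have : Nonempty (Fin d) := ⟨⟨0, hd⟩⟩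
    obtain ⟨i₀, hi₀⟩ := Finite.exists_min a
    refine ⟨a i₀ ^ 2, pow_pos (ha i₀) 2, fun m hm => ?_⟩
    obtain ⟨i, hi⟩ := Function.ne_iff.1 hm
    have h1 : (1 : ℝ) ≤ (m i : ℝ) ^ 2 := by
      have : (1 : ℤ) ≤ m i ^ 2 := by
        have : 0 < m i ^ 2 := by have := hi; simp only [Pi.zero_apply] at this; positivity
        omega
      exact_mod_cast this
    calc a i₀ ^ 2 ≤ a i ^ 2 * 1 := by
          rw [mul_one]; exact pow_le_pow_left₀ (ha i₀).le (hi₀ i) 2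
      _ ≤ (a i * m i) ^ 2 := by rw [mul_pow]; gcongr
      _ ≤ q m := Finset.single_le_sum (f := fun i => (a i * (m i : ℝ)) ^ 2)
          (fun j _ => sq_nonneg _) (Finset.mem_univ i)
  have hqsum (s : ℝ) (hs : 0 < s) : Summable fun m : Fin d → ℤ => Real.exp (-s * q m) := by
    have := (hasSum_plane_wave ha 0 hs).summable.norm
    simpa [-Complex.ofReal_exp, hq] using this
  set M := ∑ y ∈ periodCell d N, |φ y|
  have hφM (m : Fin d → ℤ) : |φ m| ≤ M := by
    rw [eq_of_forall_dvd_sub hφ (x := m) (z := fun i => m i % N) fun i => Int.dvd_self_sub_emod]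
    exact Finset.single_le_sum (f := fun y => |φ y|) (fun _ _ => abs_nonneg _)
      (emod_mem_periodCell hN m)
  have hM0 : 0 ≤ M := (abs_nonneg _).trans (hφM 0)
  have hR0 : R 0 = 1 := by simpa [hRdef, sq] using hnorm
  have hRB (m) : |R m| ≤ |((N : ℝ) ^ d)⁻¹| * ∑ y ∈ periodCell d N, M * M := by
    rw [hRdef, abs_mul]
    gcongr
    refine (Finset.abs_sum_le_sum_abs _ _).trans (Finset.sum_le_sum fun y _ => ?_)
    rw [abs_mul]
    exact mul_le_mul (hφM _) (hφM _) (abs_nonneg _) hM0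
  have hsub : Function.Injective (Subtype.val : {m : Fin d → ℤ // m ≠ 0} → _) :=
    Subtype.val_injective
  obtain ⟨hI, hT⟩ := tendsto_tsum_cutoff (ι := {m : Fin d → ℤ // m ≠ 0}) (μ := μ)
    (q := fun m => q m.1) (R := fun m => R m.1) (G := fun t => Θ t - 1) hc
    (fun m => hcq m.1 m.2) (fun s hs => (hqsum s hs).comp_injective hsub) (fun m => hRB m.1) hμ
    (fun s hs => by
      have h := hΘ s hs
      have h0 : R 0 * Real.exp (-s * q 0) = 1 := by rw [hR0]; simp [hq]
      have h1 : HasSum ((fun m => R m * Real.exp (-s * q m)) ∘ Subtype.val :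
          ((({0} : Finset (Fin d → ℤ)) : Set (Fin d → ℤ))ᶜ : Set _) → ℝ) (Θ s - 1) := by
        have := (Finset.hasSum_compl_iff (f := fun m => R m * Real.exp (-s * q m))
          (a := Θ s - 1) {0}).2 (by rw [Finset.sum_singleton, h0, sub_add_cancel]; exact h)
        exact this
      have h2 : {m : Fin d → ℤ | m ≠ 0} =
          ((({0} : Finset (Fin d → ℤ)) : Set (Fin d → ℤ))ᶜ : Set _) := by
        ext; simp
      rw [← h2] at h1
      exact h1)
    (hΘc.sub continuousOn_const) (by simpa [hΘ0] using hΘt.sub_const 1)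
  refine ⟨hI, (hT.const_mul (1 / 2)).congr' ?_⟩
  filter_upwards [self_mem_nhdsWithin] with η hη
  have hη : 0 < η := hη
  have hsummable (y : Fin d → ℤ) : Summable fun m : {m : Fin d → ℤ // m ≠ 0} =>
      φ y * φ (y + m.1) * (∫ t in Set.Ici 0, Real.exp (-q m.1 * t) ∂μ) *
        Real.exp (-η * q m.1) := by
    refine Summable.of_norm_bounded (((hqsum η hη).comp_injective hsub).mul_left
      (M * M * ∫ t in Set.Ici 0, Real.exp (-c * t) ∂μ)) fun m => ?_
    have h1 : ∫ t in Set.Ici 0, Real.exp (-q m.1 * t) ∂μ ≤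
        ∫ t in Set.Ici 0, Real.exp (-c * t) ∂μ :=
      setIntegral_mono_on (hμ _ (hc.trans_le (hcq m.1 m.2))) (hμ c hc) measurableSet_Ici
        fun t ht => Real.exp_le_exp.2
          (by nlinarith [mul_le_mul_of_nonneg_right (hcq m.1 m.2) (Set.mem_Ici.1 ht)])
    have h2 : 0 ≤ ∫ t in Set.Ici 0, Real.exp (-q m.1 * t) ∂μ :=
      integral_nonneg fun t => (Real.exp_pos _).le
    rw [norm_mul, norm_mul, norm_mul, Real.norm_of_nonneg h2, Real.norm_of_nonneg (Real.exp_pos _).le]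
    simp only [Real.norm_eq_abs, Function.comp_apply]
    exact mul_le_mul_of_nonneg_right (mul_le_mul (mul_le_mul (hφM _) (hφM _) (abs_nonneg _) hM0) h1
      h2 (mul_nonneg hM0 hM0)) (Real.exp_pos _).le
  rw [← Summable.tsum_finsetSum fun y _ => hsummable y, ← tsum_mul_left, ← tsum_mul_left]
  refine tsum_congr fun m => ?_
  rw [← Finset.sum_mul, ← Finset.sum_mul, hRdef, mul_inv]
  ring

lemma coe_div_ne_zero {N : ℕ} {k : ℤ} (h0 : 0 < k) (hN : k < N) :
    ((k / N : ℝ) : UnitAddCircle) ≠ 0 := by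
  intro h
  obtain ⟨n, hn⟩ := (AddCircle.coe_eq_zero_iff 1).1 h
  have hN0 : (0 : ℝ) < N := by exact_mod_cast h0.trans hN
  rw [zsmul_one, eq_div_iff hN0.ne'] at hn
  have hn' : n * (N : ℤ) = k := by exact_mod_cast hn
  rcases le_or_gt n 0 with h | h <;> nlinarith

lemma half_ne_zero : ((1 / 2 : ℝ) : UnitAddCircle) ≠ 0 := by
  simpa using coe_div_ne_zero (N := 2) (k := 1) one_pos (by norm_num)

lemma negOnePow_periodic {d : ℕ} (m : Fin d → ℤ) (i : Fin d) :
    (-1 : ℝ) ^ (∑ j, (m + Pi.single i (2 : ℤ) : Fin d → ℤ) j) = (-1 : ℝ) ^ (∑ j, m j) := by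
  simp [Finset.sum_add_distrib, zpow_add₀]

lemma negOnePow_mul {d : ℕ} (y m : Fin d → ℤ) :
    (-1 : ℝ) ^ (∑ j, y j) * (-1 : ℝ) ^ (∑ j, (y + m) j) = (-1 : ℝ) ^ (∑ j, m j) := by
  simp only [Pi.add_apply, Finset.sum_add_distrib]
  rw [zpow_add₀ (by norm_num), ← mul_assoc, ← mul_zpow]
  simp

lemma card_periodCell (d N : ℕ) : (periodCell d N).card = N ^ d := by
  simp [periodCell]

lemma sum_negOnePow_eq_zero {d : ℕ} (hd : 1 ≤ d) :
    ∑ y ∈ periodCell d 2, (-1 : ℝ) ^ (∑ j, y j) = 0 := by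
  have h (y : Fin d → ℤ) : (-1 : ℝ) ^ (∑ j, y j) = ∏ j, (-1 : ℝ) ^ y j := by
    induction (Finset.univ : Finset (Fin d)) using Finset.induction_on with
    | empty => simp
    | insert i s hi ih => rw [Finset.sum_insert hi, Finset.prod_insert hi, zpow_add₀ (by norm_num), ih]
  simp_rw [h]
  rw [← Finset.prod_univ_sum (fun _ : Fin d => Finset.Ico (0 : ℤ) ((2 : ℕ) : ℤ))
    (fun _ k => (-1 : ℝ) ^ k)]
  refine Finset.prod_eq_zero (Finset.mem_univ ⟨0, hd⟩) ?_
  have : Finset.Ico (0 : ℤ) ((2 : ℕ) : ℤ) = {0, 1} := by decide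
  rw [this]
  norm_num

lemma hasSum_negOnePow {d : ℕ} {a : Fin d → ℝ} (ha : ∀ i, 0 < a i) {s : ℝ} (hs : 0 < s) :
    HasSum (fun m : Fin d → ℤ => (-1 : ℝ) ^ (∑ j, m j) * Real.exp (-s * ∑ i, (a i * m i) ^ 2))
      (∏ i, cosKernel ((1 / 2 : ℝ) : UnitAddCircle) (a i ^ 2 / π * s)) := by
  rw [← Complex.hasSum_ofReal]
  have h := hasSum_plane_wave ha (fun _ => 1 / 2) hs
  rw [← Complex.ofReal_prod] at h
  refine h.congr_fun fun m => ?_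
  rw [Complex.ofReal_mul]
  congr 1
  have : 2 * π * Complex.I * ∑ i, (((1 / 2 : ℝ) : ℂ) * (m i : ℂ)) =
      ((∑ i, m i : ℤ) : ℂ) * (π * Complex.I) := by
    rw [← Finset.mul_sum]
    push_cast
    ring
  rw [this, Complex.exp_int_mul, Complex.exp_pi_mul_I]
  push_cast
  rfl

/-- The theta series attached to the spectral weights `c` of a configuration. -/
noncomputable def spectralTheta {d : ℕ} (N : ℕ) (a : Fin d → ℝ) (c : (Fin d → ℤ) → ℝ) (s : ℝ) : ℝ :=
  ∑ k ∈ periodCell d N, c k * ∏ i, cosKernel ((k i / N : ℝ) : UnitAddCircle) (a i ^ 2 / π * s)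

lemma spectralTheta_zero {d : ℕ} (hd : 1 ≤ d) (N : ℕ) (a : Fin d → ℝ) (c : (Fin d → ℤ) → ℝ) :
    spectralTheta N a c 0 = 0 := by
  refine Finset.sum_eq_zero fun k _ => ?_
  rw [Finset.prod_eq_zero (Finset.mem_univ (⟨0, hd⟩ : Fin d)) (cosKernel_undef _ (by simp)),
    mul_zero]

lemma continuousOn_spectralTheta {d : ℕ} (N : ℕ) {a : Fin d → ℝ} (ha : ∀ i, 0 < a i)
    (c : (Fin d → ℤ) → ℝ) : ContinuousOn (spectralTheta N a c) (Set.Ioi 0) := by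
  have hb (i) : 0 < a i ^ 2 / π := div_pos (pow_pos (ha i) 2) Real.pi_pos
  exact continuousOn_finsetSum _ fun k _ =>
    continuousOn_const.mul (continuousOn_prod_cosKernel hb fun i => ((k i / N : ℝ) : UnitAddCircle))

lemma tendsto_spectralTheta {d N : ℕ} {a : Fin d → ℝ} (ha : ∀ i, 0 < a i)
    {c : (Fin d → ℤ) → ℝ} (hc : c 0 = 0) :
    Tendsto (spectralTheta N a c) (𝓝[>] 0) (𝓝 0) := by
  have hb (i) : 0 < a i ^ 2 / π := div_pos (pow_pos (ha i) 2) Real.pi_pos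
  have h : ∀ k ∈ periodCell d N, Tendsto (fun s : ℝ => c k *
      ∏ i, cosKernel ((k i / N : ℝ) : UnitAddCircle) (a i ^ 2 / π * s)) (𝓝[>] 0) (𝓝 0) := by
    intro k hk
    by_cases hk0 : k = 0
    · simp [hk0, hc]
    · obtain ⟨i, hi⟩ := Function.ne_iff.1 hk0
      have hki := Finset.mem_Ico.1 (Fintype.mem_piFinset.1 hk i)
      have := tendsto_prod_cosKernel hb (u := fun i => ((k i / N : ℝ) : UnitAddCircle)) (i₀ := i)
        (coe_div_ne_zero (lt_of_le_of_ne hki.1 (Ne.symm hi)) hki.2)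
      simpa using this.const_mul (c k)
  have := tendsto_finsetSum _ h
  rw [Finset.sum_const_zero] at this
  exact this

lemma hasSum_spectralTheta {d N : ℕ} {a : Fin d → ℝ} (ha : ∀ i, 0 < a i)
    {c R : (Fin d → ℤ) → ℝ}
    (hR : ∀ m : Fin d → ℤ, (R m : ℂ) = ∑ k ∈ periodCell d N, (c k : ℂ) *
      Complex.exp (2 * π * Complex.I * ∑ i, (((k i / N : ℝ) : ℂ) * m i))) {s : ℝ} (hs : 0 < s) :
    HasSum (fun m : Fin d → ℤ => R m * Real.exp (-s * ∑ i, (a i * m i) ^ 2))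
      (spectralTheta N a c s) := by
  rw [← Complex.hasSum_ofReal]
  have h := hasSum_sum fun k (_ : k ∈ periodCell d N) =>
    (hasSum_plane_wave ha (fun i => (k i / N : ℝ)) hs).mul_left (c k : ℂ)
  have hval : ((spectralTheta N a c s : ℝ) : ℂ) = ∑ k ∈ periodCell d N, (c k : ℂ) *
      ∏ i, (cosKernel ((k i / N : ℝ) : UnitAddCircle) (a i ^ 2 / π * s) : ℂ) := by
    rw [spectralTheta, Complex.ofReal_sum]
    exact Finset.sum_congr rfl fun k _ => by rw [Complex.ofReal_mul, Complex.ofReal_prod]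
  rw [hval]
  refine h.congr_fun fun m => ?_
  rw [Complex.ofReal_mul, hR, Finset.sum_mul]
  exact Finset.sum_congr rfl fun k _ => mul_assoc _ _ _

lemma prod_cosKernel_half_le_spectralTheta {d N : ℕ} {a : Fin d → ℝ} (ha : ∀ i, 0 < a i)
    {c : (Fin d → ℤ) → ℝ} (hc : ∀ k, 0 ≤ c k) (hsum : ∑ k ∈ periodCell d N, c k = 1)
    {s : ℝ} (hs : 0 < s) :
    ∏ i, cosKernel ((1 / 2 : ℝ) : UnitAddCircle) (a i ^ 2 / π * s) ≤ spectralTheta N a c s := by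
  have hpos (i) : 0 < a i ^ 2 / π * s := mul_pos (div_pos (pow_pos (ha i) 2) Real.pi_pos) hs
  refine (one_mul _).symm.trans_le ((congrArg (· * _) hsum.symm).trans_le ?_)
  rw [spectralTheta, Finset.sum_mul]
  refine Finset.sum_le_sum fun k hk => mul_le_mul_of_nonneg_left
    (Finset.prod_le_prod (fun i _ => cosKernel_nonneg _ (hpos i)) fun i _ => ?_) (hc k)
  have hki := Finset.mem_Ico.1 (Fintype.mem_piFinset.1 hk i)
  have h0 : (0 : ℝ) ≤ k i := by exact_mod_cast hki.1
  have h1 : (k i : ℝ) ≤ N := by exact_mod_cast hki.2.le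
  exact cosKernel_half_le (div_nonneg h0 (h0.trans h1)) (div_le_one_of_le₀ h1 (h0.trans h1)) (hpos i)

/-- Born's conjecture: on an orthorhombic lattice of unit density `X = Aℤ^d`,
`A = diag(a₁,…,a_d)`, `a₁⋯a_d = 1`, and for any `f ∈ 𝓕`, the alternating rock-salt
configuration `φ*(m) = (−1)^{m₁+⋯+m_d}` (2-periodic, normalized, charge neutral) has a
well-defined Ewald energy which minimizes the Ewald energy among all periodic
normalized charge-neutral configurations. -/
theorem born_conjecture_orthorhombic (d : ℕ) (hd : 1 ≤ d)
    (a : Fin d → ℝ) (ha : ∀ i, 0 < a i) (hprod : ∏ i, a i = 1)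
    (A : Matrix (Fin d) (Fin d) ℝ) (hA : A = Matrix.diagonal a)
    (μ : Measure ℝ) (f : (Fin d → ℝ) → ℝ)
    (hμf : ∀ x : Fin d → ℝ, x ≠ 0 →
      IntegrableOn (fun t : ℝ => Real.exp (-(∑ i, x i ^ 2) * t)) (Set.Ici 0) μ)
    (hf : ∀ x : Fin d → ℝ, x ≠ 0 →
      f x = ∫ t in Set.Ici 0, Real.exp (-(∑ i, x i ^ 2) * t) ∂μ)
    (Ew : ℕ → ((Fin d → ℤ) → ℝ) → ℝ → Prop)
    (hEw : ∀ (L : ℕ) (χ : (Fin d → ℤ) → ℝ) (e : ℝ),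
      Ew L χ e ↔ Tendsto (fun η : ℝ =>
        (2 * (L : ℝ) ^ d)⁻¹ *
          ∑ y ∈ Fintype.piFinset (fun _ : Fin d => Finset.Ico (0 : ℤ) (L : ℤ)),
            ∑' m : {m : Fin d → ℤ // m ≠ 0},
              χ y * χ (y + m.1) * f (A.mulVec fun j => (m.1 j : ℝ)) *
                Real.exp (-η * ∑ i, (A.mulVec (fun j => (m.1 j : ℝ)) i) ^ 2))
        (𝓝[>] (0 : ℝ)) (𝓝 e))
    (φstar : (Fin d → ℤ) → ℝ)
    (hφstar : ∀ m : Fin d → ℤ, φstar m = (-1 : ℝ) ^ (∑ i, m i)) :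
    (∀ (m : Fin d → ℤ) (i : Fin d), φstar (m + Pi.single i (2 : ℤ)) = φstar m) ∧
    ((2 : ℝ) ^ d)⁻¹ *
      (∑ y ∈ Fintype.piFinset (fun _ : Fin d => Finset.Ico (0 : ℤ) (2 : ℤ)), φstar y ^ 2) = 1 ∧
    (∑ y ∈ Fintype.piFinset (fun _ : Fin d => Finset.Ico (0 : ℤ) (2 : ℤ)), φstar y) = 0 ∧
    ∃ Estar : ℝ, Ew 2 φstar Estar ∧
      ∀ (N : ℕ), 1 ≤ N → ∀ φ : (Fin d → ℤ) → ℝ,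
        (∀ (m : Fin d → ℤ) (i : Fin d), φ (m + Pi.single i (N : ℤ)) = φ m) →
        ((N : ℝ) ^ d)⁻¹ *
          (∑ y ∈ Fintype.piFinset (fun _ : Fin d => Finset.Ico (0 : ℤ) (N : ℤ)), φ y ^ 2) = 1 →
        (∑ y ∈ Fintype.piFinset (fun _ : Fin d => Finset.Ico (0 : ℤ) (N : ℤ)), φ y) = 0 →
        ∃ Ephi : ℝ, Ew N φ Ephi ∧ Estar ≤ Ephi := by
  have hμ (r : ℝ) (hr : 0 < r) : IntegrableOn (fun t : ℝ => Real.exp (-r * t)) (Set.Ici 0) μ := by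
    have h := hμf (Pi.single ⟨0, hd⟩ (Real.sqrt r)) (by simpa using (Real.sqrt_pos.2 hr).ne')
    simpa [Pi.single_apply, ite_pow, Real.sq_sqrt hr.le] using h
  have hmul (m : Fin d → ℤ) (i : Fin d) :
      A.mulVec (fun j => (m j : ℝ)) i = a i * m i := by
    rw [hA, Matrix.mulVec_diagonal]
  have hfA (m : {m : Fin d → ℤ // m ≠ 0}) : f (A.mulVec fun j => (m.1 j : ℝ)) =
      ∫ t in Set.Ici 0, Real.exp (-(∑ i, (a i * m.1 i) ^ 2) * t) ∂μ := by
    rw [hf _ fun h => m.2 ?_]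
    · simp_rw [hmul]
    · ext i
      have := congrFun h i
      rw [hmul] at this
      simpa [(ha i).ne'] using this
  simp_rw [hfA, hmul] at hEw
  obtain rfl : φstar = fun m => (-1 : ℝ) ^ (∑ i, m i) := funext hφstar
  have hper : ∀ (m : Fin d → ℤ) (i : Fin d),
      (-1 : ℝ) ^ (∑ j, (m + Pi.single i ((2 : ℕ) : ℤ) : Fin d → ℤ) j) = (-1 : ℝ) ^ (∑ j, m j) :=
    negOnePow_periodic
  have hsq (y : Fin d → ℤ) : ((-1 : ℝ) ^ (∑ i, y i)) ^ 2 = 1 := by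
    rw [← zpow_natCast, zpow_comm, zpow_natCast, neg_one_sq, one_zpow]
  have hnorm : (((2 : ℕ) : ℝ) ^ d)⁻¹ *
      ∑ y ∈ periodCell d 2, ((-1 : ℝ) ^ (∑ i, y i)) ^ 2 = 1 := by
    simp [hsq]
  have hR (m : Fin d → ℤ) : (((2 : ℕ) : ℝ) ^ d)⁻¹ * ∑ y ∈ periodCell d 2,
      (-1 : ℝ) ^ (∑ i, y i) * (-1 : ℝ) ^ (∑ i, (y + m) i) = (-1 : ℝ) ^ (∑ i, m i) := by
    rw [Finset.sum_congr rfl fun y _ => negOnePow_mul y m, Finset.sum_const, card_periodCell,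
      nsmul_eq_mul]
    push_cast
    field_simp
  have hb (i) : 0 < a i ^ 2 / π := div_pos (pow_pos (ha i) 2) Real.pi_pos
  obtain ⟨hIstar, hTstar⟩ := tendsto_ewald hd one_le_two ha hμ hper hnorm
    (Θ := fun s => ∏ i, cosKernel ((1 / 2 : ℝ) : UnitAddCircle) (a i ^ 2 / π * s))
    (fun s hs => by simpa only [hR] using hasSum_negOnePow ha hs)
    (continuousOn_prod_cosKernel hb _)
    (Finset.prod_eq_zero (Finset.mem_univ (⟨0, hd⟩ : Fin d)) (cosKernel_undef _ (by simp)))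
    (tendsto_prod_cosKernel hb (i₀ := ⟨0, hd⟩) half_ne_zero)
  refine ⟨negOnePow_periodic, by exact_mod_cast hnorm, by exact_mod_cast sum_negOnePow_eq_zero hd,
    _, (hEw 2 _ _).2 hTstar, fun N hN φ hφ hφn hφ0 => ?_⟩
  obtain ⟨c, hc, hc0, hR⟩ := exists_spectral_weights hN hφ
  have hcsum : ∑ k ∈ periodCell d N, c k = 1 := by
    have h := hR 0
    simp only [add_zero, ← sq] at h
    rw [hφn] at h
    simp only [Pi.zero_apply, Int.cast_zero, mul_zero, Finset.sum_const_zero, Complex.exp_zero,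
      mul_one] at h
    exact_mod_cast h.symm
  obtain ⟨hI, hT⟩ := tendsto_ewald hd hN ha hμ hφ hφn
    (fun s hs => hasSum_spectralTheta ha hR hs) (continuousOn_spectralTheta N ha c)
    (spectralTheta_zero hd N a c) (tendsto_spectralTheta ha (hc0 hφ0))
  refine ⟨_, (hEw N φ _).2 hT, ?_⟩
  refine mul_le_mul_of_nonneg_left ?_ (by norm_num)
  refine setIntegral_mono_on hIstar hI measurableSet_Ici fun t ht => sub_le_sub_right ?_ 1
  rcases (Set.mem_Ici.1 ht).eq_or_lt with rfl | ht
  · rw [spectralTheta_zero hd,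
      Finset.prod_eq_zero (Finset.mem_univ (⟨0, hd⟩ : Fin d)) (cosKernel_undef _ (by simp))]
  · exact prod_cosKernel_half_le_spectralTheta ha hc hcsum ht
end

section
/- Let d ≥ 1, N ≥ 2, 0 < s ≤ d, let A be an invertible real d×d matrix with |det A| = 1, B = (A⁻¹)ᵀ, and let f_s(x) = |x|^{−s}. Let φ : ℤ^d → ℝ be N-periodic satisfying the normalization and the charge neutrality constraint, with dual weights ξ. For j ∈ K_N∖{0}, set Z_j := (π^{s/2}/Γ(s/2)) · [ −2/s + ∫_1^∞ ∑_{n∈ℤ^d∖{0}} e^{2πi n·j/N} e^{−πt|An|²} t^{s/2−1} dt + ∫_1^∞ ∑_{n∈ℤ^d} e^{−πt|B(n + j/N)|²} t^{(d−s)/2−1} dt ] (this is the analytic continuation Z(0; Aᵀ B j/N)(q_X; s) of Epstein's zeta function of the quadratic form q_X(n) = |An|²). Then each ξ(j) ≥ 0, the Ewald energy E_{X,f_s}[φ] exists, and E_{X,f_s}[φ] = (2N^d)^{−1} ∑_{j∈K_N∖{0}} ξ(j) Z_j. -/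
open scoped Real BigOperators Topology
open MeasureTheory Filter Complex

namespace EwaldEpstein

variable {d : ℕ}

/-- The quadratic form `x ↦ |Ax|²` of the lattice `Aℤ^d`. -/
noncomputable def quadForm (A : Matrix (Fin d) (Fin d) ℝ) (x : Fin d → ℝ) : ℝ :=
  ∑ i, (A.mulVec x i) ^ 2

/-- The additive character `n ↦ e^{2πi n·x}` of `ℤ^d`. -/
noncomputable def latticeChar (x : Fin d → ℝ) (n : Fin d → ℤ) : ℂ :=
  cexp (2 * π * I * ((∑ i, (n i : ℝ) * x i : ℝ) : ℂ))

lemma norm_latticeChar (x : Fin d → ℝ) (n : Fin d → ℤ) : ‖latticeChar x n‖ = 1 := by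
  rw [latticeChar, show (2 * π * I * ((∑ i, (n i : ℝ) * x i : ℝ) : ℂ))
    = ((2 * π * (∑ i, (n i : ℝ) * x i) : ℝ) : ℂ) * I by push_cast; ring]
  exact norm_exp_ofReal_mul_I _

lemma continuous_quadForm (A : Matrix (Fin d) (Fin d) ℝ) : Continuous (quadForm A) := by
  unfold quadForm
  fun_prop

lemma quadForm_nonneg (A : Matrix (Fin d) (Fin d) ℝ) (x : Fin d → ℝ) : 0 ≤ quadForm A x :=
  Finset.sum_nonneg fun _ _ => sq_nonneg _

lemma quadForm_coercive {A : Matrix (Fin d) (Fin d) ℝ} (hA : IsUnit A.det) :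
    ∃ c : ℝ, 0 < c ∧ ∀ x : Fin d → ℝ, c * ∑ i, x i ^ 2 ≤ quadForm A x := by
  set M : ℝ := 1 + ∑ i, ∑ j, A⁻¹ i j ^ 2 with hM
  have hM0 : 0 < M := by positivity
  refine ⟨M⁻¹, inv_pos.2 hM0, fun x => ?_⟩
  rw [inv_mul_le_iff₀ hM0]
  have hx : x = A⁻¹.mulVec (A.mulVec x) := by
    rw [Matrix.mulVec_mulVec, Matrix.nonsing_inv_mul _ hA, Matrix.one_mulVec]
  have hq := quadForm_nonneg A x
  calc ∑ i, x i ^ 2 = ∑ i, (∑ j, A⁻¹ i j * A.mulVec x j) ^ 2 := by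
        refine Finset.sum_congr rfl fun i _ => ?_
        conv_lhs => rw [hx]
        rfl
    _ ≤ ∑ i, (∑ j, A⁻¹ i j ^ 2) * quadForm A x :=
        Finset.sum_le_sum fun i _ => Finset.sum_mul_sq_le_sq_mul_sq _ _ _
    _ = (∑ i, ∑ j, A⁻¹ i j ^ 2) * quadForm A x := by rw [Finset.sum_mul]
    _ ≤ M * quadForm A x := by rw [hM]; nlinarith

lemma summable_exp_neg_mul_int_sq {c : ℝ} (hc : 0 < c) :
    Summable fun n : ℤ => Real.exp (-c * (n : ℝ) ^ 2) := by
  have hsum : Summable fun n : ℕ => Real.exp (-c * n) := by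
    simpa [mul_comm] using Real.summable_exp_nat_mul_iff.2 (neg_lt_zero.2 hc)
  have key : ∀ n : ℕ, Real.exp (-c * (n : ℝ) ^ 2) ≤ Real.exp (-c * n) := fun n => by
    apply Real.exp_le_exp.2
    have : (n : ℝ) ≤ (n : ℝ) ^ 2 := by exact_mod_cast Nat.le_self_pow two_ne_zero n
    nlinarith
  refine Summable.of_nat_of_neg ?_ ?_ <;>
  · refine Summable.of_nonneg_of_le (fun _ => (Real.exp_pos _).le) (fun n => ?_) hsum
    simpa using key n

lemma summable_exp_neg_mul_sum_sq {c : ℝ} (hc : 0 < c) :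
    Summable fun n : Fin d → ℤ => Real.exp (-c * ∑ i, (n i : ℝ) ^ 2) := by
  classical
  have h1 := summable_exp_neg_mul_int_sq hc
  refine summable_of_sum_le (c := ∏ _i : Fin d, ∑' n : ℤ, Real.exp (-c * (n : ℝ) ^ 2))
    (fun _ => (Real.exp_pos _).le) fun u => ?_
  calc ∑ n ∈ u, Real.exp (-c * ∑ i, (n i : ℝ) ^ 2)
      ≤ ∑ n ∈ Fintype.piFinset fun i => u.image fun n : Fin d → ℤ => n i,
          Real.exp (-c * ∑ i, (n i : ℝ) ^ 2) := by
        refine Finset.sum_le_sum_of_subset_of_nonneg (fun n hn => ?_)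
          fun _ _ _ => (Real.exp_pos _).le
        exact Fintype.mem_piFinset.2 fun i => Finset.mem_image_of_mem _ hn
    _ = ∏ i, ∑ m ∈ u.image fun n : Fin d → ℤ => n i, Real.exp (-c * (m : ℝ) ^ 2) := by
        rw [Finset.prod_univ_sum]
        refine Finset.sum_congr rfl fun n _ => ?_
        rw [Finset.mul_sum, Real.exp_sum]
    _ ≤ _ := Finset.prod_le_prod (fun _ _ => Finset.sum_nonneg fun _ _ => (Real.exp_pos _).le)
        fun i _ => h1.sum_le_tsum _ fun _ _ => (Real.exp_pos _).le

/-- Gaussians of a lattice translate are summable, uniformly for bounded translations. -/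
lemma exists_summable_bound_exp_quadForm {A : Matrix (Fin d) (Fin d) ℝ} (hA : IsUnit A.det)
    {a : ℝ} (ha : 0 < a) (R : ℝ) :
    ∃ u : (Fin d → ℤ) → ℝ, Summable u ∧ ∀ (x : Fin d → ℝ) (n : Fin d → ℤ), ‖x‖ ≤ R →
      Real.exp (-π * a * quadForm A (fun i => n i + x i)) ≤ u n := by
  obtain ⟨c, hc, hcA⟩ := quadForm_coercive hA
  have hk : 0 < π * a * c := by positivity
  refine ⟨fun n => Real.exp (π * a * c * (d * R ^ 2)) *
    Real.exp (-(π * a * c / 2) * ∑ i, (n i : ℝ) ^ 2),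
    (summable_exp_neg_mul_sum_sq (by positivity)).mul_left _, fun x n hx => ?_⟩
  beta_reduce
  rw [← Real.exp_add, Real.exp_le_exp]
  have h1 : ∑ i, (n i : ℝ) ^ 2 ≤ 2 * ∑ i, ((n i : ℝ) + x i) ^ 2 + 2 * (d * R ^ 2) := by
    have : (d * R ^ 2 : ℝ) = ∑ _i : Fin d, R ^ 2 := by simp
    rw [this, Finset.mul_sum, Finset.mul_sum, ← Finset.sum_add_distrib]
    refine Finset.sum_le_sum fun i _ => ?_
    have h2 : |x i| ≤ R := (norm_le_pi_norm x i).trans hx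
    have h3 : x i ^ 2 ≤ R ^ 2 := sq_le_sq' (abs_le.1 h2).1 (abs_le.1 h2).2
    nlinarith [sq_nonneg ((n i : ℝ) + 2 * x i)]
  have h4 := mul_le_mul_of_nonneg_left (hcA fun i => n i + x i) (by positivity : 0 ≤ π * a)
  have h5 := mul_le_mul_of_nonneg_left h1 hk.le
  nlinarith

lemma summable_exp_quadForm {A : Matrix (Fin d) (Fin d) ℝ} (hA : IsUnit A.det)
    {a : ℝ} (ha : 0 < a) (x : Fin d → ℝ) :
    Summable fun n : Fin d → ℤ => Real.exp (-π * a * quadForm A (fun i => n i + x i)) := by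
  obtain ⟨u, hu, h⟩ := exists_summable_bound_exp_quadForm hA ha ‖x‖
  exact hu.of_nonneg_of_le (fun _ => (Real.exp_pos _).le) fun n => h x n le_rfl

lemma continuous_tsum_comp_add {f : (Fin d → ℝ) → ℂ} (hf : Continuous f)
    (hb : ∀ R : ℝ, ∃ u : (Fin d → ℤ) → ℝ, Summable u ∧
      ∀ (x : Fin d → ℝ) (n : Fin d → ℤ), ‖x‖ ≤ R → ‖f (fun i => n i + x i)‖ ≤ u n) :
    Continuous fun x : Fin d → ℝ => ∑' n : Fin d → ℤ, f (fun i => n i + x i) := by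
  refine continuous_iff_continuousAt.2 fun x => ?_
  obtain ⟨u, hu, h⟩ := hb (‖x‖ + 1)
  refine ContinuousOn.continuousAt (s := Metric.closedBall 0 (‖x‖ + 1))
    (continuousOn_tsum (fun n => (hf.comp (by fun_prop)).continuousOn) hu
      fun n y hy => h y n (by simpa using hy)) ?_
  exact Filter.mem_of_superset (Metric.isOpen_ball.mem_nhds (by simp : x ∈ Metric.ball 0 (‖x‖ + 1)))
    Metric.ball_subset_closedBall

lemma tsum_comp_add_intCast (f : (Fin d → ℝ) → ℂ) (x : Fin d → ℝ) (m : Fin d → ℤ) :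
    ∑' n : Fin d → ℤ, f (fun i => n i + (m i + x i)) =
      ∑' n : Fin d → ℤ, f (fun i => n i + x i) := by
  rw [← (Equiv.addRight m).tsum_eq fun n : Fin d → ℤ => f (fun i => n i + x i)]
  refine tsum_congr fun n => congrArg f (funext fun i => ?_)
  simp [add_assoc]

lemma isOpenQuotientMap_unitAddTorus_mk :
    IsOpenQuotientMap fun (x : Fin d → ℝ) (i : Fin d) => (x i : UnitAddCircle) :=
  IsOpenQuotientMap.piMap fun _ => QuotientAddGroup.isOpenQuotientMap_mk

/-- The periodization of a function on `ℝ^d`, as a function on the torus. -/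
lemma exists_periodization {f : (Fin d → ℝ) → ℂ} (hf : Continuous f)
    (hb : ∀ R : ℝ, ∃ u : (Fin d → ℤ) → ℝ, Summable u ∧
      ∀ (x : Fin d → ℝ) (n : Fin d → ℤ), ‖x‖ ≤ R → ‖f (fun i => n i + x i)‖ ≤ u n) :
    ∃ F : C(UnitAddTorus (Fin d), ℂ), ∀ x : Fin d → ℝ,
      F (fun i => (x i : UnitAddCircle)) = ∑' n : Fin d → ℤ, f (fun i => n i + x i) := by
  set G : (Fin d → ℝ) → ℂ := fun x => ∑' n : Fin d → ℤ, f (fun i => n i + x i) with hG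
  have hq := isOpenQuotientMap_unitAddTorus_mk (d := d)
  have hfac : Function.FactorsThrough G
      fun (x : Fin d → ℝ) (i : Fin d) => (x i : UnitAddCircle) := by
    intro x y hxy
    have : ∀ i, ∃ k : ℤ, x i = k + y i := fun i => by
      have h : ((x i - y i : ℝ) : UnitAddCircle) = 0 := by
        rw [AddCircle.coe_sub, sub_eq_zero]
        exact congrFun hxy i
      obtain ⟨k, hk⟩ := AddCircle.coe_eq_zero_iff _ |>.1 h
      exact ⟨k, by simp at hk; linarith⟩
    choose m hm using this
    rw [show x = fun i => m i + y i from funext hm]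
    exact tsum_comp_add_intCast f y m
  refine ⟨⟨Function.extend
    (fun (x : Fin d → ℝ) (i : Fin d) => (x i : UnitAddCircle)) G 0, ?_⟩, fun x => hfac.extend_apply 0 x⟩
  refine hq.isQuotientMap.continuous_iff.2 ?_
  convert continuous_tsum_comp_add hf hb using 1
  exact funext fun x => hfac.extend_apply 0 x

lemma mFourier_coe (n : Fin d → ℤ) (x : Fin d → ℝ) :
    UnitAddTorus.mFourier n (fun i => (x i : UnitAddCircle)) = latticeChar x n := by
  simp only [UnitAddTorus.mFourier, ContinuousMap.coe_mk, fourier_coe_apply, latticeChar]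
  rw [← Complex.exp_sum]
  congr 1
  push_cast
  rw [Finset.mul_sum]
  exact Finset.sum_congr rfl fun i _ => by ring

lemma latticeChar_add_intCast (n m : Fin d → ℤ) (x : Fin d → ℝ) :
    latticeChar (fun i => m i + x i) n = latticeChar x n := by
  rw [← mFourier_coe, ← mFourier_coe]
  congr 1
  funext i
  simp

lemma measurableSet_unitBox :
    MeasurableSet {x : Fin d → ℝ | ∀ i, x i ∈ Set.Ioc (0 : ℝ) (0 + 1)} :=
  MeasurableSet.univ_pi' fun _ => measurableSet_Ioc

lemma iUnion_translate_unitBox :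
    ⋃ m : Fin d → ℤ, (fun x : Fin d → ℝ => fun i => m i + x i) ''
      {x : Fin d → ℝ | ∀ i, x i ∈ Set.Ioc (0 : ℝ) (0 + 1)} = Set.univ := by
  refine Set.eq_univ_of_forall fun x => Set.mem_iUnion.2 ⟨fun i => ⌈x i⌉ - 1,
    fun i => x i - (⌈x i⌉ - 1), fun i => ⟨?_, ?_⟩, ?_⟩
  · linarith [Int.ceil_lt_add_one (x i)]
  · linarith [Int.le_ceil (x i)]
  · funext i
    push_cast
    ring

lemma pairwise_disjoint_translate_unitBox :
    Pairwise (Function.onFun Disjoint fun m : Fin d → ℤ => (fun x : Fin d → ℝ => fun i => m i + x i) ''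
      {x : Fin d → ℝ | ∀ i, x i ∈ Set.Ioc (0 : ℝ) (0 + 1)}) := by
  intro m n hmn
  refine Set.disjoint_left.2 ?_
  rintro _ ⟨x, hx, rfl⟩ ⟨y, hy, hxy⟩
  refine hmn (funext fun i => ?_)
  have h := congrFun hxy i
  have hxi := hx i
  have hyi := hy i
  simp only [zero_add, Set.mem_Ioc] at h hxi hyi
  have h1 : ((m i : ℤ) : ℝ) < n i + 1 := by linarith
  have h2 : ((n i : ℤ) : ℝ) < m i + 1 := by linarith
  have h1' : m i < n i + 1 := by exact_mod_cast h1
  have h2' : n i < m i + 1 := by exact_mod_cast h2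
  omega

lemma integral_unitBox_tsum {g : (Fin d → ℝ) → ℂ} (hg : Integrable g)
    {u : (Fin d → ℤ) → ℝ} (hu : Summable u)
    (hgu : ∀ (x : Fin d → ℝ) (n : Fin d → ℤ), ‖x‖ ≤ 1 → ‖g (fun i => n i + x i)‖ ≤ u n) :
    ∫ x in {x : Fin d → ℝ | ∀ i, x i ∈ Set.Ioc (0 : ℝ) (0 + 1)},
      ∑' n : Fin d → ℤ, g (fun i => n i + x i) = ∫ x, g x := by
  set S : Set (Fin d → ℝ) := {x | ∀ i, x i ∈ Set.Ioc (0 : ℝ) (0 + 1)} with hS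
  have hSm : MeasurableSet S := measurableSet_unitBox
  have hSv : volume S = 1 := by
    have : S = Set.univ.pi fun _ => Set.Ioc (0 : ℝ) (0 + 1) := by
      ext x
      simp [hS]
    simp [this, Real.volume_pi_Ioc]
  have hmp : ∀ n : Fin d → ℤ, MeasurePreserving (fun x : Fin d → ℝ => fun i => (n i : ℝ) + x i) :=
    fun n => measurePreserving_add_left volume fun i => (n i : ℝ)
  have hme : ∀ n : Fin d → ℤ, MeasurableEmbedding (fun x : Fin d → ℝ => fun i => (n i : ℝ) + x i) :=
    fun n => measurableEmbedding_addLeft fun i => (n i : ℝ)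
  have hint : ∀ n : Fin d → ℤ, Integrable (fun x : Fin d → ℝ => g (fun i => n i + x i)) :=
    fun n => (hmp n).integrable_comp_of_integrable hg
  have h1 := integral_iUnion (f := g) (μ := volume)
    (fun m : Fin d → ℤ => (hme m).measurableSet_image.2 hSm)
    pairwise_disjoint_translate_unitBox hg.integrableOn
  rw [iUnion_translate_unitBox, setIntegral_univ] at h1
  rw [h1]
  rw [← integral_tsum_of_summable_integral_norm (fun n => (hint n).integrableOn)]
  · refine tsum_congr fun n => ?_
    rw [(hmp n).setIntegral_image_emb (hme n)]
  · refine hu.of_nonneg_of_le (fun n => integral_nonneg fun _ => norm_nonneg _) fun n => ?_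
    have := norm_setIntegral_le_of_norm_le_const (μ := volume) (s := S) (C := u n)
      (f := fun x => ‖g (fun i => n i + x i)‖) (by simp [hSv]) fun x hx => ?_
    · rw [Real.norm_of_nonneg (integral_nonneg fun _ => norm_nonneg _)] at this
      simpa [Measure.real, hSv] using this
    · rw [norm_norm]
      refine hgu x n ((pi_norm_le_iff_of_nonneg zero_le_one).2 fun i => ?_)
      have := hx i
      rw [Real.norm_eq_abs, abs_le]
      constructor <;> linarith [this.1, this.2]

/-- Poisson summation on `ℤ^d`. -/
lemma tsum_comp_add_eq_tsum_fourier {f : (Fin d → ℝ) → ℂ} (hf : Continuous f) (hfi : Integrable f)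
    (hb : ∀ R : ℝ, ∃ u : (Fin d → ℤ) → ℝ, Summable u ∧
      ∀ (x : Fin d → ℝ) (n : Fin d → ℤ), ‖x‖ ≤ R → ‖f (fun i => n i + x i)‖ ≤ u n)
    (hs : Summable fun n : Fin d → ℤ => ∫ x, latticeChar x (-n) * f x) (x : Fin d → ℝ) :
    ∑' n : Fin d → ℤ, f (fun i => n i + x i) =
      ∑' n : Fin d → ℤ, (∫ y, latticeChar y (-n) * f y) * latticeChar x n := by
  obtain ⟨F, hF⟩ := exists_periodization hf hb
  have hcont : ∀ n : Fin d → ℤ, Continuous fun y : Fin d → ℝ => latticeChar y n := fun n => by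
    unfold latticeChar
    fun_prop
  have hcoef : UnitAddTorus.mFourierCoeff F = fun n => ∫ y, latticeChar y (-n) * f y := by
    funext n
    obtain ⟨u, hu, h⟩ := hb 1
    rw [UnitAddTorus.mFourierCoeff_eq_integral F n 0, ← integral_unitBox_tsum ?_ hu ?_]
    · refine setIntegral_congr_fun measurableSet_unitBox fun y _ => ?_
      simp only [mFourier_coe, hF, smul_eq_mul, latticeChar_add_intCast, tsum_mul_left]
    · exact hfi.bdd_mul (c := 1) (hcont _).aestronglyMeasurable
        (ae_of_all _ fun y => (norm_latticeChar _ _).le)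
    · intro y m hy
      rw [norm_mul, norm_latticeChar, one_mul]
      exact h y m hy
  have := UnitAddTorus.hasSum_mFourier_series_apply_of_summable (f := F) (hcoef ▸ hs)
    fun i => (x i : UnitAddCircle)
  rw [hF, hcoef] at this
  rw [← this.tsum_eq]
  simp [mFourier_coe]

lemma measurePreserving_mulVec {B : Matrix (Fin d) (Fin d) ℝ} (hB : |B.det| = 1) :
    MeasurePreserving (fun x : Fin d → ℝ => B.mulVec x) := by
  have h0 : B.det ≠ 0 := fun h => by simp [h] at hB
  refine ⟨by fun_prop, ?_⟩
  have := Real.map_matrix_volume_pi_eq_smul_volume_pi h0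
  rw [abs_inv, hB] at this
  simpa using! this

lemma integral_latticeChar_mul_gaussian {A B : Matrix (Fin d) (Fin d) ℝ} (hA : IsUnit A.det)
    (hdet : |A.det| = 1) (hB : B = A⁻¹.transpose) {a : ℝ} (ha : 0 < a) (n : Fin d → ℤ) :
    ∫ x : Fin d → ℝ, latticeChar x (-n) * (Real.exp (-π * a * quadForm B x) : ℂ) =
      ((a ^ (-(d : ℝ) / 2) * Real.exp (-π * a⁻¹ * quadForm A fun i => n i) : ℝ) : ℂ) := by
  have hBdet : |B.det| = 1 := by
    rw [hB, Matrix.det_transpose, Matrix.det_nonsing_inv, Ring.inverse_eq_inv', abs_inv, hdet,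
      inv_one]
  have hmp := measurePreserving_mulVec hBdet
  have hinj : Function.Injective fun x : Fin d → ℝ => B.mulVec x := by
    refine Matrix.mulVec_injective_iff_isUnit.2 ((Matrix.isUnit_iff_isUnit_det _).2 ?_)
    refine isUnit_iff_ne_zero.2 fun h => ?_
    simp [h] at hBdet
  have hme : MeasurableEmbedding fun x : Fin d → ℝ => B.mulVec x :=
    (Continuous.measurableEmbedding (by fun_prop) hinj)
  set v : Fin d → ℝ := A.mulVec fun i => (n i : ℝ) with hv
  have hdot : ∀ x : Fin d → ℝ, ∑ i, (n i : ℝ) * x i = ∑ i, v i * B.mulVec x i := by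
    intro x
    change (fun i => (n i : ℝ)) ⬝ᵥ x = v ⬝ᵥ B.mulVec x
    rw [hv, Matrix.dotProduct_mulVec, ← Matrix.mulVec_transpose, hB, Matrix.transpose_transpose,
      Matrix.mulVec_mulVec, Matrix.nonsing_inv_mul _ hA, Matrix.one_mulVec]
  have hre : 0 < ((π * a : ℝ) : ℂ).re := by rw [ofReal_re]; positivity
  have hg := GaussianFourier.integral_cexp_neg_mul_sum_add hre
    fun i : Fin d => -(2 * π * I * (v i : ℂ))
  rw [← hmp.integral_comp hme] at hg
  have hl : ∀ x : Fin d → ℝ, latticeChar x (-n) * (Real.exp (-π * a * quadForm B x) : ℂ) =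
      cexp (-((π * a : ℝ) : ℂ) * ∑ i, ((B.mulVec x i : ℝ) : ℂ) ^ 2 +
        ∑ i, -(2 * π * I * (v i : ℂ)) * ((B.mulVec x i : ℝ) : ℂ)) := by
    intro x
    rw [latticeChar, ofReal_exp, ← Complex.exp_add]
    congr 1
    have : (∑ i, (((-n) i : ℤ) : ℝ) * x i) = -∑ i, v i * B.mulVec x i := by
      rw [← hdot, ← Finset.sum_neg_distrib]
      exact Finset.sum_congr rfl fun i _ => by simp
    rw [this, quadForm]
    push_cast
    simp only [Finset.mul_sum, neg_mul, Finset.sum_neg_distrib, mul_neg, mul_assoc]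
    ring
  simp_rw [hl]
  rw [hg, ofReal_mul (a ^ _), ofReal_exp]
  congr 1
  · have hpi : (π : ℂ) / ((π * a : ℝ) : ℂ) = ((a⁻¹ : ℝ) : ℂ) := by
      have := Real.pi_ne_zero
      rw [← ofReal_div]
      congr 1
      field_simp
    rw [hpi, Fintype.card_fin, show ((d : ℂ) / 2) = ((d / 2 : ℝ) : ℂ) by push_cast; rfl,
      ← ofReal_cpow (by positivity), Real.inv_rpow ha.le, ← Real.rpow_neg ha.le, neg_div]
  · congr 1
    have hpi : (π : ℂ) ≠ 0 := by exact_mod_cast Real.pi_ne_zero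
    have ha' : (a : ℂ) ≠ 0 := by exact_mod_cast ha.ne'
    rw [quadForm, ← hv]
    push_cast
    rw [div_eq_iff (by simp [hpi, ha'])]
    simp only [neg_sq, mul_pow, I_sq, ← Finset.mul_sum]
    field_simp
    ring

/-- The functional equation of the theta function of a unimodular lattice. -/
lemma theta_functional_equation {A B : Matrix (Fin d) (Fin d) ℝ} (hA : IsUnit A.det)
    (hdet : |A.det| = 1) (hB : B = A⁻¹.transpose) {a : ℝ} (ha : 0 < a) (x : Fin d → ℝ) :
    ((∑' n : Fin d → ℤ, Real.exp (-π * a * quadForm B fun i => n i + x i) : ℝ) : ℂ) =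
      ((a ^ (-(d : ℝ) / 2) : ℝ) : ℂ) * ∑' n : Fin d → ℤ, latticeChar x n *
        (Real.exp (-π * a⁻¹ * quadForm A fun i => n i) : ℂ) := by
  have hBu : IsUnit B.det := by
    rw [hB, Matrix.det_transpose]
    exact (Matrix.isUnit_nonsing_inv_det_iff).2 hA
  set f : (Fin d → ℝ) → ℂ := fun y => (Real.exp (-π * a * quadForm B y) : ℂ) with hfdef
  have hf : Continuous f := by
    have := continuous_quadForm B
    fun_prop
  have hfn : ∀ y, ‖f y‖ = Real.exp (-π * a * quadForm B y) := fun y => by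
    rw [hfdef, norm_real, Real.norm_of_nonneg (Real.exp_pos _).le]
  have hfi : Integrable f := by
    obtain ⟨c, hc, hcB⟩ := quadForm_coercive hBu
    have hre : 0 < ((π * a * c : ℝ) : ℂ).re := by rw [ofReal_re]; positivity
    refine (GaussianFourier.integrable_cexp_neg_mul_sum_add hre (0 : Fin d → ℂ)).mono
      hf.aestronglyMeasurable (ae_of_all _ fun y => ?_)
    rw [hfn, norm_exp]
    refine Real.exp_le_exp.2 ?_
    have h := mul_le_mul_of_nonneg_left (hcB y) (by positivity : 0 ≤ π * a)
    have : (-((π * a * c : ℝ) : ℂ) * ∑ i, (y i : ℂ) ^ 2 + ∑ i, (0 : Fin d → ℂ) i * (y i : ℂ)) =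
        ((-(π * a * c) * ∑ i, y i ^ 2 : ℝ) : ℂ) := by
      push_cast
      simp
    rw [this, ofReal_re]
    linarith
  have hcoef := fun n => integral_latticeChar_mul_gaussian hA hdet hB ha n
  have hsum : Summable fun n : Fin d → ℤ => ∫ y, latticeChar y (-n) * f y := by
    simp_rw [hfdef, hcoef]
    have := (summable_exp_quadForm hA (inv_pos.2 ha) 0).mul_left (a ^ (-(d : ℝ) / 2))
    refine Complex.summable_ofReal.2 ?_
    simpa using this
  have hb : ∀ R : ℝ, ∃ u : (Fin d → ℤ) → ℝ, Summable u ∧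
      ∀ (y : Fin d → ℝ) (n : Fin d → ℤ), ‖y‖ ≤ R → ‖f (fun i => n i + y i)‖ ≤ u n := by
    simp_rw [hfn]
    exact exists_summable_bound_exp_quadForm hBu ha
  rw [ofReal_tsum, tsum_comp_add_eq_tsum_fourier hf hfi hb hsum x, ← tsum_mul_left]
  refine tsum_congr fun n => ?_
  simp_rw [hfdef, hcoef]
  push_cast
  ring

/-- The theta function of `Aℤ^d` twisted by a character, without the constant term. -/
noncomputable def puncturedTheta (A : Matrix (Fin d) (Fin d) ℝ) (x : Fin d → ℝ) (t : ℝ) : ℂ :=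
  ∑' n : {n : Fin d → ℤ // n ≠ 0},
    latticeChar x n.1 * (Real.exp (-π * t * quadForm A fun i => n.1 i) : ℂ)

/-- The theta function of the translate of the lattice `Bℤ^d` by `Bx`. -/
noncomputable def shiftedTheta (B : Matrix (Fin d) (Fin d) ℝ) (x : Fin d → ℝ) (t : ℝ) : ℝ :=
  ∑' n : Fin d → ℤ, Real.exp (-π * t * quadForm B fun i => n i + x i)

lemma norm_latticeChar_mul_exp (x : Fin d → ℝ) (n : Fin d → ℤ) (r : ℝ) :
    ‖latticeChar x n * (Real.exp r : ℂ)‖ = Real.exp r := by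
  rw [norm_mul, norm_latticeChar, one_mul, norm_real, Real.norm_of_nonneg (Real.exp_pos _).le]

lemma summable_exp_quadForm_intCast {A : Matrix (Fin d) (Fin d) ℝ} (hA : IsUnit A.det)
    {a : ℝ} (ha : 0 < a) :
    Summable fun n : Fin d → ℤ => Real.exp (-π * a * quadForm A (fun i => n i)) := by
  simpa using summable_exp_quadForm hA ha 0

lemma exists_pos_le_quadForm_intCast {A : Matrix (Fin d) (Fin d) ℝ} (hA : IsUnit A.det) :
    ∃ δ : ℝ, 0 < δ ∧ ∀ n : Fin d → ℤ, n ≠ 0 → δ ≤ quadForm A (fun i => n i) := by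
  obtain ⟨c, hc, h⟩ := quadForm_coercive hA
  refine ⟨c, hc, fun n hn => ?_⟩
  obtain ⟨i, hi⟩ := Function.ne_iff.1 hn
  have h1 : (1 : ℝ) ≤ (n i : ℝ) ^ 2 := by
    have : 1 ≤ n i ^ 2 := Int.one_le_abs (pow_ne_zero 2 hi) |>.trans_eq (abs_of_nonneg (sq_nonneg _))
    exact_mod_cast this
  have h2 : (n i : ℝ) ^ 2 ≤ ∑ i, (n i : ℝ) ^ 2 :=
    Finset.single_le_sum (f := fun i => (n i : ℝ) ^ 2) (fun _ _ => sq_nonneg _) (Finset.mem_univ i)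
  have := h fun i => n i
  nlinarith

lemma tsum_exp_neg_mul_le {ι : Type*} {q : ι → ℝ} {δ : ℝ} (hq : ∀ i, δ ≤ q i)
    (hs : ∀ t : ℝ, 0 < t → Summable fun i => Real.exp (-π * t * q i)) {t : ℝ} (ht : 1 ≤ t) :
    ∑' i, Real.exp (-π * t * q i) ≤
      (Real.exp (π * δ) * ∑' i, Real.exp (-π * 1 * q i)) * Real.exp (-(π * δ) * t) := by
  rw [mul_right_comm, ← Real.exp_add, ← tsum_mul_left]
  refine (hs t (by linarith)).tsum_le_tsum (fun i => ?_) ((hs 1 one_pos).mul_left _)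
  rw [← Real.exp_add, Real.exp_le_exp]
  have := mul_le_mul_of_nonneg_left (hq i) (mul_nonneg Real.pi_pos.le (sub_nonneg.2 ht))
  nlinarith

lemma rpow_le_mul_exp {p k u : ℝ} (hp : 0 < p) (hk : 0 < k) (hu : 0 ≤ u) :
    u ^ p ≤ (p / k) ^ p * Real.exp (k * u) := by
  have h1 : u ≤ p / k * Real.exp (k * u / p) := by
    have h2 := Real.add_one_le_exp (k * u / p)
    calc u = p / k * (k * u / p) := by field_simp
      _ ≤ _ := mul_le_mul_of_nonneg_left (by linarith) (by positivity)
  calc u ^ p ≤ (p / k * Real.exp (k * u / p)) ^ p := Real.rpow_le_rpow hu h1 hp.le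
    _ = _ := by
      rw [Real.mul_rpow (by positivity) (Real.exp_pos _).le, ← Real.exp_mul,
        div_mul_cancel₀ _ hp.ne']

lemma puncturedTheta_eq {A B : Matrix (Fin d) (Fin d) ℝ} (hA : IsUnit A.det)
    (hdet : |A.det| = 1) (hB : B = A⁻¹.transpose) {t : ℝ} (ht : 0 < t) (x : Fin d → ℝ) :
    puncturedTheta A x t = ((t ^ (-(d : ℝ) / 2) * shiftedTheta B x t⁻¹ : ℝ) : ℂ) - 1 := by
  have h := theta_functional_equation hA hdet hB (inv_pos.2 ht) x
  rw [inv_inv] at h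
  have hsum : Summable fun n : Fin d → ℤ =>
      latticeChar x n * (Real.exp (-π * t * quadForm A fun i => n i) : ℂ) := by
    refine Summable.of_norm ?_
    simp_rw [norm_latticeChar_mul_exp]
    exact summable_exp_quadForm_intCast hA ht
  have h2 := hsum.sum_add_tsum_subtype_compl {0}
  rw [shiftedTheta, ofReal_mul, h, ← h2, ← mul_assoc, ← ofReal_mul, Real.inv_rpow ht.le,
    mul_inv_cancel₀ (Real.rpow_pos_of_pos ht _).ne', ofReal_one, one_mul, Finset.sum_singleton]
  have h0 : latticeChar x 0 * (Real.exp (-π * t * quadForm A fun i => (0 : Fin d → ℤ) i) : ℂ) = 1 := by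
    have : quadForm A (fun i => (((0 : Fin d → ℤ) i : ℤ) : ℝ)) = 0 := by
      rw [show (fun i => (((0 : Fin d → ℤ) i : ℤ) : ℝ)) = 0 from funext fun i => by simp]
      simp [quadForm]
    rw [this]
    simp [latticeChar]
  rw [h0, add_sub_cancel_left, puncturedTheta]
  exact (Equiv.subtypeEquivRight fun n : Fin d → ℤ => by simp).tsum_eq
    fun n : {n : Fin d → ℤ // n ∉ ({0} : Finset (Fin d → ℤ))} =>
      latticeChar x n.1 * (Real.exp (-π * t * quadForm A fun i => n.1 i) : ℂ)

lemma continuousOn_puncturedTheta {A : Matrix (Fin d) (Fin d) ℝ} (hA : IsUnit A.det)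
    (x : Fin d → ℝ) : ContinuousOn (puncturedTheta A x) (Set.Ioi 0) := by
  intro t ht
  refine ContinuousAt.continuousWithinAt ?_
  have ht2 : 0 < t / 2 := half_pos ht
  refine ContinuousOn.continuousAt (s := Set.Ici (t / 2)) ?_ (Ici_mem_nhds (half_lt_self ht))
  refine continuousOn_tsum (fun n => by fun_prop)
    ((summable_exp_quadForm_intCast hA ht2).subtype {n | n ≠ 0}) fun n r hr => ?_
  rw [norm_latticeChar_mul_exp]
  refine Real.exp_le_exp.2 ?_
  have := mul_le_mul_of_nonneg_right (mul_le_mul_of_nonneg_left (Set.mem_Ici.1 hr) Real.pi_pos.le)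
    (quadForm_nonneg A fun i => n.1 i)
  simp only [neg_mul]
  linarith

lemma exists_norm_puncturedTheta_le {A B : Matrix (Fin d) (Fin d) ℝ} (hd : 1 ≤ d)
    (hA : IsUnit A.det) (hdet : |A.det| = 1) (hB : B = A⁻¹.transpose) {x : Fin d → ℝ} {δ : ℝ}
    (hδ : 0 < δ) (hx : ∀ n : Fin d → ℤ, δ ≤ quadForm B (fun i => n i + x i)) :
    ∃ C k : ℝ, 0 < k ∧ ∀ t : ℝ, 0 < t → ‖puncturedTheta A x t‖ ≤ C * Real.exp (-k * t) := by
  obtain ⟨c, hc, hcA⟩ := exists_pos_le_quadForm_intCast hA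
  have hBu : IsUnit B.det := by
    rw [hB, Matrix.det_transpose]
    exact Matrix.isUnit_nonsing_inv_det_iff.2 hA
  have hd2 : (0 : ℝ) < d / 2 := by
    have : (0 : ℝ) < d := by exact_mod_cast hd
    positivity
  set C₁ : ℝ := Real.exp (π * c) *
    ∑' n : {n : Fin d → ℤ // n ≠ 0}, Real.exp (-π * 1 * quadForm A fun i => n.1 i)
  set C₂ : ℝ := Real.exp (π * δ) *
    ∑' n : Fin d → ℤ, Real.exp (-π * 1 * quadForm B fun i => n i + x i)
  have hC₁ : 0 ≤ C₁ := mul_nonneg (Real.exp_pos _).le (tsum_nonneg fun _ => (Real.exp_pos _).le)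
  have hC₂ : 0 ≤ C₂ := mul_nonneg (Real.exp_pos _).le (tsum_nonneg fun _ => (Real.exp_pos _).le)
  set C₃ : ℝ := (d / 2 / (π * δ)) ^ ((d : ℝ) / 2) * C₂ + 1
  have hC₃ : 0 ≤ C₃ := by positivity
  refine ⟨C₁ + C₃ * Real.exp (π * c), π * c, by positivity, fun t ht => ?_⟩
  rcases le_total 1 t with h1 | h1
  · have hs : ∀ r : ℝ, 0 < r → Summable fun n : {n : Fin d → ℤ // n ≠ 0} =>
        Real.exp (-π * r * quadForm A fun i => n.1 i) := fun r hr =>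
      (summable_exp_quadForm_intCast hA hr).subtype {n | n ≠ 0}
    have hle := tsum_exp_neg_mul_le (fun n : {n : Fin d → ℤ // n ≠ 0} => hcA n.1 n.2) hs h1
    refine (norm_tsum_le_tsum_norm ?_).trans ?_
    · simp_rw [norm_latticeChar_mul_exp]
      exact hs t ht
    · simp_rw [norm_latticeChar_mul_exp]
      refine hle.trans (mul_le_mul_of_nonneg_right ?_ (Real.exp_pos _).le)
      exact le_add_of_nonneg_right (by positivity)
  · have hu : 1 ≤ t⁻¹ := (one_le_inv₀ ht).2 h1
    have hle := tsum_exp_neg_mul_le hx (fun r hr => summable_exp_quadForm hBu hr x) hu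
    have hpow := rpow_le_mul_exp hd2 (by positivity : 0 < π * δ) (inv_pos.2 ht).le
    have hS : 0 ≤ shiftedTheta B x t⁻¹ := tsum_nonneg fun _ => (Real.exp_pos _).le
    have hA1 : ‖puncturedTheta A x t‖ ≤ C₃ := by
      rw [puncturedTheta_eq hA hdet hB ht]
      refine (norm_sub_le _ _).trans ?_
      rw [norm_one, norm_real, Real.norm_of_nonneg (by positivity), neg_div, Real.rpow_neg ht.le,
        ← Real.inv_rpow ht.le]
      refine add_le_add_left ?_ 1
      calc t⁻¹ ^ ((d : ℝ) / 2) * shiftedTheta B x t⁻¹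
          ≤ ((d / 2 / (π * δ)) ^ ((d : ℝ) / 2) * Real.exp (π * δ * t⁻¹)) *
            (C₂ * Real.exp (-(π * δ) * t⁻¹)) := by
            exact mul_le_mul hpow hle hS (by positivity)
        _ = (d / 2 / (π * δ)) ^ ((d : ℝ) / 2) * C₂ *
            (Real.exp (π * δ * t⁻¹) * Real.exp (-(π * δ) * t⁻¹)) := by ring
        _ = _ := by rw [← Real.exp_add, neg_mul, add_neg_cancel, Real.exp_zero, mul_one]
    refine hA1.trans ?_
    have : 1 ≤ Real.exp (π * c) * Real.exp (-(π * c) * t) := by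
      rw [← Real.exp_add, Real.one_le_exp_iff]
      have : 0 < π * c := by positivity
      nlinarith
    calc C₃ = C₃ * 1 := (mul_one _).symm
      _ ≤ C₃ * (Real.exp (π * c) * Real.exp (-(π * c) * t)) := mul_le_mul_of_nonneg_left this hC₃
      _ = C₃ * Real.exp (π * c) * Real.exp (-(π * c) * t) := by ring
      _ ≤ _ := mul_le_mul_of_nonneg_right (le_add_of_nonneg_left hC₁) (Real.exp_pos _).le

section Mellin

variable {F : ℝ → ℂ} {C k p : ℝ}

lemma integrableOn_exp_mul_rpow (hk : 0 < k) (hp : 0 < p) :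
    IntegrableOn (fun t : ℝ => C * Real.exp (-k * t) * t ^ (p - 1)) (Set.Ioi 0) := by
  have := (integrableOn_rpow_mul_exp_neg_mul_rpow (by linarith : -1 < p - 1) one_pos hk).const_mul C
  refine IntegrableOn.congr_fun this (fun t _ => ?_) measurableSet_Ioi
  simp only [Real.rpow_one]
  ring

lemma aestronglyMeasurable_mul_rpow (hF : ContinuousOn F (Set.Ioi 0)) {ε : ℝ} (hε : 0 ≤ ε) :
    AEStronglyMeasurable (fun t : ℝ => F (t + ε) * ((t ^ (p - 1) : ℝ) : ℂ))
      (volume.restrict (Set.Ioi 0)) := by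
  refine ContinuousOn.aestronglyMeasurable ?_ measurableSet_Ioi
  refine ContinuousOn.mul (hF.comp (by fun_prop) fun t ht => ?_) ?_
  · simp only [Set.mem_Ioi] at ht ⊢
    linarith
  · refine continuous_ofReal.comp_continuousOn fun t ht => ?_
    exact (Real.continuousAt_rpow_const t (p - 1) (Or.inl (ne_of_gt ht))).continuousWithinAt

lemma norm_mul_rpow_le (hk : 0 < k) (hb : ∀ t : ℝ, 0 < t → ‖F t‖ ≤ C * Real.exp (-k * t))
    {ε t : ℝ} (hε : 0 ≤ ε) (ht : 0 < t) :
    ‖F (t + ε) * ((t ^ (p - 1) : ℝ) : ℂ)‖ ≤ C * Real.exp (-k * t) * t ^ (p - 1) := by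
  have hC : 0 ≤ C := by
    have h := (norm_nonneg _).trans (hb 1 one_pos)
    exact nonneg_of_mul_nonneg_left h (Real.exp_pos _)
  rw [norm_mul, norm_real, Real.norm_of_nonneg (Real.rpow_nonneg ht.le _)]
  refine mul_le_mul_of_nonneg_right ((hb _ (by linarith)).trans ?_) (Real.rpow_nonneg ht.le _)
  refine mul_le_mul_of_nonneg_left (Real.exp_le_exp.2 ?_) hC
  nlinarith

lemma integrableOn_mul_rpow (hk : 0 < k) (hp : 0 < p) (hF : ContinuousOn F (Set.Ioi 0))
    (hb : ∀ t : ℝ, 0 < t → ‖F t‖ ≤ C * Real.exp (-k * t)) :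
    IntegrableOn (fun t : ℝ => F t * ((t ^ (p - 1) : ℝ) : ℂ)) (Set.Ioi 0) := by
  refine (integrableOn_exp_mul_rpow (C := C) hk hp).mono' ?_
    ((ae_restrict_iff' measurableSet_Ioi).2 (ae_of_all _ fun t ht => ?_))
  · simpa using aestronglyMeasurable_mul_rpow (p := p) hF le_rfl
  · simpa using norm_mul_rpow_le (p := p) hk hb le_rfl ht

lemma tendsto_integral_comp_add_mul_rpow (hk : 0 < k) (hp : 0 < p)
    (hF : ContinuousOn F (Set.Ioi 0)) (hb : ∀ t : ℝ, 0 < t → ‖F t‖ ≤ C * Real.exp (-k * t)) :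
    Tendsto (fun ε : ℝ => ∫ t in Set.Ioi (0 : ℝ), F (t + ε) * ((t ^ (p - 1) : ℝ) : ℂ))
      (𝓝[>] 0) (𝓝 (∫ t in Set.Ioi (0 : ℝ), F t * ((t ^ (p - 1) : ℝ) : ℂ))) := by
  refine tendsto_integral_filter_of_dominated_convergence
    (fun t => C * Real.exp (-k * t) * t ^ (p - 1)) ?_ ?_ (integrableOn_exp_mul_rpow hk hp) ?_
  · filter_upwards [self_mem_nhdsWithin] with ε hε
    exact aestronglyMeasurable_mul_rpow hF (le_of_lt hε)
  · filter_upwards [self_mem_nhdsWithin] with ε hε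
    exact (ae_restrict_iff' measurableSet_Ioi).2 (ae_of_all _ fun t ht =>
      norm_mul_rpow_le hk hb (le_of_lt hε) ht)
  · refine (ae_restrict_iff' measurableSet_Ioi).2 (ae_of_all _ fun t ht => ?_)
    refine Tendsto.mul_const _ ?_
    have h1 : ContinuousAt F t := hF.continuousAt (Ioi_mem_nhds ht)
    refine h1.tendsto.comp ?_
    have : Tendsto (fun ε : ℝ => t + ε) (𝓝 0) (𝓝 (t + 0)) := by
      exact (continuous_const.add continuous_id).tendsto 0
    rw [add_zero] at this
    exact this.mono_left nhdsWithin_le_nhds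

end Mellin

lemma setIntegral_Ioo_inv (g : ℝ → ℂ) :
    ∫ t in Set.Ioo (0 : ℝ) 1, ((t ^ (-2 : ℝ) : ℝ) : ℂ) * g t⁻¹ = ∫ u in Set.Ioi (1 : ℝ), g u := by
  have h := integral_comp_rpow_Ioi ((Set.Ioi (1 : ℝ)).indicator g) (p := -1) (by norm_num)
  rw [setIntegral_indicator measurableSet_Ioi, Set.inter_eq_self_of_subset_right
    (Set.Ioi_subset_Ioi zero_le_one)] at h
  rw [← h, ← Set.Ioi_inter_Iio, ← setIntegral_indicator measurableSet_Iio]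
  refine setIntegral_congr_fun measurableSet_Ioi fun t ht => ?_
  have ht' : (0 : ℝ) < t := ht
  by_cases h1 : t < 1
  · have h2 : 1 < t⁻¹ := (one_lt_inv₀ ht').2 h1
    rw [Set.indicator_of_mem (Set.mem_Iio.2 h1)]
    simp only [Real.rpow_neg_one]
    rw [Set.indicator_of_mem (Set.mem_Ioi.2 h2), abs_neg, abs_one, one_mul, real_smul]
    norm_num
  · have h2 : ¬ 1 < t⁻¹ := fun h => h1 ((one_lt_inv₀ ht').1 h)
    rw [Set.indicator_of_notMem (by simpa using h1)]
    simp only [Real.rpow_neg_one]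
    rw [Set.indicator_of_notMem (by simpa using h2), smul_zero]

/-- The value at `s = 2p` of the analytic continuation of Epstein's zeta function, up to the
Gamma factor, is a Mellin transform. -/
lemma integral_puncturedTheta {A B : Matrix (Fin d) (Fin d) ℝ} (hd : 1 ≤ d)
    (hA : IsUnit A.det) (hdet : |A.det| = 1) (hB : B = A⁻¹.transpose) {x : Fin d → ℝ} {δ : ℝ}
    (hδ : 0 < δ) (hx : ∀ n : Fin d → ℤ, δ ≤ quadForm B (fun i => n i + x i)) {p : ℝ} (hp : 0 < p) :
    ∫ t in Set.Ioi (0 : ℝ), puncturedTheta A x t * ((t ^ (p - 1) : ℝ) : ℂ) =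
      ((-p⁻¹ : ℝ) : ℂ) +
        (∫ t in Set.Ioi (1 : ℝ), puncturedTheta A x t * ((t ^ (p - 1) : ℝ) : ℂ)) +
        ((∫ t in Set.Ioi (1 : ℝ), shiftedTheta B x t * t ^ ((d : ℝ) / 2 - p - 1) : ℝ) : ℂ) := by
  obtain ⟨C, k, hk, hC⟩ := exists_norm_puncturedTheta_le hd hA hdet hB hδ hx
  have hint := integrableOn_mul_rpow hk hp (continuousOn_puncturedTheta hA x) hC
  have hIoc : Set.Ioi (0 : ℝ) = Set.Ioc 0 1 ∪ Set.Ioi 1 :=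
    (Set.Ioc_union_Ioi_eq_Ioi zero_le_one).symm
  have hdisj : Disjoint (Set.Ioc (0 : ℝ) 1) (Set.Ioi 1) :=
    Set.disjoint_left.2 fun t h1 h2 => not_lt.2 h1.2 h2
  rw [hIoc, setIntegral_union hdisj measurableSet_Ioi (hint.mono_set Set.Ioc_subset_Ioi_self)
    (hint.mono_set (Set.Ioi_subset_Ioi zero_le_one)), integral_Ioc_eq_integral_Ioo]
  have hpow : IntegrableOn (fun t : ℝ => ((t ^ (p - 1) : ℝ) : ℂ)) (Set.Ioo 0 1) := by
    refine Integrable.ofReal ?_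
    exact (intervalIntegral.integrableOn_Ioo_rpow_iff zero_lt_one).2 (by linarith)
  have hval : ∫ t in Set.Ioo (0 : ℝ) 1, ((t ^ (p - 1) : ℝ) : ℂ) = ((p⁻¹ : ℝ) : ℂ) := by
    rw [integral_complex_ofReal, ← integral_Ioc_eq_integral_Ioo,
      ← intervalIntegral.integral_of_le zero_le_one, integral_rpow (Or.inl (by linarith))]
    simp [hp.ne']
  have h1 : ∫ t in Set.Ioo (0 : ℝ) 1, puncturedTheta A x t * ((t ^ (p - 1) : ℝ) : ℂ) =
      (∫ t in Set.Ioo (0 : ℝ) 1, (puncturedTheta A x t * ((t ^ (p - 1) : ℝ) : ℂ) +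
        ((t ^ (p - 1) : ℝ) : ℂ))) - ((p⁻¹ : ℝ) : ℂ) := by
    rw [integral_add (hint.mono_set Set.Ioo_subset_Ioi_self) hpow, hval, add_sub_cancel_right]
  have h2 : ∫ t in Set.Ioo (0 : ℝ) 1, (puncturedTheta A x t * ((t ^ (p - 1) : ℝ) : ℂ) +
        ((t ^ (p - 1) : ℝ) : ℂ)) =
      ((∫ t in Set.Ioi (1 : ℝ), shiftedTheta B x t * t ^ ((d : ℝ) / 2 - p - 1) : ℝ) : ℂ) := by
    rw [← integral_complex_ofReal, ← setIntegral_Ioo_inv]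
    refine setIntegral_congr_fun measurableSet_Ioo fun t ht => ?_
    have ht0 : 0 < t := ht.1
    simp only [puncturedTheta_eq hA hdet hB ht0]
    rw [sub_mul, one_mul, sub_add_cancel, ← ofReal_mul]
    rw [← ofReal_mul]
    congr 1
    rw [Real.inv_rpow ht0.le, ← Real.rpow_neg ht0.le, mul_left_comm, ← Real.rpow_add ht0,
      mul_right_comm, ← Real.rpow_add ht0, mul_comm]
    congr 2
    ring
  rw [h1, h2]
  push_cast
  ring

/-- The regularized lattice sum as a Mellin transform. -/
lemma tsum_regularized_eq {A : Matrix (Fin d) (Fin d) ℝ} (hA : IsUnit A.det) (x : Fin d → ℝ)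
    {p : ℝ} (hp : 0 < p) {η : ℝ} (hη : 0 < η) :
    HasSum (fun n : {n : Fin d → ℤ // n ≠ 0} => latticeChar x n.1 *
      ((quadForm A (fun i => n.1 i) ^ (-p) * Real.exp (-η * quadForm A fun i => n.1 i) : ℝ) : ℂ))
      (((π ^ p / Real.Gamma p : ℝ) : ℂ) * ∫ t in Set.Ioi (0 : ℝ),
        puncturedTheta A x (t + η / π) * ((t ^ (p - 1) : ℝ) : ℂ)) := by
  obtain ⟨c, hc, hcA⟩ := exists_pos_le_quadForm_intCast hA
  have hpos : ∀ n : {n : Fin d → ℤ // n ≠ 0}, 0 < quadForm A fun i => n.1 i :=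
    fun n => hc.trans_le (hcA n.1 n.2)
  have hsum : ∀ r : ℝ, 0 < r → Summable fun n : {n : Fin d → ℤ // n ≠ 0} =>
      Real.exp (-π * r * quadForm A fun i => n.1 i) := fun r hr =>
    (summable_exp_quadForm_intCast hA hr).subtype {n | n ≠ 0}
  have hηπ : 0 < η / π := div_pos hη Real.pi_pos
  have hπη : ∀ y : ℝ, -η * y = -π * (η / π) * y := fun y => by
    field_simp
  have key := hasSum_mellin_pi_mul
    (a := fun n : {n : Fin d → ℤ // n ≠ 0} => latticeChar x n.1 *
      (Real.exp (-η * quadForm A fun i => n.1 i) : ℂ))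
    (q := fun n => quadForm A fun i => n.1 i)
    (F := fun t => puncturedTheta A x (t + η / π)) (s := (p : ℂ))
    (fun n => Or.inr (hpos n)) (by simpa using hp) (fun t ht => ?_) ?_
  · have hm : mellin (fun t => puncturedTheta A x (t + η / π)) (p : ℂ) =
        ∫ t in Set.Ioi (0 : ℝ), puncturedTheta A x (t + η / π) * ((t ^ (p - 1) : ℝ) : ℂ) := by
      refine setIntegral_congr_fun measurableSet_Ioi fun t ht => ?_
      have ht0 : (0 : ℝ) ≤ t := le_of_lt ht
      simp only
      rw [ofReal_cpow ht0, smul_eq_mul, mul_comm]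
      push_cast
      rfl
    rw [hm] at key
    have hG : (Real.Gamma p : ℂ) ≠ 0 := by exact_mod_cast (Real.Gamma_pos_of_pos hp).ne'
    have hπp : ((π ^ p : ℝ) : ℂ) ≠ 0 := by exact_mod_cast (Real.rpow_pos_of_pos Real.pi_pos p).ne'
    convert! key.mul_left ((π ^ p / Real.Gamma p : ℝ) : ℂ) using 1
    funext n
    rw [Complex.Gamma_ofReal, ← ofReal_neg, ← ofReal_cpow Real.pi_pos.le,
      ← ofReal_cpow (hpos n).le, Real.rpow_neg Real.pi_pos.le, Real.rpow_neg (hpos n).le]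
    have hQ : ((quadForm A (fun i => n.1 i) ^ p : ℝ) : ℂ) ≠ 0 := by
      exact_mod_cast (Real.rpow_pos_of_pos (hpos n) p).ne'
    simp only [ofReal_mul, ofReal_div, ofReal_inv]
    field_simp
  · have ht' : 0 < t + η / π := add_pos ht hηπ
    have hs : Summable fun n : {n : Fin d → ℤ // n ≠ 0} => latticeChar x n.1 *
        (Real.exp (-π * (t + η / π) * quadForm A fun i => n.1 i) : ℂ) := by
      refine Summable.of_norm ?_
      simp_rw [norm_latticeChar_mul_exp]
      exact hsum _ ht'
    convert! hs.hasSum using 1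
    funext n
    rw [mul_assoc, ← ofReal_mul, ← Real.exp_add, hπη]
    congr 3
    ring
  · refine ((hsum _ hηπ).mul_left (c ^ (-p))).of_nonneg_of_le (fun n => ?_) fun n => ?_
    · exact div_nonneg (norm_nonneg _) (Real.rpow_nonneg (hpos n).le _)
    · rw [norm_latticeChar_mul_exp, ofReal_re, hπη, div_eq_mul_inv, mul_comm,
        Real.rpow_neg hc.le]
      refine mul_le_mul_of_nonneg_right ?_ (Real.exp_pos _).le
      exact inv_anti₀ (Real.rpow_pos_of_pos hc p) (Real.rpow_le_rpow hc.le (hcA n.1 n.2) hp.le)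

lemma tendsto_tsum_regularized {A B : Matrix (Fin d) (Fin d) ℝ} (hd : 1 ≤ d)
    (hA : IsUnit A.det) (hdet : |A.det| = 1) (hB : B = A⁻¹.transpose) {x : Fin d → ℝ} {δ : ℝ}
    (hδ : 0 < δ) (hx : ∀ n : Fin d → ℤ, δ ≤ quadForm B (fun i => n i + x i)) {p : ℝ} (hp : 0 < p) :
    Tendsto (fun η : ℝ => ∑' n : {n : Fin d → ℤ // n ≠ 0}, latticeChar x n.1 *
        ((quadForm A (fun i => n.1 i) ^ (-p) * Real.exp (-η * quadForm A fun i => n.1 i) : ℝ) : ℂ))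
      (𝓝[>] 0) (𝓝 (((π ^ p / Real.Gamma p : ℝ) : ℂ) *
        (((-p⁻¹ : ℝ) : ℂ) +
        (∫ t in Set.Ioi (1 : ℝ), puncturedTheta A x t * ((t ^ (p - 1) : ℝ) : ℂ)) +
        ((∫ t in Set.Ioi (1 : ℝ), shiftedTheta B x t * t ^ ((d : ℝ) / 2 - p - 1) : ℝ) : ℂ)))) := by
  obtain ⟨C, k, hk, hC⟩ := exists_norm_puncturedTheta_le hd hA hdet hB hδ hx
  rw [← integral_puncturedTheta hd hA hdet hB hδ hx hp]
  have hlim := tendsto_integral_comp_add_mul_rpow hk hp (continuousOn_puncturedTheta hA x) hC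
  have hdiv : Tendsto (fun η : ℝ => η / π) (𝓝[>] 0) (𝓝[>] 0) := by
    refine tendsto_nhdsWithin_iff.2 ⟨?_, ?_⟩
    · have : Tendsto (fun η : ℝ => η / π) (𝓝 0) (𝓝 (0 / π)) := tendsto_id.div_const π
      rw [zero_div] at this
      exact this.mono_left nhdsWithin_le_nhds
    · filter_upwards [self_mem_nhdsWithin] with η hη
      exact div_pos hη Real.pi_pos
  refine ((hlim.comp hdiv).const_mul _).congr' ?_
  filter_upwards [self_mem_nhdsWithin] with η hη
  exact (tsum_regularized_eq hA x hp hη).tsum_eq.symm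

lemma summable_quadForm_rpow_mul_exp {A : Matrix (Fin d) (Fin d) ℝ} (hA : IsUnit A.det) {p : ℝ}
    (hp : 0 < p) {η : ℝ} (hη : 0 < η) :
    Summable fun n : {n : Fin d → ℤ // n ≠ 0} =>
      quadForm A (fun i => n.1 i) ^ (-p) * Real.exp (-η * quadForm A fun i => n.1 i) :=
  Summable.of_norm <| (tsum_regularized_eq hA 0 hp hη).summable.norm.congr fun n => by
    rw [norm_mul, norm_latticeChar, one_mul, norm_real]

lemma apply_emod_of_periodic {α : Type*} {N : ℕ} {g : (Fin d → ℤ) → α}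
    (hg : ∀ i, Function.Periodic g (Pi.single i (N : ℤ))) (m : Fin d → ℤ) :
    g (fun i => m i % N) = g m := by
  have key : ∀ (v : Fin d → ℤ) (s : Finset (Fin d)) (x : Fin d → ℤ),
      g (x + ∑ i ∈ s, v i • (Pi.single i (N : ℤ) : Fin d → ℤ)) = g x := by
    intro v s
    induction s using Finset.induction_on with
    | empty => simp
    | insert a s ha ih =>
      intro x
      rw [Finset.sum_insert ha, ← add_assoc, ih, (hg a).zsmul (v a) x]
  rw [← key (fun i => m i / N) Finset.univ (fun i => m i % N)]
  congr 1
  funext j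
  rw [Pi.add_apply, Finset.sum_apply, Finset.sum_eq_single j]
  · simp [mul_comm, Int.emod_add_mul_ediv]
  · intro i _ hij
    simp [Pi.single_eq_of_ne hij.symm]
  · simp

/-- The box `{0, …, N - 1}^d` in `ℤ^d`. -/
noncomputable def cell (d N : ℕ) : Finset (Fin d → ℤ) :=
  Fintype.piFinset fun _ : Fin d => Finset.Ico (0 : ℤ) (N : ℤ)

lemma mem_cell {N : ℕ} {y : Fin d → ℤ} : y ∈ cell d N ↔ ∀ i, 0 ≤ y i ∧ y i < N := by
  simp [cell]

lemma card_cell (N : ℕ) : (cell d N).card = N ^ d := by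
  simp [cell]

lemma emod_mem_cell {N : ℕ} (hN : 0 < N) (m : Fin d → ℤ) : (fun i => m i % (N : ℤ)) ∈ cell d N :=
  have hN' : (0 : ℤ) < N := by exact_mod_cast hN
  mem_cell.2 fun i => ⟨Int.emod_nonneg _ hN'.ne', Int.emod_lt_of_pos _ hN'⟩

lemma sum_cell_add {M : Type*} [AddCommMonoid M] {N : ℕ} (hN : 0 < N) {g : (Fin d → ℤ) → M}
    (hg : ∀ i, Function.Periodic g (Pi.single i (N : ℤ))) (m : Fin d → ℤ) :
    ∑ y ∈ cell d N, g (y + m) = ∑ y ∈ cell d N, g y := by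
  refine Finset.sum_bij' (fun y _ i => (y i + m i) % (N : ℤ)) (fun y _ i => (y i - m i) % (N : ℤ))
    (fun y _ => emod_mem_cell hN _) (fun y _ => emod_mem_cell hN _) (fun y hy => ?_)
    (fun y hy => ?_) (fun y _ => (apply_emod_of_periodic hg (y + m)).symm)
  · funext i
    rw [Int.emod_sub_emod, add_sub_cancel_right]
    exact Int.emod_eq_of_lt (mem_cell.1 hy i).1 (mem_cell.1 hy i).2
  · funext i
    rw [Int.emod_add_emod, sub_add_cancel]
    exact Int.emod_eq_of_lt (mem_cell.1 hy i).1 (mem_cell.1 hy i).2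

/-- The character `m ↦ e^{2πi m·k/N}` of `ℤ^d`. -/
noncomputable def dftChar (N : ℕ) (k m : Fin d → ℤ) : ℂ :=
  latticeChar (fun i => (k i : ℝ) / N) m

lemma dftChar_eq_exp (N : ℕ) (k m : Fin d → ℤ) :
    dftChar N k m = cexp (2 * (π : ℂ) * I * ((∑ i, m i * k i : ℤ) : ℂ) / (N : ℂ)) := by
  rw [dftChar, latticeChar]
  congr 1
  push_cast
  rw [mul_div_assoc, Finset.sum_div]
  simp only [mul_div_assoc]

lemma dftChar_comm (N : ℕ) (k m : Fin d → ℤ) : dftChar N k m = dftChar N m k := by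
  simp only [dftChar_eq_exp, mul_comm]

lemma dftChar_add (N : ℕ) (k m n : Fin d → ℤ) :
    dftChar N k (m + n) = dftChar N k m * dftChar N k n := by
  simp only [dftChar_eq_exp, ← Complex.exp_add, Pi.add_apply, add_mul, Finset.sum_add_distrib]
  congr 1
  push_cast
  ring

lemma dftChar_zero_left (N : ℕ) (m : Fin d → ℤ) : dftChar N 0 m = 1 := by
  simp [dftChar_eq_exp]

lemma norm_dftChar (N : ℕ) (k m : Fin d → ℤ) : ‖dftChar N k m‖ = 1 :=
  norm_latticeChar _ _

lemma dftChar_mul_conj (N : ℕ) (k m : Fin d → ℤ) :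
    dftChar N k m * (starRingEnd ℂ) (dftChar N k m) = 1 := by
  rw [Complex.mul_conj, Complex.normSq_eq_norm_sq, norm_dftChar]
  norm_num

lemma dftChar_single (N : ℕ) (k : Fin d → ℤ) (i : Fin d) (a : ℤ) :
    dftChar N k (Pi.single i a) = cexp (2 * π * I * (a * k i : ℤ) / N) := by
  rw [dftChar_eq_exp, Finset.sum_eq_single i]
  · simp
  · intro j _ hj
    simp [Pi.single_eq_of_ne hj]
  · simp

lemma periodic_dftChar {N : ℕ} (hN : 0 < N) (k : Fin d → ℤ) (i : Fin d) :
    Function.Periodic (dftChar N k) (Pi.single i (N : ℤ)) := fun m => by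
  have hN' : (N : ℂ) ≠ 0 := by exact_mod_cast hN.ne'
  rw [dftChar_add, dftChar_single, Complex.exp_eq_one_iff.2 ⟨k i, ?_⟩, mul_one]
  push_cast
  field_simp

lemma sum_dftChar {N : ℕ} (hN : 0 < N) {y : Fin d → ℤ} (hy : y ∈ cell d N) :
    ∑ k ∈ cell d N, dftChar N k y = if y = 0 then (N : ℂ) ^ d else 0 := by
  simp_rw [dftChar_comm N _ y]
  split_ifs with h
  · simp [h, dftChar_zero_left, card_cell]
  · obtain ⟨i, hi⟩ := Function.ne_iff.1 h
    have hsum := sum_cell_add hN (periodic_dftChar hN y) (Pi.single i 1)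
    simp_rw [dftChar_add] at hsum
    rw [← Finset.sum_mul] at hsum
    refine (mul_right_eq_self₀.1 hsum).resolve_left fun h1 => hi ?_
    rw [dftChar_single, Complex.exp_eq_one_iff] at h1
    obtain ⟨n, hn⟩ := h1
    have hN' : (N : ℂ) ≠ 0 := by exact_mod_cast hN.ne'
    have h2 : (y i : ℂ) = n * N := by
      rw [div_eq_iff hN', one_mul] at hn
      exact mul_left_cancel₀ Complex.two_pi_I_ne_zero (hn.trans (by ring))
    have h3 : y i = n * N := by exact_mod_cast h2
    exact Int.eq_zero_of_dvd_of_nonneg_of_lt (mem_cell.1 hy i).1 (mem_cell.1 hy i).2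
      ⟨n, h3.trans (mul_comm _ _)⟩

section Autocorrelation

variable {N : ℕ} {φ : (Fin d → ℤ) → ℝ}

lemma periodic_autocorrelation (hφ : ∀ i, Function.Periodic φ (Pi.single i (N : ℤ))) (i : Fin d) :
    Function.Periodic (fun m => ∑ y ∈ cell d N, φ y * φ (y + m)) (Pi.single i (N : ℤ)) := fun m => by
  simp only [← add_assoc, (hφ i) _]

lemma autocorrelation_neg (hN : 0 < N) (hφ : ∀ i, Function.Periodic φ (Pi.single i (N : ℤ)))
    (m : Fin d → ℤ) :
    ∑ y ∈ cell d N, φ y * φ (y + -m) = ∑ y ∈ cell d N, φ y * φ (y + m) := by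
  rw [← sum_cell_add hN (g := fun y => φ y * φ (y + -m)) _ m]
  · simp [mul_comm]
  · intro i y
    simp only [hφ i y, add_right_comm y _ (-m), hφ i (y + -m)]

/-- The Fourier transform of the autocorrelation is the squared modulus of the Fourier
transform. -/
lemma sum_autocorrelation_mul_dftChar (hN : 0 < N)
    (hφ : ∀ i, Function.Periodic φ (Pi.single i (N : ℤ))) (k : Fin d → ℤ) :
    ∑ m ∈ cell d N, ((∑ y ∈ cell d N, φ y * φ (y + m) : ℝ) : ℂ) * dftChar N k m =
      (‖∑ y ∈ cell d N, (φ y : ℂ) * dftChar N k y‖ ^ 2 : ℝ) := by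
  have hper : ∀ i, Function.Periodic (fun y => (φ y : ℂ) * dftChar N k y) (Pi.single i (N : ℤ)) :=
    fun i y => by simp only [hφ i y, periodic_dftChar hN k i y]
  rw [← Complex.normSq_eq_norm_sq, ← Complex.mul_conj, map_sum, Finset.mul_sum]
  simp only [ofReal_sum, Finset.sum_mul (s := cell d N) (f := fun y => ((φ y * φ (y + _) : ℝ) : ℂ))]
  rw [Finset.sum_comm]
  refine Finset.sum_congr rfl fun y _ => ?_
  rw [← sum_cell_add hN hper y, Finset.sum_mul]
  refine Finset.sum_congr rfl fun m _ => ?_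
  rw [dftChar_add, map_mul, conj_ofReal, ofReal_mul, add_comm m y]
  linear_combination (-(φ y : ℂ) * φ (y + m) * dftChar N k m) * dftChar_mul_conj N k y

lemma autocorrelation_eq_sum (hN : 0 < N) (hφ : ∀ i, Function.Periodic φ (Pi.single i (N : ℤ)))
    (m : Fin d → ℤ) :
    ((∑ y ∈ cell d N, φ y * φ (y + m) : ℝ) : ℂ) =
      ∑ k ∈ cell d N, (((N : ℂ) ^ d)⁻¹ * ∑ y ∈ cell d N,
        ((∑ z ∈ cell d N, φ z * φ (z + y) : ℝ) : ℂ) * dftChar N k y) * dftChar N k m := by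
  have hN' : (N : ℂ) ^ d ≠ 0 := pow_ne_zero _ (by exact_mod_cast hN.ne')
  set S : (Fin d → ℤ) → ℝ := fun m => ∑ y ∈ cell d N, φ y * φ (y + m) with hS
  have hSper : ∀ i, Function.Periodic S (Pi.single i (N : ℤ)) := periodic_autocorrelation hφ
  have hper : ∀ i, Function.Periodic
      (fun y => (S (y + -m) : ℂ) * ∑ k ∈ cell d N, dftChar N k y) (Pi.single i (N : ℤ)) := by
    intro i y
    simp only [add_right_comm y _ (-m), hSper i _, periodic_dftChar hN _ i y]
  have h := sum_cell_add hN hper m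
  have h0 : (0 : Fin d → ℤ) ∈ cell d N := mem_cell.2 fun i => ⟨le_rfl, by simpa using hN⟩
  have hR : ∑ y ∈ cell d N, (S (y + -m) : ℂ) * ∑ k ∈ cell d N, dftChar N k y =
      S m * (N : ℂ) ^ d := by
    rw [Finset.sum_eq_single_of_mem 0 h0, sum_dftChar hN h0, if_pos rfl, zero_add,
      show S (-m) = S m from autocorrelation_neg hN hφ m]
    intro y hy hy0
    rw [sum_dftChar hN hy, if_neg hy0, mul_zero]
  rw [hR] at h
  simp only [add_neg_cancel_right, Finset.mul_sum] at h
  rw [Finset.sum_comm] at h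
  change (S m : ℂ) = ∑ k ∈ cell d N, (((N : ℂ) ^ d)⁻¹ * ∑ y ∈ cell d N,
    (S y : ℂ) * dftChar N k y) * dftChar N k m
  rw [← mul_inv_cancel_right₀ hN' (S m : ℂ), ← h, mul_comm, Finset.mul_sum]
  simp only [dftChar_add, mul_assoc, Finset.sum_mul, Finset.mul_sum]

end Autocorrelation

lemma exists_pos_le_quadForm_add_div {B : Matrix (Fin d) (Fin d) ℝ} (hB : IsUnit B.det) {N : ℕ}
    (hN : 0 < N) {j : Fin d → ℤ} (hj : j ∈ cell d N) (hj0 : j ≠ 0) :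
    ∃ δ : ℝ, 0 < δ ∧ ∀ n : Fin d → ℤ, δ ≤ quadForm B (fun i => n i + (j i : ℝ) / N) := by
  obtain ⟨c, hc, hcB⟩ := quadForm_coercive hB
  have hN' : (0 : ℝ) < N := by exact_mod_cast hN
  obtain ⟨i, hi⟩ := Function.ne_iff.1 hj0
  refine ⟨c * ((N : ℝ) ^ 2)⁻¹, by positivity, fun n => le_trans ?_ (hcB _)⟩
  refine mul_le_mul_of_nonneg_left (le_trans ?_ (Finset.single_le_sum
    (f := fun i => ((n i : ℝ) + (j i : ℝ) / N) ^ 2) (fun i _ => sq_nonneg _)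
    (Finset.mem_univ i))) hc.le
  have hne : n i * N + j i ≠ 0 := by
    intro h
    have h1 := mem_cell.1 hj i
    have h2 : (N : ℤ) ∣ j i := ⟨-n i, by linarith⟩
    exact hi (Int.eq_zero_of_dvd_of_nonneg_of_lt h1.1 h1.2 h2)
  have h1 : (1 : ℝ) ≤ (n i * N + j i : ℝ) ^ 2 := by
    have : (1 : ℤ) ≤ (n i * N + j i) ^ 2 := Int.add_one_le_iff.2 (sq_pos_of_ne_zero hne)
    exact_mod_cast this
  have h2 : ((n i : ℝ) + (j i : ℝ) / N) ^ 2 = (n i * N + j i : ℝ) ^ 2 * ((N : ℝ) ^ 2)⁻¹ := by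
    field_simp
  rw [h2]
  exact le_mul_of_one_le_left (by positivity) h1

/-- Plancherel for the regularized energy. -/
lemma sum_tsum_eq_sum_dftChar {N : ℕ} {φ : (Fin d → ℤ) → ℝ} (hN : 0 < N)
    (hφ : ∀ i, Function.Periodic φ (Pi.single i (N : ℤ)))
    {ξ : (Fin d → ℤ) → ℂ}
    (hξ : ∀ m, ((∑ y ∈ cell d N, φ y * φ (y + m) : ℝ) : ℂ) =
      ∑ k ∈ cell d N, ξ k * dftChar N k m)
    {w : {m : Fin d → ℤ // m ≠ 0} → ℝ} (hw : Summable w) :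
    ((∑ y ∈ cell d N, ∑' m : {m : Fin d → ℤ // m ≠ 0}, φ y * φ (y + m.1) * w m : ℝ) : ℂ) =
      ∑ k ∈ cell d N, ξ k * ∑' m : {m : Fin d → ℤ // m ≠ 0}, dftChar N k m.1 * (w m : ℂ) := by
  have hbound : ∀ m, |φ m| ≤ ∑ y ∈ cell d N, |φ y| := fun m => by
    rw [← apply_emod_of_periodic hφ m]
    exact Finset.single_le_sum (f := fun y => |φ y|) (fun _ _ => abs_nonneg _) (emod_mem_cell hN m)
  have hs1 : ∀ y ∈ cell d N, Summable fun m : {m : Fin d → ℤ // m ≠ 0} =>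
      φ y * φ (y + m.1) * w m := fun y _ => by
    refine Summable.of_norm_bounded (hw.norm.mul_left (|φ y| * ∑ y ∈ cell d N, |φ y|)) fun m => ?_
    rw [norm_mul, norm_mul, Real.norm_eq_abs, Real.norm_eq_abs]
    gcongr
    exact hbound _
  have hs2 : ∀ k ∈ cell d N, Summable fun m : {m : Fin d → ℤ // m ≠ 0} =>
      ξ k * (dftChar N k m.1 * (w m : ℂ)) := fun k _ => by
    have h : Summable fun m : {m : Fin d → ℤ // m ≠ 0} => dftChar N k m.1 * (w m : ℂ) := by
      refine Summable.of_norm ?_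
      simp only [norm_mul, norm_dftChar, one_mul, norm_real]
      exact hw.norm
    exact h.mul_left (ξ k)
  rw [← Summable.tsum_finsetSum hs1, ofReal_tsum]
  simp_rw [← tsum_mul_left]
  rw [← Summable.tsum_finsetSum hs2]
  refine tsum_congr fun m => ?_
  rw [← Finset.sum_mul, ofReal_mul, hξ, Finset.sum_mul]
  simp only [mul_assoc]

end EwaldEpstein

/-- Relation to Epstein's zeta function: for the Riesz potential `f_s(x) = |x|^{−s}`,
`0 < s ≤ d`, on the unit-density lattice `X = Aℤ^d`, and an `N`-periodic normalized
charge-neutral `φ` with dual weights `ξ`, each `ξ(j)` is a nonnegative real, the Ewald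
energy exists and equals `(2N^d)⁻¹ ∑_{j∈K_N∖{0}} ξ(j) Z_j`, where `Z_j` is the analytic
continuation of Epstein's zeta function. -/
theorem ewald_energy_epstein_zeta (d N : ℕ) (hd : 1 ≤ d) (hN : 2 ≤ N)
    (s : ℝ) (hs0 : 0 < s) (hsd : s ≤ d)
    (A : Matrix (Fin d) (Fin d) ℝ) (hA : IsUnit A.det) (hdet : |A.det| = 1)
    (B : Matrix (Fin d) (Fin d) ℝ) (hB : B = A⁻¹.transpose)
    (K : Finset (Fin d → ℤ)) (hK : K = Fintype.piFinset fun _ : Fin d => Finset.Ico (0 : ℤ) (N : ℤ))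
    (φ : (Fin d → ℤ) → ℝ)
    (hφ : ∀ (m : Fin d → ℤ) (i : Fin d), φ (m + Pi.single i (N : ℤ)) = φ m)
    (hnorm : ((N : ℝ) ^ d)⁻¹ * ∑ y ∈ K, φ y ^ 2 = 1)
    (hneutral : ∑ y ∈ K, φ y = 0)
    (sac : (Fin d → ℤ) → ℝ) (hsac : ∀ m : Fin d → ℤ, sac m = ∑ y ∈ K, φ y * φ (y + m))
    (ξ : (Fin d → ℤ) → ℂ)
    (hξ : ∀ k : Fin d → ℤ, ξ k = ((N : ℂ) ^ d)⁻¹ *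
      ∑ y ∈ K, (sac y : ℂ) *
        Complex.exp (2 * (π : ℂ) * Complex.I * ((∑ i, y i * k i : ℤ) : ℂ) / (N : ℂ)))
    (Z : (Fin d → ℤ) → ℂ)
    (hZ : ∀ j : Fin d → ℤ, Z j = ((π ^ (s / 2) / Real.Gamma (s / 2) : ℝ) : ℂ) *
      (((-2 / s : ℝ) : ℂ) +
        (∫ t in Set.Ioi (1 : ℝ),
          (∑' n : {n : Fin d → ℤ // n ≠ 0},
            Complex.exp (2 * (π : ℂ) * Complex.I * ((∑ i, n.1 i * j i : ℤ) : ℂ) / (N : ℂ)) *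
              ((Real.exp (-π * t * ∑ i, (A.mulVec (fun l => (n.1 l : ℝ)) i) ^ 2) : ℝ) : ℂ)) *
            ((t ^ (s / 2 - 1) : ℝ) : ℂ)) +
        (((∫ t in Set.Ioi (1 : ℝ),
          (∑' n : Fin d → ℤ,
            Real.exp (-π * t *
              ∑ i, (B.mulVec (fun l => (n l : ℝ) + (j l : ℝ) / (N : ℝ)) i) ^ 2)) *
            t ^ (((d : ℝ) - s) / 2 - 1) : ℝ)) : ℂ))) :
    (∀ j : Fin d → ℤ, (ξ j).im = 0 ∧ 0 ≤ (ξ j).re) ∧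
    ∃ E : ℝ,
      Tendsto (fun η : ℝ =>
        (2 * (N : ℝ) ^ d)⁻¹ * ∑ y ∈ K, ∑' m : {m : Fin d → ℤ // m ≠ 0},
          φ y * φ (y + m.1) *
            Real.sqrt (∑ i, (A.mulVec (fun l => (m.1 l : ℝ)) i) ^ 2) ^ (-s) *
            Real.exp (-η * ∑ i, (A.mulVec (fun l => (m.1 l : ℝ)) i) ^ 2))
        (𝓝[>] (0 : ℝ)) (𝓝 E) ∧
      (E : ℂ) = (2 * (N : ℂ) ^ d)⁻¹ * ∑ j ∈ K.erase 0, ξ j * Z j := by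

  subst hK
  have hN0 : 0 < N := by omega
  have hper : ∀ i, Function.Periodic φ (Pi.single i (N : ℤ)) := fun i m => hφ m i
  have hξ1 : ∀ k, ξ k = ((N : ℂ) ^ d)⁻¹ * ∑ y ∈ EwaldEpstein.cell d N,
      ((∑ z ∈ EwaldEpstein.cell d N, φ z * φ (z + y) : ℝ) : ℂ) * EwaldEpstein.dftChar N k y := by
    intro k
    simp only [hξ, hsac, EwaldEpstein.dftChar_eq_exp, EwaldEpstein.cell]
  have hξ2 : ∀ k, ξ k = ((((N : ℝ) ^ d)⁻¹ *
      ‖∑ y ∈ EwaldEpstein.cell d N, (φ y : ℂ) * EwaldEpstein.dftChar N k y‖ ^ 2 : ℝ) : ℂ) := by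
    intro k
    rw [hξ1, EwaldEpstein.sum_autocorrelation_mul_dftChar hN0 hper]
    push_cast
    rfl
  have hξ0 : ξ 0 = 0 := by
    rw [hξ2]
    simp only [EwaldEpstein.dftChar_zero_left, mul_one, ← ofReal_sum]
    rw [show ∑ y ∈ EwaldEpstein.cell d N, φ y = 0 from hneutral]
    simp
  have hinv : ∀ m, ((∑ y ∈ EwaldEpstein.cell d N, φ y * φ (y + m) : ℝ) : ℂ) =
      ∑ k ∈ EwaldEpstein.cell d N, ξ k * EwaldEpstein.dftChar N k m := fun m => by
    simp only [hξ1]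
    exact EwaldEpstein.autocorrelation_eq_sum hN0 hper m
  refine ⟨fun j => ?_, ?_⟩
  · rw [hξ2]
    exact ⟨ofReal_im _, by rw [ofReal_re]; positivity⟩
  have hBu : IsUnit B.det := by
    rw [hB, Matrix.det_transpose]
    exact (Matrix.isUnit_nonsing_inv_det_iff).2 hA
  have hp : 0 < s / 2 := half_pos hs0
  have hlim : ∀ j ∈ (EwaldEpstein.cell d N).erase 0, Tendsto (fun η : ℝ =>
      ∑' m : {m : Fin d → ℤ // m ≠ 0}, EwaldEpstein.dftChar N j m.1 *
        ((EwaldEpstein.quadForm A (fun i => m.1 i) ^ (-(s / 2)) *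
          Real.exp (-η * EwaldEpstein.quadForm A fun i => m.1 i) : ℝ) : ℂ))
      (𝓝[>] 0) (𝓝 (Z j)) := by
    intro j hj
    obtain ⟨hj0, hj⟩ := Finset.mem_erase.1 hj
    obtain ⟨δ, hδ, hx⟩ := EwaldEpstein.exists_pos_le_quadForm_add_div hBu hN0 hj hj0
    have h := EwaldEpstein.tendsto_tsum_regularized hd hA hdet hB hδ hx hp
    have h1 : -2 / s = -(s / 2)⁻¹ := by field_simp
    have h2 : ((d : ℝ) - s) / 2 - 1 = (d : ℝ) / 2 - s / 2 - 1 := by ring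
    rw [hZ, h1, h2]
    simp only [← EwaldEpstein.dftChar_eq_exp]
    exact h
  have hsum := (tendsto_finsetSum _ fun j hj => (hlim j hj).const_mul (ξ j)).const_mul
    (2 * (N : ℂ) ^ d)⁻¹
  set F : ℝ → ℝ := fun η : ℝ =>
        (2 * (N : ℝ) ^ d)⁻¹ * ∑ y ∈ EwaldEpstein.cell d N, ∑' m : {m : Fin d → ℤ // m ≠ 0},
          φ y * φ (y + m.1) *
            Real.sqrt (∑ i, (A.mulVec (fun l => (m.1 l : ℝ)) i) ^ 2) ^ (-s) *
            Real.exp (-η * ∑ i, (A.mulVec (fun l => (m.1 l : ℝ)) i) ^ 2) with hF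
  have hFlim : Tendsto (fun η => (F η : ℂ)) (𝓝[>] 0)
      (𝓝 ((2 * (N : ℂ) ^ d)⁻¹ * ∑ j ∈ (EwaldEpstein.cell d N).erase 0, ξ j * Z j)) := by
    refine hsum.congr' ?_
    filter_upwards [self_mem_nhdsWithin] with η hη
    have hw := EwaldEpstein.summable_quadForm_rpow_mul_exp hA hp hη
    rw [Finset.sum_erase _ (by rw [hξ0, zero_mul]),
      ← EwaldEpstein.sum_tsum_eq_sum_dftChar hN0 hper hinv hw, hF]
    push_cast
    congr 1
    refine Finset.sum_congr rfl fun y _ => tsum_congr fun m => ?_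
    have hpow : Real.sqrt (EwaldEpstein.quadForm A fun i => m.1 i) ^ (-s) =
        EwaldEpstein.quadForm A (fun i => m.1 i) ^ (-(s / 2)) := by
      rw [Real.sqrt_eq_rpow, ← Real.rpow_mul (EwaldEpstein.quadForm_nonneg _ _)]
      congr 1
      ring
    rw [← hpow]
    simp only [EwaldEpstein.quadForm]
    push_cast
    ring
  have him : Tendsto (fun η => (F η : ℂ).im) (𝓝[>] (0 : ℝ)) _ :=
    (continuous_im.tendsto _).comp hFlim
  refine ⟨_, (continuous_re.tendsto _).comp hFlim, ?_⟩
  refine Complex.ext (ofReal_re _) ?_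
  rw [ofReal_im]
  exact tendsto_nhds_unique (by simp only [ofReal_im]; exact tendsto_const_nhds) him
end
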